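/- arXiv:1707.06504 — 7 statements merged into one kernel-verified Lean document; each statement's English description precedes it below -/
import Mathlib

section
/- Let K : ℝ^N → [0,∞) be measurable with K(x) = K(−x) for a.e. x and min(|x|,1)·K(x) ∈ L¹(ℝ^N). Then the functional E ↦ Per_K(E) is lower semicontinuous with respect to L¹_loc convergence of characteristic functions: if χ_{E_n} → χ_E in L¹_loc(ℝ^N), then Per_K(E) ≤ liminf_n Per_K(E_n). -/
open MeasureTheory Filter Metric
open scoped ENNReal Topology

/-- The nonlocal `K`-perimeter of a set `E ⊆ ℝ^N`:
`Per_K(E) = ∫_E ∫_{ℝ^N ∖ E} K(x-y) dy dx`. -/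
noncomputable def perK {N : ℕ} (W : EuclideanSpace ℝ (Fin N) → ℝ≥0∞)
    (E : Set (EuclideanSpace ℝ (Fin N))) : ℝ≥0∞ :=
  ∫⁻ x in E, ∫⁻ y in Eᶜ, W (x - y)

/-- Fatou's lemma for varying domains: integrands and domains may both vary with `n`. -/
theorem setLIntegral_le_liminf_of_eventually_mem {α : Type*} [MeasurableSpace α] {μ : Measure α}
    {f : α → ℝ≥0∞} {g : ℕ → α → ℝ≥0∞} {E : Set α} {F : ℕ → Set α}
    (hE : MeasurableSet E) (hF : ∀ n, MeasurableSet (F n)) (hg : ∀ n, Measurable (g n))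
    (hEF : ∀ᵐ x ∂μ, x ∈ E → ∀ᶠ n in atTop, x ∈ F n)
    (hfg : ∀ x, f x ≤ liminf (fun n => g n x) atTop) :
    ∫⁻ x in E, f x ∂μ ≤ liminf (fun n => ∫⁻ x in F n, g n x ∂μ) atTop := by
  simp_rw [← lintegral_indicator hE, ← lintegral_indicator (hF _)]
  refine (lintegral_mono_ae ?_).trans
    (lintegral_liminf_le fun n => (hg n).indicator (hF n))
  filter_upwards [hEF] with x hx
  by_cases hxE : x ∈ E
  · rw [Set.indicator_of_mem hxE]
    refine (hfg x).trans_eq (liminf_congr ?_)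
    filter_upwards [hx hxE] with n hn
    rw [Set.indicator_of_mem hn]
  · simp [hxE]

/-- `perK` is lower semicontinuous along almost everywhere convergence of sets. -/
theorem perK_le_liminf_of_ae_eventually_mem_iff {N : ℕ} {W : EuclideanSpace ℝ (Fin N) → ℝ≥0∞}
    (hW : Measurable W) {E : Set (EuclideanSpace ℝ (Fin N))} (hE : MeasurableSet E)
    {F : ℕ → Set (EuclideanSpace ℝ (Fin N))} (hF : ∀ n, MeasurableSet (F n))
    (hEF : ∀ᵐ x, ∀ᶠ n in atTop, (x ∈ F n ↔ x ∈ E)) :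
    perK W E ≤ liminf (fun n => perK W (F n)) atTop := by
  have hmeas : Measurable fun p : EuclideanSpace ℝ (Fin N) × EuclideanSpace ℝ (Fin N) =>
      W (p.1 - p.2) := hW.comp measurable_sub
  refine setLIntegral_le_liminf_of_eventually_mem hE hF
    (fun n => hmeas.lintegral_prod_right') ?_ fun x => ?_
  · filter_upwards [hEF] with x hx hxE
    exact hx.mono fun n hn => hn.2 hxE
  · refine setLIntegral_le_liminf_of_eventually_mem hE.compl (fun n => (hF n).compl)
      (fun n => hW.comp (measurable_const.sub measurable_id)) ?_ fun y => ?_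
    · filter_upwards [hEF] with y hy hyE
      exact hy.mono fun n hn hyF => hyE (hn.1 hyF)
    · simp

/-- Sets whose symmetric differences with `E` have summably small measure in growing balls
converge to `E` almost everywhere. -/
theorem ae_eventually_mem_iff_of_measure_symmDiff_inter_ball_lt {α : Type*}
    [SeminormedAddCommGroup α] [MeasurableSpace α] {μ : Measure α} {E : Set α} {F : ℕ → Set α}
    (h : ∀ n : ℕ, μ (symmDiff (F n) E ∩ ball (0 : α) (n + 1)) < 2⁻¹ ^ n) :
    ∀ᵐ x ∂μ, ∀ᶠ n in atTop, (x ∈ F n ↔ x ∈ E) := by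
  have hsum : ∑' n : ℕ, μ (symmDiff (F n) E ∩ ball (0 : α) (n + 1)) ≠ ∞ := by
    refine ne_top_of_le_ne_top ?_ (ENNReal.tsum_le_tsum fun n => (h n).le)
    rw [ENNReal.tsum_geometric, ENNReal.one_sub_inv_two, inv_inv]
    exact ENNReal.ofNat_ne_top
  filter_upwards [ae_eventually_notMem hsum] with x hx
  filter_upwards [hx, eventually_ge_atTop ⌈‖x‖⌉₊] with n hn hxn
  have hball : x ∈ ball (0 : α) (n + 1) := by
    rw [mem_ball_zero_iff]
    exact (Nat.ceil_le.1 hxn).trans_lt (lt_add_one _)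
  by_contra hiff
  refine hn ⟨?_, hball⟩
  rw [Set.mem_symmDiff]
  tauto

/-- `Per_K` is lower semicontinuous with respect to `L¹_loc` convergence of
characteristic functions: if `χ_{Eₙ} → χ_E` in `L¹_loc(ℝ^N)` (i.e. the measure of the symmetric
difference `Eₙ ∆ E` intersected with any ball tends to `0`), then
`Per_K(E) ≤ liminf_n Per_K(Eₙ)`. -/
theorem perK_lowerSemicontinuous {N : ℕ} (K : EuclideanSpace ℝ (Fin N) → ℝ)
    (hKmeas : Measurable K) (hKnonneg : ∀ x, 0 ≤ K x)
    (hKsymm : ∀ᵐ x ∂(volume : Measure (EuclideanSpace ℝ (Fin N))), K (-x) = K x)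
    (hKint : Integrable (fun x : EuclideanSpace ℝ (Fin N) => min ‖x‖ 1 * K x) volume)
    (E : Set (EuclideanSpace ℝ (Fin N))) (hE : MeasurableSet E)
    (En : ℕ → Set (EuclideanSpace ℝ (Fin N))) (hEn : ∀ n, MeasurableSet (En n))
    (hconv : ∀ R : ℝ, 0 < R →
      Tendsto (fun n => volume (symmDiff (En n) E ∩ ball (0 : EuclideanSpace ℝ (Fin N)) R))
        atTop (𝓝 0)) :
    perK (fun z => ENNReal.ofReal (K z)) E ≤
      liminf (fun n => perK (fun z => ENNReal.ofReal (K z)) (En n)) atTop := by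
  by_contra! hlt
  obtain ⟨c, hc, hcE⟩ := exists_between hlt
  have hfreq : ∀ n : ℕ, ∃ᶠ k in atTop, perK (fun z => ENNReal.ofReal (K z)) (En k) < c ∧
      volume (symmDiff (En k) E ∩ ball (0 : EuclideanSpace ℝ (Fin N)) (n + 1)) < 2⁻¹ ^ n :=
    fun n => (frequently_lt_of_liminf_lt (by isBoundedDefault) hc).and_eventually
      ((hconv (n + 1) n.cast_add_one_pos).eventually_lt_const (by simp [pos_iff_ne_zero]))
  obtain ⟨φ, -, hφ⟩ := extraction_forall_of_frequently hfreq
  have hle := perK_le_liminf_of_ae_eventually_mem_iff hKmeas.ennreal_ofReal hE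
    (fun n => hEn (φ n))
    (ae_eventually_mem_iff_of_measure_symmDiff_inter_ball_lt fun n => (hφ n).2)
  refine hcE.not_ge (hle.trans ?_)
  exact (liminf_le_liminf (Eventually.of_forall fun n => (hφ n).1.le)).trans_eq
    (liminf_const c)
end

section
/- Coarea formula: let K : ℝ^N → [0,∞) be measurable with K(x) = K(−x) for a.e. x and min(|x|,1)·K(x) ∈ L¹(ℝ^N). For every measurable function u : ℝ^N → ℝ one has J_K(u) = ∫_{−∞}^{+∞} Per_K({x : u(x) > s}) ds (as an identity in [0,∞]). -/
open MeasureTheory Filter Metric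
open scoped ENNReal Topology

/-- The nonlocal energy `J_K(u) = (1/2) ∫∫ |u(x) - u(y)| K(x-y) dx dy`, valued in `[0,∞]`. -/
noncomputable def JK {N : ℕ} (K u : EuclideanSpace ℝ (Fin N) → ℝ) : ℝ≥0∞ :=
  (1 / 2 : ℝ≥0∞) * ∫⁻ x, ∫⁻ y, ENNReal.ofReal |u x - u y| * ENNReal.ofReal (K (x - y))

/-- The energy density `∫∫ (u x - u y)⁺ W(x - y)` is the integral over all levels of the
`W`-perimeter of the superlevel sets. -/
theorem lintegral_perK_superlevel {N : ℕ} {W : EuclideanSpace ℝ (Fin N) → ℝ≥0∞}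
    (hW : Measurable W) {u : EuclideanSpace ℝ (Fin N) → ℝ} (hu : Measurable u) :
    ∫⁻ s : ℝ, perK W {x | s < u x} =
      ∫⁻ x, ∫⁻ y, ENNReal.ofReal (u x - u y) * W (x - y) := by
  have hF : Measurable fun p : (ℝ × EuclideanSpace ℝ (Fin N)) × EuclideanSpace ℝ (Fin N) =>
      (Set.Ico (u p.2) (u p.1.2)).indicator (fun _ => W (p.1.2 - p.2)) p.1.1 := by
    have hS : MeasurableSet
        {p : (ℝ × EuclideanSpace ℝ (Fin N)) × EuclideanSpace ℝ (Fin N) |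
          u p.2 ≤ p.1.1 ∧ p.1.1 < u p.1.2} :=
      (measurableSet_le (hu.comp measurable_snd) measurable_fst.fst).inter
        (measurableSet_lt measurable_fst.fst (hu.comp measurable_fst.snd))
    exact Measurable.indicator (f := fun p : (ℝ × EuclideanSpace ℝ (Fin N)) ×
      EuclideanSpace ℝ (Fin N) => W (p.1.2 - p.2)) (by fun_prop) hS
  have hperK (s : ℝ) : perK W {x | s < u x} =
      ∫⁻ x, ∫⁻ y, (Set.Ico (u y) (u x)).indicator (fun _ => W (x - y)) s := by
    have hE : MeasurableSet {x | s < u x} := measurableSet_lt measurable_const hu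
    rw [perK, ← lintegral_indicator hE]
    refine lintegral_congr fun x => ?_
    by_cases hx : s < u x
    · rw [Set.indicator_of_mem (by exact hx), ← lintegral_indicator hE.compl]
      refine lintegral_congr fun y => ?_
      simp [Set.indicator_apply, hx]
    · rw [Set.indicator_of_notMem (by exact hx)]
      simp [hx]
  simp_rw [hperK]
  rw [lintegral_lintegral_swap hF.lintegral_prod_right'.aemeasurable]
  refine lintegral_congr fun x => ?_
  rw [lintegral_lintegral_swap]
  · refine lintegral_congr fun y => ?_
    rw [lintegral_indicator measurableSet_Ico, setLIntegral_const, Real.volume_Ico, mul_comm]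
  · have hx : Measurable fun q : ℝ × EuclideanSpace ℝ (Fin N) => ((q.1, x), q.2) := by fun_prop
    exact (hF.comp hx).aemeasurable

/-- For an a.e. even kernel, integrating the positive part of `u x - u y` gives half of the
integral of `|u x - u y|`. -/
theorem lintegral_abs_sub_eq_two_mul {N : ℕ} {W : EuclideanSpace ℝ (Fin N) → ℝ≥0∞}
    (hW : Measurable W) (hsymm : ∀ᵐ x, W (-x) = W x)
    {u : EuclideanSpace ℝ (Fin N) → ℝ} (hu : Measurable u) :
    ∫⁻ x, ∫⁻ y, ENNReal.ofReal |u x - u y| * W (x - y) =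
      2 * ∫⁻ x, ∫⁻ y, ENNReal.ofReal (u x - u y) * W (x - y) := by
  have hG : Measurable fun p : EuclideanSpace ℝ (Fin N) × EuclideanSpace ℝ (Fin N) =>
      ENNReal.ofReal (u p.1 - u p.2) * W (p.1 - p.2) := by fun_prop
  have hswap : ∫⁻ x, ∫⁻ y, ENNReal.ofReal (u y - u x) * W (x - y) =
      ∫⁻ x, ∫⁻ y, ENNReal.ofReal (u x - u y) * W (x - y) := by
    rw [lintegral_lintegral_swap (by fun_prop)]
    refine lintegral_congr fun x => lintegral_congr_ae ?_
    filter_upwards [(Measure.measurePreserving_sub_left volume x).quasiMeasurePreserving.ae hsymm]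
      with y hy
    rw [← hy, neg_sub]
  have habs (a : ℝ) : ENNReal.ofReal |a| = ENNReal.ofReal a + ENNReal.ofReal (-a) := by
    rcases le_total 0 a with h | h
    · rw [abs_of_nonneg h, ENNReal.ofReal_of_nonpos (neg_nonpos.2 h), add_zero]
    · rw [abs_of_nonpos h, ENNReal.ofReal_of_nonpos h, zero_add]
  simp_rw [habs, neg_sub, add_mul]
  have hinner (x : EuclideanSpace ℝ (Fin N)) :
      ∫⁻ y, (ENNReal.ofReal (u x - u y) * W (x - y) + ENNReal.ofReal (u y - u x) * W (x - y)) =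
        (∫⁻ y, ENNReal.ofReal (u x - u y) * W (x - y)) +
          ∫⁻ y, ENNReal.ofReal (u y - u x) * W (x - y) :=
    lintegral_add_left (by fun_prop) _
  simp_rw [hinner]
  rw [lintegral_add_left hG.lintegral_prod_right', hswap, two_mul]

/-- Coarea formula: for every measurable `u : ℝ^N → ℝ`,
`J_K(u) = ∫_{-∞}^{∞} Per_K({u > s}) ds` as an identity in `[0,∞]`. -/
theorem coarea_formula {N : ℕ} (K : EuclideanSpace ℝ (Fin N) → ℝ)
    (hKmeas : Measurable K) (hKnonneg : ∀ x, 0 ≤ K x)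
    (hKsymm : ∀ᵐ x ∂(volume : Measure (EuclideanSpace ℝ (Fin N))), K (-x) = K x)
    (hKint : Integrable (fun x : EuclideanSpace ℝ (Fin N) => min ‖x‖ 1 * K x) volume)
    (u : EuclideanSpace ℝ (Fin N) → ℝ) (hu : Measurable u) :
    JK K u = ∫⁻ s : ℝ, perK (fun z => ENNReal.ofReal (K z)) {x | s < u x} := by
  have hW : Measurable fun z => ENNReal.ofReal (K z) := hKmeas.ennreal_ofReal
  have hsymm : ∀ᵐ x, ENNReal.ofReal (K (-x)) = ENNReal.ofReal (K x) :=
    hKsymm.mono fun x hx => by rw [hx]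
  rw [lintegral_perK_superlevel hW hu, JK, lintegral_abs_sub_eq_two_mul hW hsymm hu, ← mul_assoc,
    one_div, ENNReal.inv_mul_cancel two_ne_zero ENNReal.ofNat_ne_top, one_mul]
end

section
/- Isoperimetric inequality for radial kernels: let K : ℝ^N → [0,∞) be measurable with min(|x|,1)·K(x) ∈ L¹(ℝ^N), and assume K is radially symmetric and radially decreasing, i.e. K(x) = k(|x|) for a nonincreasing function k : [0,∞) → [0,∞). Then for every measurable set E ⊆ ℝ^N with |E| < ∞ one has Per_K(E) ≥ Per_K(B_{|E|}), where B_{|E|} is the ball centered at the origin with Lebesgue measure |E|. -/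
open MeasureTheory Filter Metric
open scoped ENNReal Topology

section Reflection

variable {V : Type*} [NormedAddCommGroup V] [InnerProductSpace ℝ V]

/-- Position of `x` relative to the bisector of `0` and `w`: positive on the side of `0`. -/
noncomputable def bisectorSide (w x : V) : ℝ := 1 - 2 * inner ℝ x w / ‖w‖ ^ 2

/-- The reflection exchanging `0` and `w`. -/
noncomputable def bisectorReflection (w x : V) : V := x + bisectorSide w x • w

variable {w : V}

lemma inner_eq_bisectorSide (hw : w ≠ 0) (x : V) :
    2 * inner ℝ x w = (1 - bisectorSide w x) * ‖w‖ ^ 2 := by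
  have : ‖w‖ ≠ 0 := norm_ne_zero_iff.2 hw
  unfold bisectorSide
  field_simp
  ring

lemma bisectorSide_reflection (hw : w ≠ 0) (x : V) :
    bisectorSide w (bisectorReflection w x) = -bisectorSide w x := by
  have : ‖w‖ ≠ 0 := norm_ne_zero_iff.2 hw
  have h := inner_eq_bisectorSide hw x
  rw [bisectorSide, bisectorReflection, inner_add_left, real_inner_smul_left,
    real_inner_self_eq_norm_sq, mul_add, h]
  field_simp
  ring

lemma bisectorReflection_involutive (hw : w ≠ 0) :
    Function.Involutive (bisectorReflection w) := by
  intro x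
  rw [bisectorReflection, bisectorSide_reflection hw, bisectorReflection, neg_smul,
    add_neg_cancel_right]

lemma norm_bisectorReflection_sq (hw : w ≠ 0) (x : V) :
    ‖bisectorReflection w x‖ ^ 2 = ‖x‖ ^ 2 + bisectorSide w x * ‖w‖ ^ 2 := by
  have h := inner_eq_bisectorSide hw x
  rw [bisectorReflection, norm_add_sq_real, real_inner_smul_right, norm_smul, mul_pow,
    Real.norm_eq_abs, sq_abs]
  linear_combination bisectorSide w x * h

lemma norm_sub_bisectorReflection_sq (hw : w ≠ 0) (x y : V) :
    ‖x - bisectorReflection w y‖ ^ 2 =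
      ‖x - y‖ ^ 2 + bisectorSide w x * bisectorSide w y * ‖w‖ ^ 2 := by
  have hx := inner_eq_bisectorSide hw x
  have hy := inner_eq_bisectorSide hw y
  rw [bisectorReflection, ← sub_sub, norm_sub_sq_real, real_inner_smul_right, norm_smul, mul_pow,
    Real.norm_eq_abs, sq_abs, inner_sub_left]
  linear_combination bisectorSide w y * (hy - hx)

lemma norm_bisectorReflection_sub (hw : w ≠ 0) (x y : V) :
    ‖bisectorReflection w x - bisectorReflection w y‖ = ‖x - y‖ := by
  have h := norm_sub_bisectorReflection_sq hw (bisectorReflection w x) y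
  rw [bisectorSide_reflection hw, norm_sub_rev (bisectorReflection w x) y,
    norm_sub_bisectorReflection_sq hw y x, norm_sub_rev y x] at h
  rw [← sq_eq_sq₀ (norm_nonneg _) (norm_nonneg _), h]
  ring

lemma norm_bisectorReflection_sub_eq (hw : w ≠ 0) (x y : V) :
    ‖bisectorReflection w x - y‖ = ‖x - bisectorReflection w y‖ := by
  conv_lhs => rw [← bisectorReflection_involutive hw y]
  exact norm_bisectorReflection_sub hw _ _

lemma bisectorReflection_eq_self {x : V} (h : bisectorSide w x = 0) :
    bisectorReflection w x = x := by simp [bisectorReflection, h]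

lemma bisectorReflection_eq_add (x : V) :
    bisectorReflection w x = (ℝ ∙ w)ᗮ.reflection x + w := by
  rw [Submodule.reflection_orthogonal_apply, Submodule.reflection_singleton_apply,
    bisectorReflection, bisectorSide, real_inner_comm, sub_smul, one_smul, mul_div_assoc,
    mul_smul, ← Nat.cast_smul_eq_nsmul ℝ]
  simp
  abel

/-- The bisector reflection exchanging two given points of different norms. -/
lemma exists_bisectorReflection_eq {x y : V} (h : ‖y‖ < ‖x‖) :
    ∃ w : V, ‖x‖ - ‖y‖ ≤ ‖w‖ ∧ ‖w‖ ≤ ‖x‖ + ‖y‖ ∧ bisectorReflection w y = x := by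
  have hne : x - y ≠ 0 := by
    intro h'
    rw [sub_eq_zero.1 h'] at h
    exact lt_irrefl _ h
  have hd : 0 < ‖x - y‖ := norm_pos_iff.2 hne
  have hsq : ‖x‖ ^ 2 - ‖y‖ ^ 2 = ‖x - y‖ ^ 2 + 2 * inner ℝ y (x - y) := by
    have := norm_add_sq_real y (x - y)
    rw [add_sub_cancel] at this
    linarith
  have hpos : 0 < ‖x‖ ^ 2 - ‖y‖ ^ 2 := by nlinarith [norm_nonneg x, norm_nonneg y]
  have hw : ‖((‖x‖ ^ 2 - ‖y‖ ^ 2) / ‖x - y‖ ^ 2) • (x - y)‖ =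
      (‖x‖ ^ 2 - ‖y‖ ^ 2) / ‖x - y‖ := by
    rw [norm_smul, Real.norm_of_nonneg (by positivity)]
    field_simp
  refine ⟨((‖x‖ ^ 2 - ‖y‖ ^ 2) / ‖x - y‖ ^ 2) • (x - y), ?_, ?_, ?_⟩
  · rw [hw, le_div_iff₀ hd]
    nlinarith [norm_sub_le x y]
  · rw [hw, div_le_iff₀ hd]
    nlinarith [norm_sub_norm_le x y, norm_nonneg x, norm_nonneg y]
  · rw [bisectorReflection, bisectorSide, hw, real_inner_smul_right, smul_smul]
    have : (1 - 2 * ((‖x‖ ^ 2 - ‖y‖ ^ 2) / ‖x - y‖ ^ 2 * inner ℝ y (x - y)) /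
        ((‖x‖ ^ 2 - ‖y‖ ^ 2) / ‖x - y‖) ^ 2) * ((‖x‖ ^ 2 - ‖y‖ ^ 2) / ‖x - y‖ ^ 2) = 1 := by
      field_simp
      linarith
    rw [this, one_smul, add_sub_cancel]

/-- As a function of its centre, `bisectorReflection` is Lipschitz away from `0`. -/
lemma lipschitzOnWith_bisectorReflection {η R : ℝ} (hη : 0 < η) (hR : 0 ≤ R) {y : V}
    (hy : ‖y‖ ≤ R) :
    LipschitzOnWith (Real.toNNReal (1 + 4 * R / η)) (fun w => bisectorReflection w y)
      {w : V | η ≤ ‖w‖} := by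
  apply LipschitzOnWith.of_dist_le_mul
  intro a ha b hb
  rw [Real.coe_toNNReal _ (by positivity)]
  simp only [Set.mem_ofPred_eq] at ha hb
  have ha0 : 0 < ‖a‖ := hη.trans_le ha
  have hb0 : 0 < ‖b‖ := hη.trans_le hb
  have hinv := dist_div_norm_sq_smul (norm_pos_iff.1 ha0) (norm_pos_iff.1 hb0) 1
  rw [dist_eq_norm, dist_eq_norm] at hinv
  have key : bisectorReflection a y - bisectorReflection b y =
      (a - b) - (2 : ℝ) • (inner ℝ y (a - b) • ((1 / ‖a‖) ^ 2 • a) +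
        inner ℝ y b • ((1 / ‖a‖) ^ 2 • a - (1 / ‖b‖) ^ 2 • b)) := by
    simp only [bisectorReflection, bisectorSide, inner_sub_right]
    module
  rw [dist_eq_norm, dist_eq_norm, key]
  have h1 : ‖inner ℝ y (a - b) • ((1 / ‖a‖) ^ 2 • a)‖ ≤ R / η * ‖a - b‖ := by
    rw [norm_smul, norm_smul, Real.norm_of_nonneg (by positivity : 0 ≤ (1 / ‖a‖) ^ 2)]
    have e : (1 / ‖a‖) ^ 2 * ‖a‖ = 1 / ‖a‖ := by field_simp
    rw [e]
    calc ‖inner ℝ y (a - b)‖ * (1 / ‖a‖) ≤ (R * ‖a - b‖) * (1 / η) := by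
          gcongr
          exact (norm_inner_le_norm _ _).trans (by gcongr)
      _ = R / η * ‖a - b‖ := by ring
  have h2 : ‖inner ℝ y b • ((1 / ‖a‖) ^ 2 • a - (1 / ‖b‖) ^ 2 • b)‖ ≤ R / η * ‖a - b‖ := by
    rw [norm_smul, hinv]
    calc ‖inner ℝ y b‖ * (1 ^ 2 / (‖a‖ * ‖b‖) * ‖a - b‖)
        ≤ (R * ‖b‖) * (1 ^ 2 / (‖a‖ * ‖b‖) * ‖a - b‖) := by
          gcongr
          exact (norm_inner_le_norm _ _).trans (by gcongr)
      _ = R / ‖a‖ * ‖a - b‖ := by field_simp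
      _ ≤ R / η * ‖a - b‖ := by gcongr
  calc _ ≤ ‖a - b‖ + ‖(2 : ℝ)‖ * (R / η * ‖a - b‖ + R / η * ‖a - b‖) := by
        refine (norm_sub_le _ _).trans ?_
        rw [norm_smul]
        gcongr
        exact (norm_add_le _ _).trans (add_le_add h1 h2)
    _ = (1 + 4 * R / η) * ‖a - b‖ := by
        rw [Real.norm_ofNat]
        ring

end Reflection

section Polarization

variable {V : Type*} [NormedAddCommGroup V] [InnerProductSpace ℝ V]

/-- The polarization of `E` with respect to the half-space of points closer to `0` than to `w`. -/
def polarize (w : V) (E : Set V) : Set V :=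
  {x | (x ∈ E ∧ bisectorReflection w x ∈ E) ∨
    (0 < bisectorSide w x ∧ (x ∈ E ∨ bisectorReflection w x ∈ E))}

variable {w x : V} {E : Set V}

lemma mem_polarize_of_nonneg (h : 0 ≤ bisectorSide w x) :
    x ∈ polarize w E ↔ x ∈ E ∨ bisectorReflection w x ∈ E := by
  rcases h.eq_or_lt with h | h
  · simp [polarize, bisectorReflection_eq_self h.symm, ← h]
  · simp only [polarize, Set.mem_ofPred_eq, h, true_and]
    tauto

lemma mem_polarize_of_nonpos (h : bisectorSide w x ≤ 0) :
    x ∈ polarize w E ↔ x ∈ E ∧ bisectorReflection w x ∈ E := by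
  simp [polarize, h.not_gt]

lemma reflection_mem_polarize_of_nonneg (hw : w ≠ 0) (h : 0 ≤ bisectorSide w x) :
    bisectorReflection w x ∈ polarize w E ↔ x ∈ E ∧ bisectorReflection w x ∈ E := by
  rw [mem_polarize_of_nonpos (by rw [bisectorSide_reflection hw]; linarith),
    bisectorReflection_involutive hw, and_comm]

lemma reflection_mem_polarize_of_nonpos (hw : w ≠ 0) (h : bisectorSide w x ≤ 0) :
    bisectorReflection w x ∈ polarize w E ↔ x ∈ E ∨ bisectorReflection w x ∈ E := by
  rw [mem_polarize_of_nonneg (by rw [bisectorSide_reflection hw]; linarith),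
    bisectorReflection_involutive hw, or_comm]

lemma norm_le_norm_bisectorReflection (hw : w ≠ 0) :
    ‖x‖ ≤ ‖bisectorReflection w x‖ ↔ 0 ≤ bisectorSide w x := by
  have : 0 < ‖w‖ ^ 2 := by positivity
  rw [← sq_le_sq₀ (norm_nonneg _) (norm_nonneg _), norm_bisectorReflection_sq hw,
    le_add_iff_nonneg_right, mul_nonneg_iff_of_pos_right this]

lemma polarize_subset_ball (hw : w ≠ 0) {R : ℝ} (hE : E ⊆ ball 0 R) :
    polarize w E ⊆ ball 0 R := by
  intro x hx
  rcases le_total 0 (bisectorSide w x) with h | h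
  · rcases (mem_polarize_of_nonneg h).1 hx with h' | h'
    · exact hE h'
    · have := hE h'
      rw [mem_ball_zero_iff] at this ⊢
      exact ((norm_le_norm_bisectorReflection hw).2 h).trans_lt this
  · exact hE ((mem_polarize_of_nonpos h).1 hx).1

variable [MeasurableSpace V] [BorelSpace V] [FiniteDimensional ℝ V]

lemma measurable_bisectorSide_uncurry :
    Measurable fun p : V × V => bisectorSide p.1 p.2 := by
  unfold bisectorSide
  fun_prop

lemma measurable_bisectorReflection_uncurry :
    Measurable fun p : V × V => bisectorReflection p.1 p.2 := by
  unfold bisectorReflection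
  exact measurable_snd.add (measurable_bisectorSide_uncurry.smul measurable_fst)

lemma measurable_bisectorSide (w : V) : Measurable (bisectorSide w) :=
  measurable_bisectorSide_uncurry.comp measurable_prodMk_left

lemma measurable_bisectorReflection (w : V) : Measurable (bisectorReflection w) :=
  measurable_bisectorReflection_uncurry.comp measurable_prodMk_left

lemma measurePreserving_bisectorReflection (w : V) :
    MeasurePreserving (bisectorReflection w) (volume : Measure V) volume := by
  have : bisectorReflection w = (· + w) ∘ (ℝ ∙ w)ᗮ.reflection :=
    funext bisectorReflection_eq_add
  rw [this]
  exact (measurePreserving_add_right volume w).comp ((ℝ ∙ w)ᗮ.reflection).measurePreserving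

lemma measurableSet_polarize (hE : MeasurableSet E) : MeasurableSet (polarize w E) := by
  have h := measurable_bisectorReflection w hE
  exact (hE.inter h).union
    ((measurableSet_lt measurable_const (measurable_bisectorSide w)).inter (hE.union h))

lemma lintegral_add_comp_bisectorReflection (w : V) {f : V → ℝ≥0∞} (hf : Measurable f) :
    ∫⁻ x, (f x + f (bisectorReflection w x)) = 2 * ∫⁻ x, f x := by
  rw [lintegral_add_left hf, (measurePreserving_bisectorReflection w).lintegral_comp hf, two_mul]

lemma lintegral_indicator_add_comp (w : V) {A : Set V} (hA : MeasurableSet A) :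
    ∫⁻ x, (A.indicator 1 x + A.indicator 1 (bisectorReflection w x)) = 2 * volume A := by
  rw [lintegral_add_comp_bisectorReflection w (measurable_one.indicator hA),
    lintegral_indicator_one hA]

lemma volume_polarize_le (hw : w ≠ 0) (hE : MeasurableSet E) :
    volume (polarize w E) ≤ volume E := by
  rw [← ENNReal.mul_le_mul_iff_right two_ne_zero ENNReal.ofNat_ne_top,
    ← lintegral_indicator_add_comp w hE,
    ← lintegral_indicator_add_comp w (measurableSet_polarize hE)]
  refine lintegral_mono fun x => ?_
  classical
  simp only [Set.indicator_apply, Pi.one_apply]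
  rcases le_total 0 (bisectorSide w x) with h | h
  · rw [mem_polarize_of_nonneg h, reflection_mem_polarize_of_nonneg hw h]
    by_cases h1 : x ∈ E <;> by_cases h2 : bisectorReflection w x ∈ E <;> simp [h1, h2]
  · rw [mem_polarize_of_nonpos h, reflection_mem_polarize_of_nonpos hw h]
    by_cases h1 : x ∈ E <;> by_cases h2 : bisectorReflection w x ∈ E <;> simp [h1, h2]

/-- Polarization moves the points of `E` outside a centred ball `B` whose reflection lies
in `B \ E` into the ball. -/
lemma volume_polarize_diff_ball_add_le (hw : w ≠ 0) (hE : MeasurableSet E) (r : ℝ) :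
    volume (polarize w E \ ball 0 r) +
      volume {y | y ∈ ball 0 r \ E ∧ bisectorReflection w y ∈ E \ ball 0 r} ≤
    volume (E \ ball 0 r) := by
  have hB : MeasurableSet (ball (0 : V) r) := measurableSet_ball
  have hT : MeasurableSet {y | y ∈ ball 0 r \ E ∧ bisectorReflection w y ∈ E \ ball 0 r} :=
    (hB.diff hE).inter (measurable_bisectorReflection w (hE.diff hB))
  have hP := (measurableSet_polarize (w := w) hE).diff hB
  rw [← ENNReal.mul_le_mul_iff_right two_ne_zero ENNReal.ofNat_ne_top, mul_add,
    ← lintegral_indicator_add_comp w (hE.diff hB), ← lintegral_indicator_add_comp w hT,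
    ← lintegral_indicator_add_comp w hP, ← lintegral_add_left]
  swap
  · exact (measurable_one.indicator hP).add
      ((measurable_one.indicator hP).comp (measurable_bisectorReflection w))
  refine lintegral_mono fun x => ?_
  classical
  simp only [Set.indicator_apply, Pi.one_apply, Set.mem_ofPred_eq, Set.mem_sdiff,
    bisectorReflection_involutive hw x]
  have hle := norm_le_norm_bisectorReflection (x := x) hw
  rcases le_total 0 (bisectorSide w x) with h | h
  · rw [mem_polarize_of_nonneg h, reflection_mem_polarize_of_nonneg hw h]
    have hb : bisectorReflection w x ∈ ball (0 : V) r → x ∈ ball (0 : V) r := by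
      simp only [mem_ball_zero_iff]
      exact (hle.2 h).trans_lt
    by_cases h1 : x ∈ E <;> by_cases h2 : bisectorReflection w x ∈ E <;>
      by_cases h3 : x ∈ ball (0 : V) r <;> by_cases h4 : bisectorReflection w x ∈ ball (0 : V) r <;>
      simp only [h1, h2, h3, h4] <;> first | exact absurd (hb h4) h3 | simp
  · rw [mem_polarize_of_nonpos h, reflection_mem_polarize_of_nonpos hw h]
    have hb : x ∈ ball (0 : V) r → bisectorReflection w x ∈ ball (0 : V) r := by
      simp only [mem_ball_zero_iff]
      have := norm_le_norm_bisectorReflection (x := bisectorReflection w x) hw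
      rw [bisectorReflection_involutive hw, bisectorSide_reflection hw] at this
      exact (this.2 (by linarith)).trans_lt
    by_cases h1 : x ∈ E <;> by_cases h2 : bisectorReflection w x ∈ E <;>
      by_cases h3 : x ∈ ball (0 : V) r <;> by_cases h4 : bisectorReflection w x ∈ ball (0 : V) r <;>
      simp only [h1, h2, h3, h4] <;> first | exact absurd (hb h3) h4 | simp

/-- The interaction energy of a set with itself. -/
noncomputable def selfInteraction (W : V → ℝ≥0∞) (E : Set V) : ℝ≥0∞ :=
  ∫⁻ p in E ×ˢ E, W (p.1 - p.2) ∂(volume.prod volume)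

lemma four_mul_selfInteraction (w : V) {W : V → ℝ≥0∞} (hW : Measurable W)
    (hE : MeasurableSet E) :
    ∫⁻ p : V × V,
      (((E ×ˢ E).indicator (fun p => W (p.1 - p.2)) p +
        (E ×ˢ E).indicator (fun p => W (p.1 - p.2)) (bisectorReflection w p.1, p.2)) +
      ((E ×ˢ E).indicator (fun p => W (p.1 - p.2)) (p.1, bisectorReflection w p.2) +
        (E ×ˢ E).indicator (fun p => W (p.1 - p.2))
          (bisectorReflection w p.1, bisectorReflection w p.2))) ∂(volume.prod volume) =
    4 * selfInteraction W E := by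
  have hE2 : MeasurableSet (E ×ˢ E) := hE.prod hE
  set f : V × V → ℝ≥0∞ := (E ×ˢ E).indicator (fun p => W (p.1 - p.2))
  have hfm : Measurable f :=
    (hW.comp (measurable_fst.sub measurable_snd)).indicator hE2
  have hσ := measurePreserving_bisectorReflection w
  have h1 := (hσ.prod (MeasurePreserving.id volume)).lintegral_comp hfm
  have h2 := ((MeasurePreserving.id volume).prod hσ).lintegral_comp hfm
  have h3 := (hσ.prod hσ).lintegral_comp hfm
  have m1 := hfm.comp (hσ.prod (MeasurePreserving.id volume)).measurable
  have m2 := hfm.comp ((MeasurePreserving.id volume).prod hσ).measurable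
  simp only [Prod.map, id, Function.comp_def] at h1 h2 h3 m1 m2
  have m0 : Measurable fun p : V × V => f p + f (bisectorReflection w p.1, p.2) := hfm.add m1
  rw [lintegral_add_left m0, lintegral_add_left hfm, lintegral_add_left m2, h1, h2, h3,
    selfInteraction, ← lintegral_indicator hE2]
  ring

/-- Polarization increases the interaction energy of radially decreasing kernels. -/
lemma selfInteraction_le_polarize (hw : w ≠ 0) {φ : ℝ → ℝ≥0∞} (hφ : AntitoneOn φ (Set.Ici 0))
    (hW : Measurable fun z : V => φ ‖z‖) (hE : MeasurableSet E) :
    selfInteraction (fun z => φ ‖z‖) E ≤ selfInteraction (fun z => φ ‖z‖) (polarize w E) := by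
  rw [← ENNReal.mul_le_mul_iff_right (four_ne_zero) ENNReal.ofNat_ne_top,
    ← four_mul_selfInteraction w hW hE,
    ← four_mul_selfInteraction w hW (measurableSet_polarize hE)]
  refine lintegral_mono fun p => ?_
  obtain ⟨x, y⟩ := p
  classical
  have hanti : ∀ {a b : V}, ‖a‖ ^ 2 ≤ ‖b‖ ^ 2 → φ ‖b‖ ≤ φ ‖a‖ := fun h =>
    hφ (norm_nonneg _) (norm_nonneg _) ((sq_le_sq₀ (norm_nonneg _) (norm_nonneg _)).1 h)
  have hsq := norm_sub_bisectorReflection_sq hw x y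
  simp only [Set.indicator_apply, Set.mem_prod, norm_bisectorReflection_sub hw,
    norm_bisectorReflection_sub_eq hw]
  rcases le_total 0 (bisectorSide w x) with hx | hx <;>
    rcases le_total 0 (bisectorSide w y) with hy | hy
  all_goals
    first
    | have h : φ ‖x - bisectorReflection w y‖ ≤ φ ‖x - y‖ := hanti (by
        have := mul_nonneg hx hy
        rw [hsq]
        nlinarith [mul_nonneg this (sq_nonneg ‖w‖)])
    | have h : φ ‖x - bisectorReflection w y‖ ≤ φ ‖x - y‖ := hanti (by
        have := mul_nonneg_of_nonpos_of_nonpos hx hy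
        rw [hsq]
        nlinarith [mul_nonneg this (sq_nonneg ‖w‖)])
    | have h : φ ‖x - y‖ ≤ φ ‖x - bisectorReflection w y‖ := hanti (by
        have : bisectorSide w x * bisectorSide w y ≤ 0 := by nlinarith
        rw [hsq]
        nlinarith [mul_nonneg (neg_nonneg.2 this) (sq_nonneg ‖w‖)])
    simp only [mem_polarize_of_nonneg, reflection_mem_polarize_of_nonneg hw,
      mem_polarize_of_nonpos, reflection_mem_polarize_of_nonpos hw, hx, hy]
    generalize φ ‖x - y‖ = P at *
    generalize φ ‖x - bisectorReflection w y‖ = Q at *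
    clear hsq hanti
    by_cases h1 : x ∈ E <;> by_cases h2 : bisectorReflection w x ∈ E <;>
      by_cases h3 : y ∈ E <;> by_cases h4 : bisectorReflection w y ∈ E <;>
      simp [h1, h2, h3, h4, h, add_comm]

end Polarization

section Rearrangement

variable {V : Type*} [NormedAddCommGroup V] [InnerProductSpace ℝ V] [MeasurableSpace V]
  [BorelSpace V] [FiniteDimensional ℝ V]

lemma volume_image_le_of_lipschitzOnWith {K : NNReal} {f : V → V} {s : Set V}
    (hf : LipschitzOnWith K f s) :
    volume (f '' s) ≤ (K : ℝ≥0∞) ^ Module.finrank ℝ V * volume s := by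
  have h := hf.hausdorffMeasure_image_le (d := Module.finrank ℝ V) (Nat.cast_nonneg _)
  rw [ENNReal.rpow_natCast] at h
  rw [← InnerProductSpace.euclideanHausdorffMeasure_eq_volume,
    Measure.euclideanHausdorffMeasure_def, Measure.smul_apply, Measure.smul_apply,
    ENNReal.smul_def, ENNReal.smul_def, smul_eq_mul, smul_eq_mul, mul_left_comm]
  gcongr

lemma volume_diff_le_diff {A B : Set V} (hA : MeasurableSet A) (hB : MeasurableSet B)
    (hAfin : volume A ≠ ⊤) (h : volume A ≤ volume B) : volume (A \ B) ≤ volume (B \ A) := by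
  rw [← measure_inter_add_sdiff A hB, ← measure_inter_add_sdiff B hA, Set.inter_comm B A] at h
  exact (ENNReal.add_le_add_iff_left (measure_ne_top_of_subset Set.inter_subset_left hAfin)).1 h

lemma exists_volume_annulus_le [Nontrivial V] {r : ℝ} (hr : 0 ≤ r) {ε : ℝ≥0∞} (hε : ε ≠ 0) :
    ∃ η > 0, volume (ball (0 : V) (r + η) \ ball 0 r) ≤ ε := by
  have hlim : Tendsto (fun η : ℝ => ENNReal.ofReal ((r + η) ^ Module.finrank ℝ V) *
      volume (ball (0 : V) 1)) (𝓝[>] 0) (𝓝 (volume (ball (0 : V) r))) := by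
    rw [Measure.addHaar_ball volume (0 : V) hr]
    refine ENNReal.Tendsto.mul_const ?_ (Or.inr measure_ball_lt_top.ne)
    have : Continuous fun η : ℝ => ENNReal.ofReal ((r + η) ^ Module.finrank ℝ V) :=
      ENNReal.continuous_ofReal.comp (by fun_prop)
    simpa using (this.tendsto 0).mono_left nhdsWithin_le_nhds
  have hlt : volume (ball (0 : V) r) < volume (ball (0 : V) r) + ε :=
    ENNReal.lt_add_right measure_ball_lt_top.ne hε
  obtain ⟨η, h1, h2⟩ := ((hlim.eventually (gt_mem_nhds hlt)).and self_mem_nhdsWithin).exists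
  have hη : (0 : ℝ) < η := h2
  refine ⟨η, hη, ?_⟩
  rw [← Measure.addHaar_ball volume (0 : V) (by positivity)] at h1
  rw [measure_sdiff (ball_subset_ball (by linarith)) measurableSet_ball.nullMeasurableSet
    measure_ball_lt_top.ne, tsub_le_iff_left]
  exact h1.le

/-- Among sets in a fixed ball having a given amount of mass outside `ball 0 r`, some polarization
brings a uniformly positive amount of mass into `ball 0 r`. -/
lemma exists_volume_gain [Nontrivial V] {r R : ℝ} (hr : 0 ≤ r) (hrR : r ≤ R) {ε : ℝ≥0∞}
    (hε : ε ≠ 0) (hεtop : ε ≠ ⊤) :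
    ∃ δ : ℝ≥0∞, δ ≠ 0 ∧ ∀ E : Set V, MeasurableSet E → E ⊆ ball 0 R →
      volume E ≤ volume (ball (0 : V) r) → ε ≤ volume (E \ ball 0 r) →
      ∃ w : V, w ≠ 0 ∧
        δ ≤ volume {y | y ∈ ball 0 r \ E ∧ bisectorReflection w y ∈ E \ ball 0 r} := by
  have hε2 : ε / 2 ≠ 0 := (ENNReal.half_pos hε).ne'
  obtain ⟨η, hη, hann⟩ := exists_volume_annulus_le (V := V) hr hε2
  set L : ℝ≥0∞ := (Real.toNNReal (1 + 4 * R / η) : ℝ≥0∞) ^ Module.finrank ℝ V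
  set U : ℝ≥0∞ := volume (closedBall (0 : V) (2 * R))
  have hLU : L * U ≠ ⊤ := ENNReal.mul_ne_top (ENNReal.pow_ne_top ENNReal.coe_ne_top)
    measure_closedBall_lt_top.ne
  obtain ⟨δ, hδ, hδlt⟩ := ENNReal.exists_nnreal_pos_mul_lt hLU (mul_ne_zero hε hε2)
  refine ⟨δ, by exact_mod_cast hδ.ne', fun E hE hER hEr hεE => ?_⟩
  by_contra! hcon
  have hEfin : volume E ≠ ⊤ := (hEr.trans_lt measure_ball_lt_top).ne
  set F : Set V := ball 0 r \ E
  set G : Set V := E \ ball 0 (r + η)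
  have hFm : MeasurableSet F := measurableSet_ball.diff hE
  have hGm : MeasurableSet G := hE.diff measurableSet_ball
  have hF : ε ≤ volume F := hεE.trans (volume_diff_le_diff hE measurableSet_ball hEfin hEr)
  have hG : ε / 2 ≤ volume G := by
    have h1 : volume (E \ ball 0 r) ≤ volume G + volume (ball (0 : V) (r + η) \ ball 0 r) := by
      refine (measure_mono ?_).trans (measure_union_le _ _)
      intro x hx
      by_cases h : x ∈ ball (0 : V) (r + η)
      · exact Or.inr ⟨h, hx.2⟩
      · exact Or.inl ⟨hx.1, h⟩
    have h2 : ε / 2 + ε / 2 ≤ volume G + ε / 2 := by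
      rw [ENNReal.add_halves]
      exact hεE.trans (h1.trans (by gcongr))
    exact (ENNReal.add_le_add_iff_right (ENNReal.div_ne_top hεtop two_ne_zero)).1 h2
  set S : Set (V × V) := {p | (η ≤ ‖p.1‖ ∧ ‖p.1‖ ≤ 2 * R) ∧ p.2 ∈ F ∧
    bisectorReflection p.1 p.2 ∈ G}
  have hS : MeasurableSet S :=
    ((measurableSet_le measurable_const (measurable_norm.comp measurable_fst)).inter
      (measurableSet_le (measurable_norm.comp measurable_fst) measurable_const)).inter
      ((measurable_snd hFm).inter (measurable_bisectorReflection_uncurry hGm))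
  have hlower : ∀ y ∈ F, volume G ≤ L * volume ((fun w => (w, y)) ⁻¹' S) := by
    intro y hy
    have hyr : ‖y‖ < r := mem_ball_zero_iff.1 hy.1
    refine le_trans (measure_mono ?_) (volume_image_le_of_lipschitzOnWith
      ((lipschitzOnWith_bisectorReflection hη (hr.trans hrR) (hyr.le.trans hrR)).mono ?_))
    · intro x hx
      have hxr : r + η ≤ ‖x‖ := not_lt.1 fun h => hx.2 (mem_ball_zero_iff.2 h)
      have hxR : ‖x‖ < R := mem_ball_zero_iff.1 (hER hx.1)
      obtain ⟨w, hw1, hw2, hw3⟩ := exists_bisectorReflection_eq (x := x) (y := y) (by linarith)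
      exact ⟨w, ⟨⟨by linarith, by linarith⟩, hy, by simpa [hw3] using hx⟩, hw3⟩
    · exact fun w hw => hw.1.1
  have hupper : ∀ w : V, volume (Prod.mk w ⁻¹' S) ≤
      (closedBall (0 : V) (2 * R)).indicator (fun _ => (δ : ℝ≥0∞)) w := by
    intro w
    by_cases hw : η ≤ ‖w‖ ∧ ‖w‖ ≤ 2 * R
    · rw [Set.indicator_of_mem (mem_closedBall_zero_iff.2 hw.2)]
      refine (measure_mono fun y hy => ?_).trans (hcon w (norm_pos_iff.1 (hη.trans_le hw.1))).le
      exact ⟨hy.2.1, hy.2.2.1, fun h => hy.2.2.2 (ball_subset_ball (by linarith) h)⟩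
    · have : Prod.mk w ⁻¹' S = ∅ := Set.eq_empty_of_forall_notMem fun y hy => hw hy.1
      simp [this]
  refine hδlt.not_ge ?_
  calc ε * (ε / 2) ≤ volume G * volume F := by rw [mul_comm]; gcongr
    _ = ∫⁻ _ in F, volume G := by rw [setLIntegral_const]
    _ ≤ ∫⁻ y in F, L * volume ((fun w => (w, y)) ⁻¹' S) :=
        setLIntegral_mono ((measurable_measure_prodMk_right hS).const_mul L) hlower
    _ ≤ ∫⁻ y, L * volume ((fun w => (w, y)) ⁻¹' S) := setLIntegral_le_lintegral _ _
    _ = L * (volume.prod volume) S := by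
        rw [lintegral_const_mul _ (measurable_measure_prodMk_right hS),
          Measure.prod_apply_symm hS]
    _ ≤ L * ∫⁻ w, (closedBall (0 : V) (2 * R)).indicator (fun _ => (δ : ℝ≥0∞)) w := by
        rw [Measure.prod_apply hS]
        gcongr with w
        exact hupper w
    _ = δ * (L * U) := by
        rw [lintegral_indicator_const measurableSet_closedBall]
        ring

lemma selfInteraction_le_add {W : V → ℝ≥0∞} {M : ℝ≥0∞} (hM : ∀ z, W z ≤ M) (E B : Set V) :
    selfInteraction W E ≤ selfInteraction W B + 2 * M * volume E * volume (E \ B) := by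
  have hsub : E ×ˢ E ⊆ B ×ˢ B ∪ ((E \ B) ×ˢ E ∪ E ×ˢ (E \ B)) := by
    rintro ⟨x, y⟩ ⟨hx, hy⟩
    by_cases h1 : x ∈ B <;> by_cases h2 : y ∈ B <;> simp_all
  have hbound : ∀ A : Set (V × V), ∫⁻ p in A, W (p.1 - p.2) ∂(volume.prod volume) ≤
      M * (volume.prod volume) A := fun A => by
    rw [← setLIntegral_const]
    exact lintegral_mono fun p => hM _
  calc selfInteraction W E ≤ _ := lintegral_mono_set hsub
    _ ≤ _ := (lintegral_union_le _ _ _).trans (add_le_add_right (lintegral_union_le _ _ _) _)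
    _ ≤ selfInteraction W B + (M * (volume (E \ B) * volume E) +
        M * (volume E * volume (E \ B))) := by
        rw [← Measure.prod_prod, ← Measure.prod_prod]
        exact add_le_add_right (add_le_add (hbound _) (hbound _)) _
    _ = _ := by ring

/-- A case of the Riesz rearrangement inequality, for bounded sets. -/
lemma selfInteraction_le_ball_of_subset_ball [Nontrivial V] {φ : ℝ → ℝ≥0∞}
    (hφ : AntitoneOn φ (Set.Ici 0)) (hW : Measurable fun z : V => φ ‖z‖) {M : ℝ≥0∞}
    (hMtop : M ≠ ⊤) (hM : ∀ z : V, φ ‖z‖ ≤ M) {E : Set V} (hE : MeasurableSet E)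
    {r R : ℝ} (hr : 0 ≤ r) (hrR : r ≤ R) (hER : E ⊆ ball 0 R)
    (hvol : volume E ≤ volume (ball (0 : V) r)) :
    selfInteraction (fun z => φ ‖z‖) E ≤ selfInteraction (fun z => φ ‖z‖) (ball (0 : V) r) := by
  set C : Set (Set V) := {P | MeasurableSet P ∧ P ⊆ ball 0 R ∧
    volume P ≤ volume (ball (0 : V) r) ∧
    selfInteraction (fun z => φ ‖z‖) E ≤ selfInteraction (fun z => φ ‖z‖) P}
  set D : Set ℝ≥0∞ := (fun P => volume (P \ ball (0 : V) r)) '' C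
  have hEC : E ∈ C := ⟨hE, hER, hvol, le_rfl⟩
  have hinf : sInf D = 0 := by
    by_contra h0
    have htop : sInf D ≠ ⊤ := by
      refine ne_top_of_le_ne_top ?_ (sInf_le (Set.mem_image_of_mem _ hEC))
      exact measure_ne_top_of_subset (Set.sdiff_subset.trans hER) measure_ball_lt_top.ne
    obtain ⟨δ, hδ, hgain⟩ := exists_volume_gain (V := V) hr hrR h0 htop
    obtain ⟨_, ⟨P, hP, rfl⟩, hlt⟩ := sInf_lt_iff.1 (ENNReal.lt_add_right htop hδ)
    obtain ⟨w, hw, hδw⟩ := hgain P hP.1 hP.2.1 hP.2.2.1 (sInf_le (Set.mem_image_of_mem _ hP))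
    have hPC : polarize w P ∈ C := ⟨measurableSet_polarize hP.1,
      polarize_subset_ball hw hP.2.1, (volume_polarize_le hw hP.1).trans hP.2.2.1,
      hP.2.2.2.trans (selfInteraction_le_polarize hw hφ hW hP.1)⟩
    have h1 : sInf D + δ ≤ volume (P \ ball (0 : V) r) :=
      (add_le_add (sInf_le (Set.mem_image_of_mem _ hPC)) hδw).trans
        (volume_polarize_diff_ball_add_le hw hP.1 r)
    exact h1.not_gt hlt
  refine ENNReal.le_of_forall_pos_le_add fun ε hε _ => ?_
  have hA : 2 * M * volume (ball (0 : V) r) ≠ ⊤ :=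
    ENNReal.mul_ne_top (ENNReal.mul_ne_top ENNReal.ofNat_ne_top hMtop) measure_ball_lt_top.ne
  obtain ⟨δ, hδ, hδlt⟩ := ENNReal.exists_nnreal_pos_mul_lt hA (ENNReal.coe_ne_zero.2 hε.ne')
  obtain ⟨_, ⟨P, hP, rfl⟩, hlt⟩ := sInf_lt_iff.1
    (hinf.trans_lt (ENNReal.coe_pos.2 hδ))
  refine hP.2.2.2.trans ((selfInteraction_le_add hM P (ball 0 r)).trans ?_)
  gcongr
  calc 2 * M * volume P * volume (P \ ball 0 r) ≤ 2 * M * volume (ball (0 : V) r) * δ :=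
        mul_le_mul' (mul_le_mul' le_rfl hP.2.2.1) hlt.le
    _ ≤ ε := by rw [mul_comm]; exact hδlt.le

/-- A case of the Riesz rearrangement inequality: among sets of given volume, balls maximize the
self-interaction with respect to a bounded radially decreasing kernel. -/
lemma selfInteraction_le_ball [Nontrivial V] {φ : ℝ → ℝ≥0∞}
    (hφ : AntitoneOn φ (Set.Ici 0)) (hW : Measurable fun z : V => φ ‖z‖) {M : ℝ≥0∞}
    (hMtop : M ≠ ⊤) (hM : ∀ z : V, φ ‖z‖ ≤ M) {E : Set V} (hE : MeasurableSet E)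
    {r : ℝ} (hr : 0 ≤ r) (hvol : volume E ≤ volume (ball (0 : V) r)) :
    selfInteraction (fun z => φ ‖z‖) E ≤ selfInteraction (fun z => φ ‖z‖) (ball (0 : V) r) := by
  set A : ℕ → Set V := fun n => E ∩ ball 0 n
  have hA : Monotone A := fun m n h =>
    Set.inter_subset_inter_right _ (ball_subset_ball (Nat.cast_le.2 h))
  have hEA : ⋃ n, A n ×ˢ A n = E ×ˢ E := by
    rw [Set.iUnion_prod_of_monotone hA hA, ← Set.inter_iUnion, iUnion_ball_nat, Set.inter_univ]
  rw [selfInteraction, ← hEA, setLIntegral_iUnion_of_directed _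
    (Monotone.directed_le fun m n h => Set.prod_mono (hA h) (hA h))]
  refine iSup_le fun n => ?_
  exact selfInteraction_le_ball_of_subset_ball hφ hW hMtop hM (hE.inter measurableSet_ball) hr
    (le_max_right (n : ℝ) r)
    (Set.inter_subset_right.trans (ball_subset_ball (le_max_left _ _)))
    ((measure_mono Set.inter_subset_left).trans hvol)

end Rearrangement

section Perimeter

variable {N : ℕ}

lemma perK_add_selfInteraction {W : EuclideanSpace ℝ (Fin N) → ℝ≥0∞} (hW : Measurable W)
    {E : Set (EuclideanSpace ℝ (Fin N))} (hE : MeasurableSet E) :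
    perK W E + selfInteraction W E = (∫⁻ z, W z) * volume E := by
  have hm : Measurable fun p : EuclideanSpace ℝ (Fin N) × EuclideanSpace ℝ (Fin N) =>
      W (p.1 - p.2) := hW.comp (measurable_fst.sub measurable_snd)
  rw [perK, selfInteraction, ← Measure.prod_restrict, lintegral_prod _ hm.aemeasurable,
    ← lintegral_add_left hm.lintegral_prod_right', ← setLIntegral_const]
  refine lintegral_congr fun x => ?_
  rw [add_comm, lintegral_add_compl _ hE, lintegral_sub_left_eq_self]

lemma perK_mono {W W' : EuclideanSpace ℝ (Fin N) → ℝ≥0∞} (h : W ≤ W')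
    (E : Set (EuclideanSpace ℝ (Fin N))) : perK W E ≤ perK W' E :=
  lintegral_mono fun _ => lintegral_mono fun _ => h _

lemma perK_iSup {W : ℕ → EuclideanSpace ℝ (Fin N) → ℝ≥0∞} (hW : ∀ n, Measurable (W n))
    (hmono : Monotone W) (E : Set (EuclideanSpace ℝ (Fin N))) :
    perK (fun z => ⨆ n, W n z) E = ⨆ n, perK (W n) E := by
  have hm : ∀ n, Measurable fun p : EuclideanSpace ℝ (Fin N) × EuclideanSpace ℝ (Fin N) =>
      W n (p.1 - p.2) := fun n => (hW n).comp (measurable_fst.sub measurable_snd)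
  unfold perK
  rw [← lintegral_iSup (fun n => (hm n).lintegral_prod_right')
    fun m n h x => lintegral_mono fun y => hmono h _]
  refine lintegral_congr fun x => ?_
  exact lintegral_iSup (fun n => (hm n).comp measurable_prodMk_left) fun m n h y => hmono h _

/-- Isoperimetric inequality for bounded integrable radially decreasing kernels. -/
lemma perK_ball_le_of_bounded (hN : 0 < N) {φ : ℝ → ℝ≥0∞} (hφ : AntitoneOn φ (Set.Ici 0))
    (hW : Measurable fun z : EuclideanSpace ℝ (Fin N) => φ ‖z‖) {M : ℝ≥0∞} (hMtop : M ≠ ⊤)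
    (hM : ∀ z : EuclideanSpace ℝ (Fin N), φ ‖z‖ ≤ M)
    (hint : ∫⁻ z : EuclideanSpace ℝ (Fin N), φ ‖z‖ ≠ ⊤)
    {E : Set (EuclideanSpace ℝ (Fin N))} (hE : MeasurableSet E) {r : ℝ} (hr : 0 ≤ r)
    (hvol : volume (ball (0 : EuclideanSpace ℝ (Fin N)) r) = volume E) :
    perK (fun z => φ ‖z‖) (ball (0 : EuclideanSpace ℝ (Fin N)) r) ≤ perK (fun z => φ ‖z‖) E := by
  have : Nonempty (Fin N) := ⟨⟨0, hN⟩⟩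
  have hB := perK_add_selfInteraction hW (measurableSet_ball (x := 0) (ε := r))
  have hI := selfInteraction_le_ball hφ hW hMtop hM hE hr hvol.ge
  have hIfin : selfInteraction (fun z => φ ‖z‖) (ball (0 : EuclideanSpace ℝ (Fin N)) r) ≠ ⊤ :=
    ne_top_of_le_ne_top (ENNReal.mul_ne_top hint measure_ball_lt_top.ne) (hB ▸ le_add_self)
  rw [hvol, ← perK_add_selfInteraction hW hE] at hB
  refine (ENNReal.add_le_add_iff_right hIfin).1 (hB.trans_le ?_)
  gcongr

end Perimeter

/-- Isoperimetric inequality for radial kernels: if `K(x) = k(|x|)` with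
`k : [0,∞) → [0,∞)` nonincreasing, `min(|x|,1) K(x) ∈ L¹(ℝ^N)`, and `E ⊆ ℝ^N` is measurable with
`|E| < ∞`, then `Per_K(E) ≥ Per_K(B_{|E|})`, where `B_{|E|}` is the ball centered at the origin
whose Lebesgue measure equals `|E|`. -/
theorem isoperimetric_radial {N : ℕ} (hN : 0 < N) (K : EuclideanSpace ℝ (Fin N) → ℝ)
    (hKmeas : Measurable K) (hKnonneg : ∀ x, 0 ≤ K x)
    (hKint : Integrable (fun x : EuclideanSpace ℝ (Fin N) => min ‖x‖ 1 * K x) volume)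
    (k : ℝ → ℝ) (hkmono : AntitoneOn k (Set.Ici 0)) (hknonneg : ∀ t ∈ Set.Ici (0 : ℝ), 0 ≤ k t)
    (hrad : ∀ x, K x = k ‖x‖)
    (E : Set (EuclideanSpace ℝ (Fin N))) (hE : MeasurableSet E) (hEfin : volume E < ⊤)
    (r : ℝ) (hr : 0 ≤ r)
    (hball : volume (ball (0 : EuclideanSpace ℝ (Fin N)) r) = volume E) :
    perK (fun z => ENNReal.ofReal (K z)) (ball (0 : EuclideanSpace ℝ (Fin N)) r) ≤
      perK (fun z => ENNReal.ofReal (K z)) E := by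
  set φ : ℕ → ℝ → ℝ≥0∞ := fun n t => if t ≤ n then min (ENNReal.ofReal (k t)) n else 0 with hφdef
  have hφanti : ∀ n, AntitoneOn (φ n) (Set.Ici 0) := by
    intro n s hs t ht hst
    by_cases h : t ≤ n
    · simp only [hφdef, h, hst.trans h, if_true]
      exact min_le_min_right _ (ENNReal.ofReal_le_ofReal (hkmono hs ht hst))
    · simp [hφdef, h]
  have hφmeas : ∀ n, Measurable fun z : EuclideanSpace ℝ (Fin N) => φ n ‖z‖ := by
    intro n
    simp only [hφdef, ← hrad]
    exact Measurable.ite (measurableSet_le measurable_norm measurable_const)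
      (hKmeas.ennreal_ofReal.min measurable_const) measurable_const
  have hφle : ∀ n t, φ n t ≤ n := by
    intro n t
    simp only [hφdef]
    split_ifs <;> simp
  have hφint : ∀ n, ∫⁻ z : EuclideanSpace ℝ (Fin N), φ n ‖z‖ ≠ ⊤ := by
    intro n
    have hle : ∫⁻ z : EuclideanSpace ℝ (Fin N), φ n ‖z‖ ≤
        ∫⁻ z, (closedBall (0 : EuclideanSpace ℝ (Fin N)) n).indicator
          (fun _ => (n : ℝ≥0∞)) z := by
      refine lintegral_mono fun z => ?_
      by_cases h : ‖z‖ ≤ n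
      · rw [Set.indicator_of_mem (mem_closedBall_zero_iff.2 h)]
        exact hφle n _
      · simp [hφdef, h]
    rw [lintegral_indicator_const measurableSet_closedBall] at hle
    exact ne_top_of_le_ne_top
      (ENNReal.mul_ne_top (ENNReal.natCast_ne_top n) measure_closedBall_lt_top.ne) hle
  have hφmono : Monotone fun n (z : EuclideanSpace ℝ (Fin N)) => φ n ‖z‖ := by
    intro m n hmn z
    have hmn' : (m : ℝ) ≤ n := Nat.cast_le.2 hmn
    by_cases h : ‖z‖ ≤ m
    · simp only [hφdef, h, h.trans hmn', if_true]
      exact min_le_min_left _ (Nat.cast_le.2 hmn)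
    · simp [hφdef, h]
  have hφK : ∀ n (z : EuclideanSpace ℝ (Fin N)), φ n ‖z‖ ≤ ENNReal.ofReal (K z) := by
    intro n z
    simp only [hφdef, hrad]
    split_ifs <;> simp
  have hsup : (fun z => ENNReal.ofReal (K z)) = fun z => ⨆ n, φ n ‖z‖ := by
    funext z
    refine le_antisymm ?_ (iSup_le fun n => hφK n z)
    obtain ⟨n, hn⟩ := exists_nat_ge (max ‖z‖ (K z))
    refine le_trans ?_ (le_iSup _ n)
    have h1 : ‖z‖ ≤ n := (le_max_left _ _).trans hn
    have h2 : ENNReal.ofReal (k ‖z‖) ≤ n := by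
      rw [← hrad, ← ENNReal.ofReal_natCast]
      exact ENNReal.ofReal_le_ofReal ((le_max_right _ _).trans hn)
    simp [hφdef, h1, h2, hrad]
  conv_lhs => rw [hsup, perK_iSup hφmeas hφmono]
  exact iSup_le fun n => (perK_ball_le_of_bounded hN (hφanti n) (hφmeas n)
    (ENNReal.natCast_ne_top n) (fun z => hφle n _) (hφint n) hE hr hball).trans
    (perK_mono (hφK n) E)
end

section
/- General isoperimetric inequality: let K : ℝ^N → [0,∞) be measurable with K(x) = K(−x) for a.e. x and min(|x|,1)·K(x) ∈ L¹(ℝ^N). Then for every measurable set E ⊆ ℝ^N with |E| < ∞ one has Per_K(E) ≥ Per_{K*}(B_{|E|}), where K* is the symmetric decreasing rearrangement of K and B_{|E|} is the ball centered at the origin with Lebesgue measure |E|. -/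
open MeasureTheory Filter Metric
open scoped ENNReal Topology

/-- The symmetric decreasing rearrangement `K*(x) = ∫_0^∞ χ_{{K>t}*}(x) dt`, where for a set `A`
of finite measure `A*` is the open ball centered at `0` with `|A*| = |A|` (so `x ∈ {K>t}*` iff
`|ball(0,|x|)| < |{K>t}|`), valued in `[0,∞]`. -/
noncomputable def symmDecrRearrangement {N : ℕ} (K : EuclideanSpace ℝ (Fin N) → ℝ)
    (x : EuclideanSpace ℝ (Fin N)) : ℝ≥0∞ :=
  ∫⁻ t in Set.Ioi (0 : ℝ),
    Set.indicator {y : EuclideanSpace ℝ (Fin N) |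
        volume (ball (0 : EuclideanSpace ℝ (Fin N)) ‖y‖) < volume {z | t < K z}}
      (fun _ => (1 : ℝ≥0∞)) x

noncomputable def rieszForm {G : Type*} [Add G] [MeasurableSpace G] (μ : Measure G)
    (E A F : Set G) : ℝ≥0∞ :=
  ∫⁻ z in A, μ {y | z + y ∈ E ∧ y ∈ F} ∂μ

section Group
variable {G : Type*} [AddGroup G] [MeasurableSpace G] [MeasurableAdd₂ G] (μ : Measure G) [SFinite μ]

lemma measurable_measure_overlap {E F : Set G} (hE : MeasurableSet E) (hF : MeasurableSet F) :
    Measurable fun z => μ {y | z + y ∈ E ∧ y ∈ F} :=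
  measurable_measure_prodMk_left (s := {p : G × G | p.1 + p.2 ∈ E ∧ p.2 ∈ F})
    ((measurable_add hE).inter (measurable_snd hF))

lemma lintegral_measure_overlap [μ.IsAddRightInvariant] {E F : Set G} (hE : MeasurableSet E)
    (hF : MeasurableSet F) : ∫⁻ z, μ {y | z + y ∈ E ∧ y ∈ F} ∂μ = μ E * μ F := by
  have hS : MeasurableSet {p : G × G | p.1 + p.2 ∈ E ∧ p.2 ∈ F} :=
    (measurable_add hE).inter (measurable_snd hF)
  have h1 := Measure.prod_apply (μ := μ) (ν := μ) hS
  rw [Measure.prod_apply_symm hS] at h1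
  refine h1.symm.trans ?_
  have : ∀ y, μ ((fun x => (x, y)) ⁻¹' {p : G × G | p.1 + p.2 ∈ E ∧ p.2 ∈ F}) =
      F.indicator (fun _ => μ E) y := by
    intro y
    by_cases hy : y ∈ F
    · rw [Set.indicator_of_mem hy, ← measure_preimage_add_right μ y E]
      congr 1; ext x; simp [hy]
    · rw [Set.indicator_of_notMem hy]
      simp [hy]
  simp_rw [this]
  rw [lintegral_indicator hF, setLIntegral_const]

end Group

lemma exists_volume_inter_Iio_eq {E : Set ℝ} (hE : MeasurableSet E) {R : ℝ}
    (hER : E ⊆ Set.Ioo (-R) R) {t : ℝ≥0∞} (ht : t ≤ volume E) :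
    ∃ e, volume (E ∩ Set.Iio e) = t := by
  have hfin : volume E ≠ ⊤ := ((measure_mono hER).trans_lt (by simp)).ne
  have hI : IntegrableOn (E.indicator (fun _ => (1 : ℝ))) Set.univ := by
    simpa using (integrable_indicator_iff hE).2 (by simp [hfin.lt_top])
  rw [integrableOn_univ] at hI
  have hc : Continuous fun e => ∫ x in (-R)..e, E.indicator (fun _ => (1 : ℝ)) x :=
    intervalIntegral.continuous_primitive (fun _ _ => hI.intervalIntegrable) _
  have hv : ∀ e, -R ≤ e → ∫ x in (-R)..e, E.indicator (fun _ => (1 : ℝ)) x =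
      (volume (E ∩ Set.Iio e)).toReal := by
    intro e he
    rw [intervalIntegral.integral_of_le he, integral_Ioc_eq_integral_Ioo,
      integral_indicator hE]
    rw [Measure.restrict_restrict hE]
    simp only [integral_const, smul_eq_mul, mul_one, measureReal_def]
    rw [Measure.restrict_apply_univ]
    congr 2
    ext x
    constructor
    · rintro ⟨h1, h2⟩; exact ⟨h1, h2.2⟩
    · rintro ⟨h1, h2⟩; exact ⟨h1, (hER h1).1, h2⟩
  by_cases hR : -R ≤ R
  · have h0 : volume (E ∩ Set.Iio (-R)) = 0 := by
      have : E ∩ Set.Iio (-R) = ∅ := by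
        ext x; simp only [Set.mem_inter_iff, Set.mem_Iio, Set.mem_empty_iff_false, iff_false]
        rintro ⟨h1, h2⟩; exact absurd h2 (not_lt.2 (hER h1).1.le)
      simp [this]
    have h1 : E ∩ Set.Iio R = E := Set.inter_eq_left.2 fun x hx => (hER hx).2
    obtain ⟨e, he, hee⟩ := intermediate_value_Icc hR hc.continuousOn
      (show t.toReal ∈ _ by
        simp only [hv _ le_rfl, hv _ hR, h0, h1]
        exact ⟨by simp, ENNReal.toReal_mono hfin ht⟩)
    refine ⟨e, ?_⟩
    simp only at hee
    rw [hv e he.1] at hee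
    exact (ENNReal.toReal_eq_toReal_iff' (measure_ne_top_of_subset Set.inter_subset_left hfin)
      (ne_top_of_le_ne_top hfin ht)).1 hee
  · have : E = ∅ := by
      rw [Set.Ioo_eq_empty (by linarith)] at hER
      exact Set.subset_empty_iff.1 hER
    subst this
    exact ⟨0, by simpa using (by simpa using ht : t = 0).symm⟩

lemma rieszForm_real_le {E A F : Set ℝ} (hE : MeasurableSet E) (hF : MeasurableSet F) {R : ℝ}
    (hER : E ⊆ Set.Ioo (-R) R) (hFR : F ⊆ Set.Ioo (-R) R)
    {t : ℝ≥0∞} (htE : t ≤ volume E) (htF : t ≤ volume F) :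
    rieszForm volume E A F ≤ t * volume A + (volume E - t) * (volume F - t) := by
  have hEfin : volume E ≠ ⊤ := ((measure_mono hER).trans_lt (by simp)).ne
  obtain ⟨e, he⟩ := exists_volume_inter_Iio_eq hE hER htE
  obtain ⟨f, hf⟩ := exists_volume_inter_Iio_eq hF hFR htF
  have htop : t ≠ ⊤ := ne_top_of_le_ne_top hEfin htE
  have hsub : ∀ {E : Set ℝ} {e : ℝ}, MeasurableSet E → volume (E ∩ Set.Iio e) = t →
      volume (E ∩ Set.Ici e) = volume E - t := by
    intro E e hE he
    have := measure_inter_add_sdiff (μ := volume) E (measurableSet_Iio (a := e))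
    rw [Set.sdiff_eq, Set.compl_Iio, he] at this
    rw [← this, ENNReal.add_sub_cancel_left htop]
  have hpt : ∀ z, volume {y | z + y ∈ E ∧ y ∈ F} ≤
      t + volume {y | z + y ∈ E ∩ Set.Ici e ∧ y ∈ F ∩ Set.Ici f} := by
    intro z
    rcases le_total (z + f) e with h | h
    · rw [← he, ← measure_preimage_add volume z (E ∩ Set.Iio e)]
      refine (measure_mono ?_).trans (measure_union_le _ _)
      rintro y ⟨h1, h2⟩
      by_cases h3 : z + y < e
      · exact Or.inl ⟨h1, h3⟩
      · refine Or.inr ⟨⟨h1, not_lt.1 h3⟩, h2, ?_⟩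
        simp only [Set.mem_Ici]; linarith
    · rw [← hf]
      refine (measure_mono ?_).trans (measure_union_le _ _)
      rintro y ⟨h1, h2⟩
      by_cases h3 : y < f
      · exact Or.inl ⟨h2, h3⟩
      · refine Or.inr ⟨⟨h1, ?_⟩, h2, not_lt.1 h3⟩
        simp only [Set.mem_Ici]; linarith
  calc rieszForm volume E A F
      ≤ ∫⁻ z in A, (t + volume {y | z + y ∈ E ∩ Set.Ici e ∧ y ∈ F ∩ Set.Ici f}) :=
        lintegral_mono hpt
    _ = t * volume A + ∫⁻ z in A, volume {y | z + y ∈ E ∩ Set.Ici e ∧ y ∈ F ∩ Set.Ici f} := by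
        rw [lintegral_add_left measurable_const, setLIntegral_const]
    _ ≤ t * volume A + ∫⁻ z, volume {y | z + y ∈ E ∩ Set.Ici e ∧ y ∈ F ∩ Set.Ici f} := by
        gcongr
        exact Measure.restrict_le_self
    _ = _ := by
        rw [lintegral_measure_overlap volume (hE.inter measurableSet_Ici)
          (hF.inter measurableSet_Ici), hsub hE he, hsub hF hf]

lemma volume_overlap_symm (e f z : ℝ) :
    volume {y : ℝ | z + y ∈ {s | |s| < e / 2} ∧ y ∈ {s | |s| < f / 2}} =
      ENNReal.ofReal (min (f / 2) (e / 2 - z) - max (-(f / 2)) (-(e / 2) - z)) := by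
  rw [← Real.volume_Ioo]
  congr 1
  ext y
  simp only [Set.mem_ofPred_eq, abs_lt, Set.mem_Ioo, max_lt_iff, lt_min_iff]
  constructor
  · rintro ⟨⟨_, _⟩, _, _⟩; refine ⟨⟨?_, ?_⟩, ?_, ?_⟩ <;> linarith
  · rintro ⟨⟨_, _⟩, _, _⟩; refine ⟨⟨?_, ?_⟩, ?_, ?_⟩ <;> linarith

lemma volume_abs_lt_half (e : ℝ) : volume {s : ℝ | |s| < e / 2} = ENNReal.ofReal e := by
  have : {s : ℝ | |s| < e / 2} = Set.Ioo (-(e / 2)) (e / 2) := by ext; simp [abs_lt]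
  rw [this, Real.volume_Ioo]; congr 1; ring

lemma measurableSet_abs_lt (r : ℝ) : MeasurableSet {s : ℝ | |s| < r} :=
  measurableSet_lt measurable_norm measurable_const

lemma le_rieszForm_intervals {e a f t p q : ℝ} (ht : 0 ≤ t) (hp : 0 ≤ p) (hq : 0 ≤ q)
    (he : t + p ≤ e) (hf : t + q ≤ f) (ha : p + q ≤ a) :
    ENNReal.ofReal (t * (p + q) + p * q) ≤
      rieszForm volume {s : ℝ | |s| < e / 2} {s : ℝ | |s| < a / 2} {s : ℝ | |s| < f / 2} := by
  have hA := measurableSet_abs_lt ((p + q) / 2)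
  have key : ∀ z : ℝ, |z| < (p + q) / 2 →
      ENNReal.ofReal t + volume {y : ℝ | z + y ∈ {s | |s| < p / 2} ∧ y ∈ {s | |s| < q / 2}} ≤
      volume {y : ℝ | z + y ∈ {s | |s| < e / 2} ∧ y ∈ {s | |s| < f / 2}} := by
    intro z hz
    obtain ⟨h1, h2⟩ := abs_lt.1 hz
    rw [volume_overlap_symm, volume_overlap_symm]
    have h3 : 0 ≤ min (q / 2) (p / 2 - z) - max (-(q / 2)) (-(p / 2) - z) := by
      rcases min_cases (q / 2) (p / 2 - z) with h | h <;>
      rcases max_cases (-(q / 2)) (-(p / 2) - z) with h' | h' <;> linarith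
    rw [← ENNReal.ofReal_add ht h3]
    apply ENNReal.ofReal_le_ofReal
    rcases min_cases (q / 2) (p / 2 - z) with h | h <;>
    rcases max_cases (-(q / 2)) (-(p / 2) - z) with h' | h' <;>
    rcases min_cases (f / 2) (e / 2 - z) with h'' | h'' <;>
    rcases max_cases (-(f / 2)) (-(e / 2) - z) with h''' | h''' <;> linarith
  have hzero : ∀ z : ℝ, z ∉ {s : ℝ | |s| < (p + q) / 2} →
      volume {y : ℝ | z + y ∈ {s | |s| < p / 2} ∧ y ∈ {s | |s| < q / 2}} = 0 := by
    intro z hz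
    rw [volume_overlap_symm]
    apply ENNReal.ofReal_of_nonpos
    simp only [Set.mem_ofPred_eq, not_lt] at hz
    rcases le_abs.1 hz with h | h <;>
    rcases min_cases (q / 2) (p / 2 - z) with h | h <;>
    rcases max_cases (-(q / 2)) (-(p / 2) - z) with h' | h' <;> linarith
  calc ENNReal.ofReal (t * (p + q) + p * q)
      = ENNReal.ofReal t * ENNReal.ofReal (p + q) + ENNReal.ofReal p * ENNReal.ofReal q := by
        rw [ENNReal.ofReal_add (by positivity) (by positivity), ENNReal.ofReal_mul ht,
          ENNReal.ofReal_mul hp]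
    _ = ∫⁻ z in {s : ℝ | |s| < (p + q) / 2}, (ENNReal.ofReal t +
          volume {y : ℝ | z + y ∈ {s | |s| < p / 2} ∧ y ∈ {s | |s| < q / 2}}) := by
        rw [lintegral_add_left measurable_const, setLIntegral_const, volume_abs_lt_half,
          ← volume_abs_lt_half p, ← volume_abs_lt_half q,
          ← lintegral_measure_overlap volume (measurableSet_abs_lt _) (measurableSet_abs_lt _)]
        congr 1
        rw [← lintegral_indicator hA]
        congr 1; ext z
        by_cases hz : z ∈ {s : ℝ | |s| < (p + q) / 2}
        · rw [Set.indicator_of_mem hz]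
        · rw [Set.indicator_of_notMem hz, hzero z hz]
    _ ≤ ∫⁻ z in {s : ℝ | |s| < (p + q) / 2},
          volume {y : ℝ | z + y ∈ {s | |s| < e / 2} ∧ y ∈ {s | |s| < f / 2}} :=
        setLIntegral_mono' hA key
    _ ≤ _ := lintegral_mono_set fun s (hs : |s| < _) => show |s| < _ by linarith

lemma rieszForm_real_le_intervals {E A F : Set ℝ} (hE : MeasurableSet E) (hF : MeasurableSet F)
    {R : ℝ} (hER : E ⊆ Set.Ioo (-R) R) (hFR : F ⊆ Set.Ioo (-R) R) (hA : volume A ≠ ⊤) :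
    rieszForm volume E A F ≤ rieszForm volume {s : ℝ | |s| < (volume E).toReal / 2}
      {s : ℝ | |s| < (volume A).toReal / 2} {s : ℝ | |s| < (volume F).toReal / 2} := by
  have hEfin : volume E ≠ ⊤ := ((measure_mono hER).trans_lt (by simp)).ne
  have hFfin : volume F ≠ ⊤ := ((measure_mono hFR).trans_lt (by simp)).ne
  set e := (volume E).toReal with he
  set a := (volume A).toReal with ha
  set f := (volume F).toReal with hf
  have he0 : 0 ≤ e := ENNReal.toReal_nonneg
  have ha0 : 0 ≤ a := ENNReal.toReal_nonneg
  have hf0 : 0 ≤ f := ENNReal.toReal_nonneg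
  have hEe : volume E = ENNReal.ofReal e := (ENNReal.ofReal_toReal hEfin).symm
  have hAa : volume A = ENNReal.ofReal a := (ENNReal.ofReal_toReal hA).symm
  have hFf : volume F = ENNReal.ofReal f := (ENNReal.ofReal_toReal hFfin).symm
  have upper : ∀ t, 0 ≤ t → t ≤ e → t ≤ f →
      rieszForm volume E A F ≤ ENNReal.ofReal (t * a + (e - t) * (f - t)) := by
    intro t ht hte htf
    refine (rieszForm_real_le hE hF hER hFR (t := ENNReal.ofReal t) ?_ ?_).trans_eq ?_
    · rw [hEe]; exact ENNReal.ofReal_le_ofReal hte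
    · rw [hFf]; exact ENNReal.ofReal_le_ofReal htf
    · rw [hEe, hAa, hFf, ← ENNReal.ofReal_sub _ ht, ← ENNReal.ofReal_sub _ ht,
        ← ENNReal.ofReal_mul ht, ← ENNReal.ofReal_mul (by linarith),
        ← ENNReal.ofReal_add (by positivity) (mul_nonneg (by linarith) (by linarith))]
  by_cases h1 : e + f ≤ a
  · refine (upper 0 le_rfl he0 hf0).trans (le_trans (le_of_eq ?_)
      (le_rieszForm_intervals (t := 0) (p := e) (q := f) ?_ ?_ ?_ ?_ ?_ ?_)) <;>
      first | linarith | (congr 1; ring)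
  by_cases h2 : a ≤ e - f
  · refine (upper f hf0 (by linarith) le_rfl).trans (le_trans (le_of_eq ?_)
      (le_rieszForm_intervals (t := f) (p := a) (q := 0) ?_ ?_ ?_ ?_ ?_ ?_)) <;>
      first | linarith | (congr 1; ring)
  by_cases h3 : a ≤ f - e
  · refine (upper e he0 le_rfl (by linarith)).trans (le_trans (le_of_eq ?_)
      (le_rieszForm_intervals (t := e) (p := 0) (q := a) ?_ ?_ ?_ ?_ ?_ ?_)) <;>
      first | linarith | (congr 1; ring)
  · refine (upper ((e + f - a) / 2) (by linarith) (by linarith) (by linarith)).trans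
      (le_trans (le_of_eq ?_) (le_rieszForm_intervals (t := (e + f - a) / 2)
      (p := (e + a - f) / 2) (q := (f + a - e) / 2) ?_ ?_ ?_ ?_ ?_ ?_)) <;>
      first | linarith | (congr 1; ring)

section Product
variable {Y : Type*} [MeasurableSpace Y]

/-- Steiner symmetrization of a subset of `ℝ × Y` along the first factor. -/
def steiner (E : Set (ℝ × Y)) : Set (ℝ × Y) :=
  {p | ENNReal.ofReal (2 * |p.1|) < volume ((fun s => (s, p.2)) ⁻¹' E)}

omit [MeasurableSpace Y] in
lemma steiner_slice_of_ne_top {E : Set (ℝ × Y)} {y : Y}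
    (h : volume ((fun s => (s, y)) ⁻¹' E) ≠ ⊤) :
    (fun s => (s, y)) ⁻¹' steiner E =
      {s : ℝ | |s| < (volume ((fun s => (s, y)) ⁻¹' E)).toReal / 2} := by
  ext s
  change ENNReal.ofReal (2 * |s|) < _ ↔ |s| < _
  rw [ENNReal.ofReal_lt_iff_lt_toReal (by positivity) h, lt_div_iff₀' two_pos]

omit [MeasurableSpace Y] in
lemma volume_steiner_slice (E : Set (ℝ × Y)) (y : Y) :
    volume ((fun s => (s, y)) ⁻¹' steiner E) = volume ((fun s => (s, y)) ⁻¹' E) := by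
  by_cases h : volume ((fun s => (s, y)) ⁻¹' E) = ⊤
  · have : (fun s => (s, y)) ⁻¹' steiner E = Set.univ := by
      ext s
      simp [steiner, h, ENNReal.mul_lt_top_iff]
    rw [this, h, Real.volume_univ]
  · rw [steiner_slice_of_ne_top h, volume_abs_lt_half, ENNReal.ofReal_toReal h]

lemma measurableSet_steiner {E : Set (ℝ × Y)} (hE : MeasurableSet E) :
    MeasurableSet (steiner E) :=
  measurableSet_lt (by fun_prop) ((measurable_measure_prodMk_right hE).comp measurable_snd)

lemma measure_steiner (ν : Measure Y) [SFinite ν] {E : Set (ℝ × Y)} (hE : MeasurableSet E) :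
    (volume.prod ν) (steiner E) = (volume.prod ν) E := by
  rw [Measure.prod_apply_symm hE, Measure.prod_apply_symm (measurableSet_steiner hE)]
  simp_rw [volume_steiner_slice]

instance [Add Y] [MeasurableAdd₂ Y] : MeasurableAdd₂ (ℝ × Y) where
  measurable_add := Measurable.prodMk (by fun_prop) (by fun_prop)

lemma rieszForm_prod [AddGroup Y] [MeasurableAdd₂ Y] (ν : Measure Y) [SFinite ν]
    {E A F : Set (ℝ × Y)} (hE : MeasurableSet E) (hA : MeasurableSet A) (hF : MeasurableSet F) :
    rieszForm (volume.prod ν) E A F =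
      ∫⁻ w, ∫⁻ w', rieszForm volume ((fun s => (s, w + w')) ⁻¹' E) ((fun s => (s, w)) ⁻¹' A)
        ((fun s => (s, w')) ⁻¹' F) ∂ν ∂ν := by
  rw [rieszForm, ← lintegral_indicator hA, lintegral_prod_symm _
    ((measurable_measure_overlap _ hE hF).indicator hA).aemeasurable]
  refine lintegral_congr fun w => ?_
  have hAw : MeasurableSet ((fun s : ℝ => (s, w)) ⁻¹' A) := measurable_prodMk_right hA
  simp only [rieszForm]
  rw [← lintegral_lintegral_swap]
  · rw [← lintegral_indicator hAw]
    refine lintegral_congr fun s => ?_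
    by_cases hs : (s, w) ∈ A
    · rw [Set.indicator_of_mem hs, Set.indicator_of_mem (by exact hs), Measure.prod_apply_symm]
      · rfl
      · exact ((measurable_const_add _) hE).inter hF
    · rw [Set.indicator_of_notMem hs, Set.indicator_of_notMem (by exact hs)]
  · refine (measurable_measure_prodMk_left
      (s := {p : (ℝ × Y) × ℝ | (p.1.1 + p.2, w + p.1.2) ∈ E ∧ (p.2, p.1.2) ∈ F})
      (MeasurableSet.inter ?_ ?_)).aemeasurable
    · exact (show Measurable fun p : (ℝ × Y) × ℝ => (p.1.1 + p.2, w + p.1.2) by fun_prop) hE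
    · exact (show Measurable fun p : (ℝ × Y) × ℝ => (p.2, p.1.2) by fun_prop) hF

lemma rieszForm_le_steiner [AddGroup Y] [MeasurableAdd₂ Y] (ν : Measure Y) [SFinite ν]
    {E A F : Set (ℝ × Y)} (hE : MeasurableSet E) (hA : MeasurableSet A) (hF : MeasurableSet F)
    {R : ℝ} (hER : ∀ p ∈ E, |p.1| < R) (hAR : ∀ p ∈ A, |p.1| < R) (hFR : ∀ p ∈ F, |p.1| < R) :
    rieszForm (volume.prod ν) E A F ≤
      rieszForm (volume.prod ν) (steiner E) (steiner A) (steiner F) := by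
  have hsub : ∀ {E : Set (ℝ × Y)}, (∀ p ∈ E, |p.1| < R) → ∀ y,
      (fun s => (s, y)) ⁻¹' E ⊆ Set.Ioo (-R) R := fun h y s hs => abs_lt.1 (h _ hs)
  have hfin : ∀ {E : Set (ℝ × Y)}, (∀ p ∈ E, |p.1| < R) → ∀ y,
      volume ((fun s => (s, y)) ⁻¹' E) ≠ ⊤ := fun h y =>
    ((measure_mono (hsub h y)).trans_lt (by simp)).ne
  rw [rieszForm_prod ν hE hA hF, rieszForm_prod ν (measurableSet_steiner hE)
    (measurableSet_steiner hA) (measurableSet_steiner hF)]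
  refine lintegral_mono fun w => lintegral_mono fun w' => ?_
  rw [steiner_slice_of_ne_top (hfin hER _), steiner_slice_of_ne_top (hfin hAR _),
    steiner_slice_of_ne_top (hfin hFR _)]
  exact rieszForm_real_le_intervals (measurable_prodMk_right hE) (measurable_prodMk_right hF)
    (hsub hER _) (hsub hFR _) (hfin hAR _)

omit [MeasurableSpace Y] in
lemma steiner_mono {E F : Set (ℝ × Y)} (h : E ⊆ F) : steiner E ⊆ steiner F :=
  fun _ hp => lt_of_lt_of_le hp (measure_mono (Set.preimage_mono h))

omit [MeasurableSpace Y] in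
lemma steiner_eq_self {B : Set (ℝ × Y)} (hB : ∀ y, ∃ ρ : ℝ, ∀ s, (s, y) ∈ B ↔ |s| < ρ) :
    steiner B = B := by
  ext ⟨s, y⟩
  obtain ⟨ρ, hρ⟩ := hB y
  have h : (fun s => (s, y)) ⁻¹' B = {s : ℝ | |s| < 2 * ρ / 2} := by
    ext s; simp [hρ]
  rw [steiner, Set.mem_ofPred_eq, h, volume_abs_lt_half, hρ]
  constructor
  · intro h
    have := (ENNReal.ofReal_lt_ofReal_iff_of_nonneg (by positivity)).1 h
    linarith
  · intro h
    exact (ENNReal.ofReal_lt_ofReal_iff_of_nonneg (by positivity)).2 (by linarith)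

lemma measure_inter_add_le_steiner_inter [AddGroup Y] [MeasurableAdd₂ Y] (ν : Measure Y)
    [SFinite ν] [ν.IsAddLeftInvariant] {E B : Set (ℝ × Y)} (hE : MeasurableSet E)
    (hBm : MeasurableSet B) (hB : ∀ y, ∃ ρ : ℝ, ∀ s, (s, y) ∈ B ↔ |s| < ρ) (c : ℝ) :
    (volume.prod ν) (E ∩ B) +
        (volume.prod ν) {p | (c, 0) + p ∈ E \ B ∧ p ∈ B \ E} ≤
      (volume.prod ν) (steiner E ∩ B) := by
  have hT : MeasurableSet {p : ℝ × Y | (c, 0) + p ∈ E \ B ∧ p ∈ B \ E} :=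
    ((measurable_const_add (c, (0 : Y))) (hE.diff hBm)).inter (hBm.diff hE)
  rw [Measure.prod_apply_symm (hE.inter hBm), Measure.prod_apply_symm hT,
    Measure.prod_apply_symm ((measurableSet_steiner hE).inter hBm),
    ← lintegral_add_left (measurable_measure_prodMk_right (hE.inter hBm))]
  refine lintegral_mono fun y => ?_
  have hEy : MeasurableSet ((fun s : ℝ => (s, y)) ⁻¹' E) := measurable_prodMk_right hE
  have hBy : MeasurableSet ((fun s : ℝ => (s, y)) ⁻¹' B) := measurable_prodMk_right hBm
  set e := (fun s : ℝ => (s, y)) ⁻¹' E with he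
  set b := (fun s : ℝ => (s, y)) ⁻¹' B with hb
  have hTy : (fun s : ℝ => (s, y)) ⁻¹' {p : ℝ × Y | (c, 0) + p ∈ E \ B ∧ p ∈ B \ E} =
      {s | c + s ∈ e \ b ∧ s ∈ b \ e} := by
    ext s; simp [he, hb]
  rw [hTy]
  have h1 : volume {s | c + s ∈ e \ b ∧ s ∈ b \ e} ≤ volume (e \ b) := by
    rw [← measure_preimage_add volume c (e \ b)]
    exact measure_mono fun s hs => hs.1
  have h2 : volume {s | c + s ∈ e \ b ∧ s ∈ b \ e} ≤ volume (b \ e) :=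
    measure_mono fun s hs => hs.2
  have h3 : volume (e ∩ b) + volume {s | c + s ∈ e \ b ∧ s ∈ b \ e} ≤ volume e :=
    (add_le_add_right h1 _).trans_eq (measure_inter_add_sdiff e hBy)
  have h4 : volume (e ∩ b) + volume {s | c + s ∈ e \ b ∧ s ∈ b \ e} ≤ volume b := by
    rw [Set.inter_comm]
    exact (add_le_add_right h2 _).trans_eq (measure_inter_add_sdiff b hEy)
  have h5 : volume ((fun s : ℝ => (s, y)) ⁻¹' (steiner E ∩ B)) =
      min (volume e) (volume b) := by
    have hb' : b = (fun s : ℝ => (s, y)) ⁻¹' steiner B := by rw [steiner_eq_self hB]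
    rw [Set.preimage_inter]
    rcases le_total (volume e) (volume b) with h | h
    · rw [min_eq_left h, ← volume_steiner_slice E y, ← hb, hb']
      congr 1
      exact Set.inter_eq_left.2 fun s hs => lt_of_lt_of_le hs h
    · rw [min_eq_right h, ← hb, hb']
      congr 1
      exact Set.inter_eq_right.2 fun s hs => lt_of_lt_of_le hs h
  exact (le_min h3 h4).trans_eq h5.symm

end Product

section Euclidean

/-- Orthonormal coordinates whose first axis points in a prescribed direction. -/
lemma exists_adapted_coordinates {n : ℕ} (h : EuclideanSpace ℝ (Fin (n + 1))) :
    ∃ φ : EuclideanSpace ℝ (Fin (n + 1)) ≃ᵐ ℝ × (Fin n → ℝ),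
      MeasurePreserving φ volume (volume.prod volume) ∧ (∀ x y, φ (x + y) = φ x + φ y) ∧
      (∀ x, ‖x‖ ^ 2 = (φ x).1 ^ 2 + ∑ i, (φ x).2 i ^ 2) ∧ ∃ c, φ h = (c, 0) := by
  set v : EuclideanSpace ℝ (Fin (n + 1)) := EuclideanSpace.single 0 ‖h‖ with hv
  have hn : ‖h‖ = ‖v‖ := by simp [hv]
  set ρ := (ℝ ∙ (h - v))ᗮ.reflection with hρ
  have hρh : ρ h = v := Submodule.reflection_sub hn
  refine ⟨ρ.toMeasurableEquiv.trans ((MeasurableEquiv.toLp 2 (Fin (n + 1) → ℝ)).symm.trans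
    (MeasurableEquiv.piFinSuccAbove (fun _ => ℝ) 0)), ?_, ?_, ?_, ?_⟩
  · exact ((volume_preserving_piFinSuccAbove (fun _ => ℝ) 0).comp
      (EuclideanSpace.volume_preserving_symm_measurableEquiv_toLp _)).comp ρ.measurePreserving
  · intro x y
    simp only [MeasurableEquiv.trans_apply, LinearIsometryEquiv.coe_toMeasurableEquiv, map_add]
    rfl
  · intro x
    rw [← ρ.norm_map x, EuclideanSpace.norm_sq_eq, Fin.sum_univ_succ]
    simp only [Real.norm_eq_abs, sq_abs]
    rfl
  · refine ⟨‖h‖, ?_⟩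
    simp only [MeasurableEquiv.trans_apply, LinearIsometryEquiv.coe_toMeasurableEquiv, hρh]
    ext i
    · rfl
    · simp [hv, MeasurableEquiv.piFinSuccAbove, Fin.tail]

lemma rieszForm_comp_equiv {G H : Type*} [Add G] [MeasurableSpace G] [AddGroup H]
    [MeasurableSpace H] [MeasurableAdd₂ H] {μ : Measure G} {ν : Measure H} [SFinite ν]
    (φ : G ≃ᵐ H) (hφ : MeasurePreserving φ μ ν) (hadd : ∀ x y, φ (x + y) = φ x + φ y)
    {E A F : Set H} (hE : MeasurableSet E) (hA : MeasurableSet A) (hF : MeasurableSet F) :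
    rieszForm μ (φ ⁻¹' E) (φ ⁻¹' A) (φ ⁻¹' F) = rieszForm ν E A F := by
  rw [rieszForm, rieszForm, ← hφ.setLIntegral_comp_preimage hA (measurable_measure_overlap ν hE hF)]
  refine lintegral_congr fun z => ?_
  rw [← hφ.measure_preimage_equiv]
  simp [hadd]

/-- Properties of a Steiner symmetrization in the direction `h`. -/
structure IsSteinerSymmetrization {N : ℕ} (h : EuclideanSpace ℝ (Fin N))
    (S : Set (EuclideanSpace ℝ (Fin N)) → Set (EuclideanSpace ℝ (Fin N))) : Prop where
  measurableSet : ∀ {E}, MeasurableSet E → MeasurableSet (S E)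
  volume_eq : ∀ {E}, MeasurableSet E → volume (S E) = volume E
  subset_ball : ∀ {E R}, E ⊆ ball 0 R → S E ⊆ ball 0 R
  rieszForm_le : ∀ {E A F R}, MeasurableSet E → MeasurableSet A → MeasurableSet F →
    E ⊆ ball 0 R → A ⊆ ball 0 R → F ⊆ ball 0 R →
    rieszForm volume E A F ≤ rieszForm volume (S E) (S A) (S F)
  volume_inter_ball : ∀ {E} r, MeasurableSet E →
    volume (E ∩ ball 0 r) + volume {y | h + y ∈ E \ ball 0 r ∧ y ∈ ball 0 r \ E} ≤
      volume (S E ∩ ball 0 r)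

lemma exists_isSteinerSymmetrization {n : ℕ} (h : EuclideanSpace ℝ (Fin (n + 1))) :
    ∃ S, IsSteinerSymmetrization h S := by
  obtain ⟨φ, hφ, hadd, hnorm, c, hc⟩ := exists_adapted_coordinates h
  have himg : ∀ {E : Set (EuclideanSpace ℝ (Fin (n + 1)))}, MeasurableSet E →
      MeasurableSet (φ.symm ⁻¹' E) := fun hE => φ.symm.measurable hE
  have hpre : ∀ E : Set (EuclideanSpace ℝ (Fin (n + 1))), φ ⁻¹' (φ.symm ⁻¹' E) = E := by
    intro E; ext x; simp
  have hball : ∀ r y, ∃ ρ : ℝ, ∀ s, (s, y) ∈ φ.symm ⁻¹' ball 0 r ↔ |s| < ρ := by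
    intro r y
    by_cases hr : 0 ≤ r
    · refine ⟨√(r ^ 2 - ∑ i, y i ^ 2), fun s => ?_⟩
      rw [Real.lt_sqrt (abs_nonneg s), sq_abs, Set.mem_preimage, mem_ball_zero_iff,
        ← abs_of_nonneg hr, ← abs_of_nonneg (norm_nonneg (φ.symm (s, y))), ← sq_lt_sq, hnorm,
        MeasurableEquiv.apply_symm_apply, sq_abs, lt_sub_iff_add_lt]
    · refine ⟨0, fun s => ?_⟩
      rw [ball_eq_empty.2 (not_le.1 hr).le]
      simp
  have hcoord : ∀ {E R}, E ⊆ ball 0 R → ∀ p ∈ φ.symm ⁻¹' E, |p.1| < R := by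
    intro E R hE p hp
    have h1 := mem_ball_zero_iff.1 (hE hp)
    refine lt_of_le_of_lt (abs_le_of_sq_le_sq ?_ (norm_nonneg _)) h1
    rw [hnorm, MeasurableEquiv.apply_symm_apply]
    have : 0 ≤ ∑ i, p.2 i ^ 2 := Finset.sum_nonneg fun i _ => sq_nonneg _
    linarith
  refine ⟨fun E => φ ⁻¹' steiner (φ.symm ⁻¹' E), ⟨?_, ?_, ?_, ?_, ?_⟩⟩
  · exact fun hE => φ.measurable (measurableSet_steiner (himg hE))
  · intro E hE
    rw [hφ.measure_preimage_equiv, measure_steiner _ (himg hE), ← hφ.measure_preimage_equiv, hpre]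
  · intro E R hE
    have := Set.preimage_mono (f := φ) (steiner_mono (Set.preimage_mono (f := φ.symm) hE))
    rwa [steiner_eq_self (hball R), hpre] at this
  · intro E A F R hE hA hF hER hAR hFR
    rw [rieszForm_comp_equiv φ hφ hadd (measurableSet_steiner (himg hE))
      (measurableSet_steiner (himg hA)) (measurableSet_steiner (himg hF))]
    refine le_trans (le_of_eq ?_) (rieszForm_le_steiner _ (himg hE) (himg hA) (himg hF)
      (hcoord hER) (hcoord hAR) (hcoord hFR))
    rw [← rieszForm_comp_equiv φ hφ hadd (himg hE) (himg hA) (himg hF), hpre, hpre, hpre]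
  · intro E r hE
    have := measure_inter_add_le_steiner_inter (volume : Measure (Fin n → ℝ)) (himg hE)
      (himg measurableSet_ball) (hball r) c
    rw [← hφ.measure_preimage_equiv, ← hφ.measure_preimage_equiv, ← hφ.measure_preimage_equiv,
      Set.preimage_inter, Set.preimage_inter, hpre, hpre] at this
    convert this using 3
    ext y
    simp [← hc, ← hadd]

/-- Some translation realizes at least the average overlap of two pairs of bounded sets. -/
lemma exists_overlap {N : ℕ} {R : ℝ} (hR : 0 < R)
    {P Q P' Q' : Set (EuclideanSpace ℝ (Fin N))} (hP : MeasurableSet P) (hQ : MeasurableSet Q)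
    (hP' : MeasurableSet P') (hQ' : MeasurableSet Q') (hPR : P ⊆ ball 0 R) (hQR : Q ⊆ ball 0 R)
    (hPR' : P' ⊆ ball 0 R) (hQR' : Q' ⊆ ball 0 R) :
    ∃ h, volume P * volume Q + volume P' * volume Q' ≤
      (volume {y | h + y ∈ P ∧ y ∈ Q} + volume {y | h + y ∈ P' ∧ y ∈ Q'}) *
        volume (ball (0 : EuclideanSpace ℝ (Fin N)) (2 * R)) := by
  by_contra! hcon
  set B := ball (0 : EuclideanSpace ℝ (Fin N)) (2 * R) with hB
  set g : EuclideanSpace ℝ (Fin N) → ℝ≥0∞ :=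
    fun h => volume {y | h + y ∈ P ∧ y ∈ Q} + volume {y | h + y ∈ P' ∧ y ∈ Q'} with hg
  have hB0 : volume B ≠ 0 := (measure_ball_pos _ _ (by positivity)).ne'
  have hBt : volume B ≠ ⊤ := measure_ball_lt_top.ne
  have hzero : ∀ {P Q : Set (EuclideanSpace ℝ (Fin N))}, P ⊆ ball 0 R → Q ⊆ ball 0 R →
      ∀ h, h ∉ B → volume {y | h + y ∈ P ∧ y ∈ Q} = 0 := by
    intro P Q hP hQ h hh
    have : {y | h + y ∈ P ∧ y ∈ Q} = ∅ := by
      rw [Set.eq_empty_iff_forall_notMem]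
      rintro y ⟨h1, h2⟩
      refine hh (mem_ball_zero_iff.2 ?_)
      have h3 := mem_ball_zero_iff.1 (hP h1)
      have h4 := mem_ball_zero_iff.1 (hQ h2)
      have h5 := norm_sub_le (h + y) y
      rw [add_sub_cancel_right] at h5
      linarith
    rw [this, measure_empty]
  have hint : ∫⁻ h, g h = volume P * volume Q + volume P' * volume Q' := by
    rw [lintegral_add_left (measurable_measure_overlap _ hP hQ),
      lintegral_measure_overlap _ hP hQ, lintegral_measure_overlap _ hP' hQ']
  have hint' : ∫⁻ h in B, g h = ∫⁻ h, g h := by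
    rw [← lintegral_indicator measurableSet_ball]
    congr 1; ext h
    by_cases hh : h ∈ B
    · rw [Set.indicator_of_mem hh]
    · rw [Set.indicator_of_notMem hh, hg]
      simp [hzero hPR hQR h hh, hzero hPR' hQR' h hh]
  set c := volume P * volume Q + volume P' * volume Q' with hcdef
  have hct : c ≠ ⊤ := by
    have : ∀ {P : Set (EuclideanSpace ℝ (Fin N))}, P ⊆ ball 0 R → volume P ≠ ⊤ := fun hP =>
      measure_ne_top_of_subset hP measure_ball_lt_top.ne
    exact ENNReal.add_ne_top.2 ⟨ENNReal.mul_ne_top (this hPR) (this hQR),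
      ENNReal.mul_ne_top (this hPR') (this hQR')⟩
  have hlt : ∀ h, g h < c / volume B := fun h =>
    (ENNReal.lt_div_iff_mul_lt (Or.inl hB0) (Or.inl hBt)).2 (hcon h)
  have : ∫⁻ h in B, g h < ∫⁻ _ in B, c / volume B := by
    refine setLIntegral_strict_mono measurableSet_ball hB0 measurable_const ?_ ?_
    · rw [hint', hint]; exact hct
    · exact Filter.Eventually.of_forall fun h _ => hlt h
  rw [setLIntegral_const, ENNReal.div_mul_cancel hB0 hBt, hint', hint] at this
  exact lt_irrefl _ this

end Euclidean

section Riesz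

lemma rieszForm_mono {G : Type*} [Add G] [MeasurableSpace G] (μ : Measure G)
    {E A F E' A' F' : Set G} (hE : E ⊆ E') (hA : A ⊆ A') (hF : F ⊆ F') :
    rieszForm μ E A F ≤ rieszForm μ E' A' F' :=
  (lintegral_mono_set hA).trans <|
    lintegral_mono fun _ => measure_mono fun _ hy => ⟨hE hy.1, hF hy.2⟩

lemma rieszForm_le_add {G : Type*} [AddGroup G] [MeasurableSpace G] [MeasurableAdd G]
    (μ : Measure G) [μ.IsAddLeftInvariant] {E A B C : Set G}
    (hC : MeasurableSet C) :
    rieszForm μ E A E ≤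
      rieszForm μ B C B + (2 * μ (E \ B) * μ A + μ E * μ (A \ C)) := by
  have h1 : ∀ z, μ {y | z + y ∈ E ∧ y ∈ E} ≤
      μ {y | z + y ∈ B ∧ y ∈ B} + 2 * μ (E \ B) := by
    intro z
    calc μ {y | z + y ∈ E ∧ y ∈ E}
        ≤ μ ({y | z + y ∈ B ∧ y ∈ B} ∪ (((fun y => z + y) ⁻¹' (E \ B)) ∪ (E \ B))) := by
          refine measure_mono ?_
          rintro y ⟨h1, h2⟩
          by_cases h3 : z + y ∈ B
          · by_cases h4 : y ∈ B
            · exact Or.inl ⟨h3, h4⟩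
            · exact Or.inr (Or.inr ⟨h2, h4⟩)
          · exact Or.inr (Or.inl ⟨h1, h3⟩)
      _ ≤ μ {y | z + y ∈ B ∧ y ∈ B} + (μ ((fun y => z + y) ⁻¹' (E \ B)) + μ (E \ B)) :=
          (measure_union_le _ _).trans (add_le_add_right (measure_union_le _ _) _)
      _ = _ := by rw [measure_preimage_add, two_mul]
  have h2 : ∀ z, μ {y | z + y ∈ E ∧ y ∈ E} ≤ μ E := fun z => measure_mono fun y hy => hy.2
  calc rieszForm μ E A E
      = ∫⁻ z in A ∩ C, μ {y | z + y ∈ E ∧ y ∈ E} ∂μ +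
        ∫⁻ z in A \ C, μ {y | z + y ∈ E ∧ y ∈ E} ∂μ :=
        (lintegral_inter_add_sdiff _ A hC).symm
    _ ≤ ∫⁻ z in A ∩ C, (μ {y | z + y ∈ B ∧ y ∈ B} + 2 * μ (E \ B)) ∂μ +
        ∫⁻ _ in A \ C, μ E ∂μ :=
        add_le_add (lintegral_mono h1) (lintegral_mono h2)
    _ = ∫⁻ z in A ∩ C, μ {y | z + y ∈ B ∧ y ∈ B} ∂μ + 2 * μ (E \ B) * μ (A ∩ C) +
        μ E * μ (A \ C) := by
        rw [lintegral_add_right _ measurable_const, setLIntegral_const, setLIntegral_const]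
    _ ≤ rieszForm μ B C B + 2 * μ (E \ B) * μ A + μ E * μ (A \ C) := by
        refine add_le_add_left (add_le_add ?_ ?_) _
        · exact lintegral_mono_set Set.inter_subset_right
        · gcongr
          exact Set.inter_subset_left
    _ = _ := add_assoc _ _ _

lemma measure_sdiff_comm {α : Type*} [MeasurableSpace α] {μ : Measure α} {E B : Set α}
    (hE : MeasurableSet E) (hB : MeasurableSet B) (h : μ B = μ E) (hfin : μ E ≠ ⊤) :
    μ (B \ E) = μ (E \ B) := by
  have h1 := measure_inter_add_sdiff (μ := μ) E hB
  have h2 := measure_inter_add_sdiff (μ := μ) B hE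
  rw [Set.inter_comm, h, ← h1] at h2
  exact (ENNReal.add_right_inj (measure_ne_top_of_subset Set.inter_subset_left hfin)).1 h2

lemma IsSteinerSymmetrization.volume_sdiff_ball {N : ℕ} {h : EuclideanSpace ℝ (Fin N)}
    {S : Set (EuclideanSpace ℝ (Fin N)) → Set (EuclideanSpace ℝ (Fin N))}
    (hS : IsSteinerSymmetrization h S) {E : Set (EuclideanSpace ℝ (Fin N))} (r : ℝ)
    (hE : MeasurableSet E) (hfin : volume E ≠ ⊤) :
    volume (S E \ ball 0 r) + volume {y | h + y ∈ E \ ball 0 r ∧ y ∈ ball 0 r \ E} ≤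
      volume (E \ ball 0 r) := by
  set T := volume {y | h + y ∈ E \ ball 0 r ∧ y ∈ ball 0 r \ E}
  have h1 := measure_inter_add_sdiff (μ := volume) (S E)
    (measurableSet_ball (x := (0 : EuclideanSpace ℝ (Fin N))) (ε := r))
  have h2 := measure_inter_add_sdiff (μ := volume) E
    (measurableSet_ball (x := (0 : EuclideanSpace ℝ (Fin N))) (ε := r))
  rw [hS.volume_eq hE, ← h2] at h1
  refine (ENNReal.add_le_add_iff_left
    (measure_ne_top_of_subset Set.inter_subset_left hfin : volume (E ∩ ball 0 r) ≠ ⊤)).1 ?_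
  rw [← h1, add_comm (volume (S E \ _)), ← add_assoc]
  exact add_le_add_left (hS.volume_inter_ball r hE) _

/-- The Riesz rearrangement inequality for bounded sets. -/
lemma rieszForm_le_ball_of_bounded {n : ℕ} {E A : Set (EuclideanSpace ℝ (Fin (n + 1)))}
    (hE : MeasurableSet E) (hA : MeasurableSet A) {R r ρ : ℝ} (hR : 0 < R) (hrR : r ≤ R)
    (hρR : ρ ≤ R) (hER : E ⊆ ball 0 R) (hAR : A ⊆ ball 0 R)
    (hr : volume (ball (0 : EuclideanSpace ℝ (Fin (n + 1))) r) = volume E)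
    (hρ : volume (ball (0 : EuclideanSpace ℝ (Fin (n + 1))) ρ) = volume A) :
    rieszForm volume E A E ≤ rieszForm volume (ball (0 : EuclideanSpace ℝ (Fin (n + 1))) r) (ball 0 ρ) (ball 0 r) := by
  set X : Set ℝ≥0∞ := {d | ∃ E' A' : Set (EuclideanSpace ℝ (Fin (n + 1))),
    MeasurableSet E' ∧ MeasurableSet A' ∧ E' ⊆ ball 0 R ∧ A' ⊆ ball 0 R ∧
    volume E' = volume E ∧ volume A' = volume A ∧
    rieszForm volume E A E ≤ rieszForm volume E' A' E' ∧
    d = volume (E' \ ball 0 r) + volume (A' \ ball 0 ρ)} with hX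
  have hEfin : volume E ≠ ⊤ := measure_ne_top_of_subset hER measure_ball_lt_top.ne
  have hAfin : volume A ≠ ⊤ := measure_ne_top_of_subset hAR measure_ball_lt_top.ne
  set V := volume (ball (0 : EuclideanSpace ℝ (Fin (n + 1))) (2 * R)) with hV
  have hV0 : V ≠ 0 := (measure_ball_pos _ _ (by positivity)).ne'
  have hVt : V ≠ ⊤ := measure_ball_lt_top.ne
  have hstep : ∀ d ∈ X, ∃ d' ∈ X, ∃ T, d' + T ≤ d ∧ d * d ≤ T * (4 * V) := by
    rintro d ⟨E', A', hE', hA', hER', hAR', hvE, hvA, hle, rfl⟩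
    have hEfin' : volume E' ≠ ⊤ := hvE ▸ hEfin
    have hAfin' : volume A' ≠ ⊤ := hvA ▸ hAfin
    obtain ⟨h, hh⟩ := exists_overlap hR (hE'.diff (measurableSet_ball (x := 0) (ε := r)))
      (measurableSet_ball.diff hE') (hA'.diff (measurableSet_ball (x := 0) (ε := ρ)))
      (measurableSet_ball.diff hA')
      (Set.sdiff_subset.trans hER') (Set.sdiff_subset.trans (ball_subset_ball hrR))
      (Set.sdiff_subset.trans hAR') (Set.sdiff_subset.trans (ball_subset_ball hρR))
    rw [measure_sdiff_comm hE' measurableSet_ball (hr.trans hvE.symm) hEfin',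
      measure_sdiff_comm hA' measurableSet_ball (hρ.trans hvA.symm) hAfin'] at hh
    obtain ⟨S, hS⟩ := exists_isSteinerSymmetrization h
    refine ⟨_, ⟨S E', S A', hS.measurableSet hE', hS.measurableSet hA', hS.subset_ball hER',
      hS.subset_ball hAR', (hS.volume_eq hE').trans hvE, (hS.volume_eq hA').trans hvA,
      hle.trans (hS.rieszForm_le hE' hA' hE' hER' hAR' hER'), rfl⟩,
      volume {y | h + y ∈ E' \ ball 0 r ∧ y ∈ ball 0 r \ E'} +
        volume {y | h + y ∈ A' \ ball 0 ρ ∧ y ∈ ball 0 ρ \ A'}, ?_, ?_⟩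
    · rw [add_add_add_comm]
      exact add_le_add (hS.volume_sdiff_ball r hE' hEfin') (hS.volume_sdiff_ball ρ hA' hAfin')
    · rw [mul_left_comm]
      refine le_trans ?_ (mul_le_mul_right hh 4)
      have key : ∀ a b : ℝ≥0∞, a ≤ b → (a + b) * (a + b) ≤ 4 * (a * a + b * b) := by
        intro a b hab
        calc (a + b) * (a + b) ≤ (b + b) * (b + b) := by gcongr
          _ = 4 * (b * b) := by ring
          _ ≤ _ := by gcongr; exact le_add_self
      rcases le_total (volume (E' \ ball 0 r)) (volume (A' \ ball 0 ρ)) with h | h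
      · exact key _ _ h
      · rw [add_comm (volume (E' \ ball 0 r)), add_comm (_ * _)]
        exact key _ _ h
  have hne : volume (E \ ball 0 r) + volume (A \ ball 0 ρ) ∈ X :=
    ⟨E, A, hE, hA, hER, hAR, rfl, rfl, le_rfl, rfl⟩
  have hinf : sInf X = 0 := by
    have hfin : sInf X ≠ ⊤ := ne_top_of_le_ne_top (ENNReal.add_ne_top.2
      ⟨measure_ne_top_of_subset Set.sdiff_subset hEfin,
        measure_ne_top_of_subset Set.sdiff_subset hAfin⟩) (sInf_le hne)
    have h4V : 4 * V ≠ ⊤ := ENNReal.mul_ne_top (by simp) hVt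
    have h1 : sInf X + sInf X * sInf X / (4 * V) ≤ sInf X := by
      refine le_sInf fun d hd => ?_
      obtain ⟨d', hd', T, hT1, hT2⟩ := hstep d hd
      refine le_trans (add_le_add (sInf_le hd') ?_) hT1
      exact ENNReal.div_le_of_le_mul ((mul_le_mul' (sInf_le hd) (sInf_le hd)).trans hT2)
    have h2 : sInf X * sInf X / (4 * V) = 0 := by
      have : sInf X + sInf X * sInf X / (4 * V) ≤ sInf X + 0 := by simpa using h1
      exact nonpos_iff_eq_zero.1 ((ENNReal.add_le_add_iff_left hfin).1 this)
    rcases ENNReal.div_eq_zero_iff.1 h2 with h | h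
    · exact mul_self_eq_zero.1 h
    · exact absurd h h4V
  set M := 2 * volume A + volume E with hM
  have hMt : M ≠ ⊤ := ENNReal.add_ne_top.2 ⟨ENNReal.mul_ne_top (by simp) hAfin, hEfin⟩
  have hbound : ∀ d ∈ X, (rieszForm volume E A E -
      rieszForm volume (ball (0 : EuclideanSpace ℝ (Fin (n + 1))) r) (ball 0 ρ) (ball 0 r)) / M ≤ d := by
    rintro d ⟨E', A', hE', hA', hER', hAR', hvE, hvA, hle, rfl⟩
    refine ENNReal.div_le_of_le_mul (tsub_le_iff_left.2 ?_)
    refine hle.trans ((rieszForm_le_add volume (B := ball 0 r)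
      (C := ball 0 ρ) measurableSet_ball).trans (add_le_add_right ?_ _))
    rw [hvE, hvA, hM, add_mul, mul_add, mul_add]
    calc _ = volume (E' \ ball 0 r) * (2 * volume A) + volume (A' \ ball 0 ρ) * volume E := by ring
      _ ≤ _ := add_le_add le_self_add le_add_self
  have h0 := le_sInf hbound
  rw [hinf, nonpos_iff_eq_zero, ENNReal.div_eq_zero_iff] at h0
  exact tsub_eq_zero_iff_le.1 (h0.resolve_right hMt)

lemma exists_volume_ball_eq {n : ℕ} {c : ℝ≥0∞} (hc : c ≠ ⊤) :
    ∃ r, 0 ≤ r ∧ volume (ball (0 : EuclideanSpace ℝ (Fin (n + 1))) r) = c := by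
  set v := volume (ball (0 : EuclideanSpace ℝ (Fin (n + 1))) 1) with hv
  have hv0 : v ≠ 0 := (measure_ball_pos _ _ one_pos).ne'
  have hvt : v ≠ ⊤ := measure_ball_lt_top.ne
  refine ⟨(c / v).toReal ^ ((n + 1 : ℕ) : ℝ)⁻¹, by positivity, ?_⟩
  rw [Measure.addHaar_ball _ _ (by positivity), finrank_euclideanSpace_fin,
    Real.rpow_inv_natCast_pow ENNReal.toReal_nonneg (by simp),
    ENNReal.ofReal_toReal (ENNReal.div_ne_top hc hv0), ENNReal.div_mul_cancel hv0 hvt]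

lemma volume_ball_lt_iff {n : ℕ} {r s : ℝ} (hr : 0 ≤ r) (hs : 0 ≤ s) :
    volume (ball (0 : EuclideanSpace ℝ (Fin (n + 1))) r) <
      volume (ball (0 : EuclideanSpace ℝ (Fin (n + 1))) s) ↔ r < s := by
  rw [Measure.addHaar_ball _ _ hr, Measure.addHaar_ball _ _ hs, finrank_euclideanSpace_fin,
    ENNReal.mul_lt_mul_iff_left (measure_ball_pos _ _ one_pos).ne' measure_ball_lt_top.ne,
    ENNReal.ofReal_lt_ofReal_iff_of_nonneg (by positivity),
    pow_lt_pow_iff_left₀ hr hs (by simp)]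

lemma tendsto_volume_sdiff_ball {N : ℕ} {E : Set (EuclideanSpace ℝ (Fin N))}
    (hE : MeasurableSet E) (hfin : volume E ≠ ⊤) :
    Tendsto (fun k : ℕ => volume (E \ (E ∩ ball 0 (k : ℝ)))) atTop (𝓝 0) := by
  have h := tendsto_measure_iInter_atTop (μ := volume)
    (s := fun k : ℕ => E \ (E ∩ ball 0 (k : ℝ)))
    (fun k => (hE.diff (hE.inter measurableSet_ball)).nullMeasurableSet)
    (fun k l hkl => Set.sdiff_subset_sdiff_right
      (Set.inter_subset_inter_right _ (ball_subset_ball (by exact_mod_cast hkl))))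
    ⟨0, measure_ne_top_of_subset Set.sdiff_subset hfin⟩
  have h0 : ⋂ k : ℕ, E \ (E ∩ ball 0 (k : ℝ)) = ∅ := by
    rw [Set.eq_empty_iff_forall_notMem]
    intro x hx
    obtain ⟨k, hk⟩ := exists_nat_gt ‖x‖
    have := Set.mem_iInter.1 hx k
    exact this.2 ⟨this.1, mem_ball_zero_iff.2 hk⟩
  rwa [h0, measure_empty] at h

/-- The Riesz rearrangement inequality for sets of finite measure. -/
theorem rieszForm_le_ball {n : ℕ} {E A : Set (EuclideanSpace ℝ (Fin (n + 1)))}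
    (hE : MeasurableSet E) (hA : MeasurableSet A) (hEfin : volume E ≠ ⊤) (hAfin : volume A ≠ ⊤)
    {r ρ : ℝ} (hr0 : 0 ≤ r) (hρ0 : 0 ≤ ρ)
    (hr : volume (ball (0 : EuclideanSpace ℝ (Fin (n + 1))) r) = volume E)
    (hρ : volume (ball (0 : EuclideanSpace ℝ (Fin (n + 1))) ρ) = volume A) :
    rieszForm volume E A E ≤ rieszForm volume (ball (0 : EuclideanSpace ℝ (Fin (n + 1))) r) (ball 0 ρ) (ball 0 r) := by
  have hradius : ∀ {E : Set (EuclideanSpace ℝ (Fin (n + 1)))} {r : ℝ}, volume E ≠ ⊤ → 0 ≤ r →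
      volume (ball (0 : EuclideanSpace ℝ (Fin (n + 1))) r) = volume E → ∀ k : ℕ,
      ∃ s ≤ r, volume (ball (0 : EuclideanSpace ℝ (Fin (n + 1))) s) =
        volume (E ∩ ball 0 (k : ℝ)) := by
    intro E r hfin hr0 hr k
    obtain ⟨s, hs0, hs⟩ := exists_volume_ball_eq (n := n)
      (measure_ne_top_of_subset (Set.inter_subset_left (t := ball 0 (k : ℝ))) hfin)
    refine ⟨s, ?_, hs⟩
    by_contra! h
    have h1 := (volume_ball_lt_iff (n := n) hr0 hs0).2 h
    rw [hr, hs] at h1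
    exact absurd (measure_mono Set.inter_subset_left) (not_le.2 h1)
  have hk : ∀ k : ℕ, rieszForm volume E A E ≤
      rieszForm volume (ball (0 : EuclideanSpace ℝ (Fin (n + 1))) r) (ball 0 ρ) (ball 0 r) +
        (2 * volume (E \ (E ∩ ball 0 (k : ℝ))) * volume A +
          volume E * volume (A \ (A ∩ ball 0 (k : ℝ)))) := by
    intro k
    obtain ⟨s, hsr, hs⟩ := hradius hEfin hr0 hr k
    obtain ⟨σ, hσρ, hσ⟩ := hradius hAfin hρ0 hρ k
    refine (rieszForm_le_add volume (B := E ∩ ball 0 (k : ℝ)) (C := A ∩ ball 0 (k : ℝ))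
      (hA.inter measurableSet_ball)).trans (add_le_add_left ?_ _)
    have hsub : ∀ E : Set (EuclideanSpace ℝ (Fin (n + 1))),
        E ∩ ball 0 (k : ℝ) ⊆ ball 0 (k + r + ρ + 1) := fun E =>
      Set.inter_subset_right.trans (ball_subset_ball (by linarith))
    have hk0 : (0 : ℝ) ≤ k := k.cast_nonneg
    refine (rieszForm_le_ball_of_bounded (hE.inter measurableSet_ball)
      (hA.inter measurableSet_ball) (by linarith) (by linarith) (by linarith) (hsub E) (hsub A)
      hs hσ).trans ?_
    exact rieszForm_mono _ (ball_subset_ball hsr) (ball_subset_ball hσρ) (ball_subset_ball hsr)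
  have hlim : Tendsto (fun k : ℕ => rieszForm volume (ball (0 : EuclideanSpace ℝ (Fin (n + 1))) r) (ball 0 ρ) (ball 0 r) +
        (2 * volume (E \ (E ∩ ball 0 (k : ℝ))) * volume A +
          volume E * volume (A \ (A ∩ ball 0 (k : ℝ))))) atTop
      (𝓝 (rieszForm volume (ball (0 : EuclideanSpace ℝ (Fin (n + 1))) r) (ball 0 ρ) (ball 0 r) +
        (2 * 0 * volume A + volume E * 0))) := by
    refine tendsto_const_nhds.add (Tendsto.add ?_ ?_)
    · exact ENNReal.Tendsto.mul_const (ENNReal.Tendsto.const_mul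
        (tendsto_volume_sdiff_ball hE hEfin) (Or.inr (by simp))) (Or.inr hAfin)
    · exact ENNReal.Tendsto.const_mul (tendsto_volume_sdiff_ball hA hAfin) (Or.inr hEfin)
  simpa using ge_of_tendsto' hlim hk

end Riesz

section Perimeter

lemma lintegral_indicator_sub_eq_rieszForm {G : Type*} [AddGroup G] [MeasurableSpace G]
    [MeasurableAdd₂ G] [MeasurableSub₂ G] (μ : Measure G) [SFinite μ] [μ.IsAddRightInvariant]
    {E A F : Set G} (hE : MeasurableSet E) (hA : MeasurableSet A) (hF : MeasurableSet F) :
    ∫⁻ x in E, ∫⁻ y in F, A.indicator (fun _ => (1 : ℝ≥0∞)) (x - y) ∂μ ∂μ =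
      rieszForm μ E A F := by
  have hS : MeasurableSet {p : G × G | p.1 ∈ E ∧ p.2 ∈ F ∧ p.1 - p.2 ∈ A} :=
    (measurable_fst hE).inter ((measurable_snd hF).inter (measurable_sub hA))
  have hT : MeasurableSet {p : G × G | p.1 ∈ A ∧ p.1 + p.2 ∈ E ∧ p.2 ∈ F} :=
    (measurable_fst hA).inter ((measurable_add hE).inter (measurable_snd hF))
  have h1 : ∫⁻ x in E, ∫⁻ y in F, A.indicator (fun _ => (1 : ℝ≥0∞)) (x - y) ∂μ ∂μ =
      (μ.prod μ) {p : G × G | p.1 ∈ E ∧ p.2 ∈ F ∧ p.1 - p.2 ∈ A} := by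
    rw [Measure.prod_apply hS, ← lintegral_indicator hE]
    refine lintegral_congr fun x => ?_
    have hx : MeasurableSet {y | x - y ∈ A} := (measurable_const_sub x) hA
    by_cases h : x ∈ E
    · rw [Set.indicator_of_mem h]
      have h2 : (fun y => A.indicator (fun _ => (1 : ℝ≥0∞)) (x - y)) =
          {y | x - y ∈ A}.indicator 1 := by
        rfl
      rw [h2, lintegral_indicator_one hx, Measure.restrict_apply hx, Set.inter_comm]
      congr 1
      ext y; simp [h]
    · rw [Set.indicator_of_notMem h]
      simp [h]
  have h2 : rieszForm μ E A F =
      (μ.prod μ) {p : G × G | p.1 ∈ A ∧ p.1 + p.2 ∈ E ∧ p.2 ∈ F} := by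
    rw [Measure.prod_apply hT, rieszForm, ← lintegral_indicator hA]
    refine lintegral_congr fun z => ?_
    by_cases h : z ∈ A
    · rw [Set.indicator_of_mem h]
      congr 1
      ext y; simp [h]
    · rw [Set.indicator_of_notMem h]
      simp [h]
  rw [h1, h2, Measure.prod_apply_symm hS, Measure.prod_apply_symm hT]
  refine lintegral_congr fun y => ?_
  rw [← measure_preimage_add_right μ y]
  congr 1
  ext z
  simp only [Set.mem_preimage, Set.mem_ofPred_eq, add_sub_cancel_right]
  tauto

lemma rieszForm_compl_add {G : Type*} [AddGroup G] [MeasurableSpace G] [MeasurableAdd₂ G]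
    (μ : Measure G) [SFinite μ] [μ.IsAddLeftInvariant] {E A : Set G} (hE : MeasurableSet E) :
    rieszForm μ E A Eᶜ + rieszForm μ E A E = μ E * μ A := by
  rw [rieszForm, rieszForm, ← lintegral_add_left (measurable_measure_overlap μ hE hE.compl),
    ← setLIntegral_const]
  refine lintegral_congr fun z => ?_
  rw [← measure_preimage_add μ z E, add_comm]
  exact measure_inter_add_sdiff ((fun y => z + y) ⁻¹' E) hE

lemma perK_eq_lintegral_rieszForm {N : ℕ} {A : ℝ → Set (EuclideanSpace ℝ (Fin N))}
    (hA : MeasurableSet {p : ℝ × EuclideanSpace ℝ (Fin N) | p.2 ∈ A p.1})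
    {W : EuclideanSpace ℝ (Fin N) → ℝ≥0∞}
    (hW : ∀ z, W z = ∫⁻ t in Set.Ioi (0 : ℝ), (A t).indicator (fun _ => (1 : ℝ≥0∞)) z)
    {E : Set (EuclideanSpace ℝ (Fin N))} (hE : MeasurableSet E) :
    perK W E = ∫⁻ t in Set.Ioi (0 : ℝ), rieszForm volume E (A t) Eᶜ := by
  set f : ℝ × EuclideanSpace ℝ (Fin N) → ℝ≥0∞ :=
    {p : ℝ × EuclideanSpace ℝ (Fin N) | p.2 ∈ A p.1}.indicator (fun _ => 1) with hf
  have hfm : Measurable f := measurable_const.indicator hA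
  have hfA : ∀ t z, (A t).indicator (fun _ => (1 : ℝ≥0∞)) z = f (t, z) := fun t z => rfl
  have hAt : ∀ t, MeasurableSet (A t) := fun t => measurable_prodMk_left (x := t) hA
  simp_rw [perK, hW]
  calc ∫⁻ x in E, ∫⁻ y in Eᶜ, ∫⁻ t in Set.Ioi (0 : ℝ),
        (A t).indicator (fun _ => (1 : ℝ≥0∞)) (x - y)
      = ∫⁻ x in E, ∫⁻ t in Set.Ioi (0 : ℝ), ∫⁻ y in Eᶜ,
        (A t).indicator (fun _ => (1 : ℝ≥0∞)) (x - y) := by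
        refine lintegral_congr fun x => lintegral_lintegral_swap ?_
        simp_rw [hfA]
        exact (hfm.comp (by fun_prop : Measurable fun p : EuclideanSpace ℝ (Fin N) × ℝ =>
          (p.2, x - p.1))).aemeasurable
    _ = ∫⁻ t in Set.Ioi (0 : ℝ), ∫⁻ x in E, ∫⁻ y in Eᶜ,
        (A t).indicator (fun _ => (1 : ℝ≥0∞)) (x - y) := by
        refine lintegral_lintegral_swap ?_
        simp_rw [hfA]
        exact (Measurable.lintegral_prod_right' (f := fun p :
          (EuclideanSpace ℝ (Fin N) × ℝ) × EuclideanSpace ℝ (Fin N) => f (p.1.2, p.1.1 - p.2))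
          (hfm.comp (by fun_prop))).aemeasurable
    _ = _ := lintegral_congr fun t =>
        lintegral_indicator_sub_eq_rieszForm volume hE (hAt t) hE.compl

lemma volume_superlevel_ne_top {N : ℕ} {K : EuclideanSpace ℝ (Fin N) → ℝ}
    (hKint : Integrable (fun x : EuclideanSpace ℝ (Fin N) => min ‖x‖ 1 * K x) volume)
    {t : ℝ} (ht : 0 < t) : volume {z | t < K z} ≠ ⊤ := by
  have h1 := (hKint.measure_gt_lt_top ht).ne
  refine measure_ne_top_of_subset (s := ball 0 1 ∪ {x | t < min ‖x‖ 1 * K x}) ?_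
    (measure_union_lt_top measure_ball_lt_top h1.lt_top).ne
  intro z hz
  by_cases h : ‖z‖ < 1
  · exact Or.inl (mem_ball_zero_iff.2 h)
  · refine Or.inr ?_
    change t < min ‖z‖ 1 * K z
    rw [min_eq_right (not_lt.1 h), one_mul]
    exact hz

end Perimeter

/-- General isoperimetric inequality: for every measurable `E ⊆ ℝ^N` with
`|E| < ∞`, `Per_K(E) ≥ Per_{K*}(B_{|E|})`, where `K*` is the symmetric decreasing rearrangement
of `K` and `B_{|E|}` is the ball centered at the origin with Lebesgue measure `|E|`. -/
theorem general_isoperimetric {N : ℕ} (hN : 0 < N) (K : EuclideanSpace ℝ (Fin N) → ℝ)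
    (hKmeas : Measurable K) (hKnonneg : ∀ x, 0 ≤ K x)
    (hKsymm : ∀ᵐ x ∂(volume : Measure (EuclideanSpace ℝ (Fin N))), K (-x) = K x)
    (hKint : Integrable (fun x : EuclideanSpace ℝ (Fin N) => min ‖x‖ 1 * K x) volume)
    (E : Set (EuclideanSpace ℝ (Fin N))) (hE : MeasurableSet E) (hEfin : volume E < ⊤)
    (r : ℝ) (hr : 0 ≤ r)
    (hball : volume (ball (0 : EuclideanSpace ℝ (Fin N)) r) = volume E) :
    perK (symmDecrRearrangement K) (ball (0 : EuclideanSpace ℝ (Fin N)) r) ≤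
      perK (fun z => ENNReal.ofReal (K z)) E := by
  obtain ⟨n, rfl⟩ : ∃ n, N = n + 1 := ⟨N - 1, by omega⟩
  have hmeasK : MeasurableSet {p : ℝ × EuclideanSpace ℝ (Fin (n + 1)) | p.2 ∈ {z | p.1 < K z}} :=
    measurableSet_lt measurable_fst (hKmeas.comp measurable_snd)
  have hball_mono : Monotone fun s : ℝ =>
      volume (ball (0 : EuclideanSpace ℝ (Fin (n + 1))) s) :=
    fun _ _ h => measure_mono (ball_subset_ball h)
  have hlevel_anti : Antitone fun t : ℝ => volume {z | t < K z} :=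
    fun _ _ h => measure_mono fun _ hz => lt_of_le_of_lt h hz
  have hmeasStar : MeasurableSet {p : ℝ × EuclideanSpace ℝ (Fin (n + 1)) |
      p.2 ∈ {y : EuclideanSpace ℝ (Fin (n + 1)) |
        volume (ball (0 : EuclideanSpace ℝ (Fin (n + 1))) ‖y‖) < volume {z | p.1 < K z}}} :=
    measurableSet_lt (hball_mono.measurable.comp measurable_snd.norm)
      (hlevel_anti.measurable.comp measurable_fst)
  rw [perK_eq_lintegral_rieszForm hmeasStar
    (W := symmDecrRearrangement K) (fun z => rfl) measurableSet_ball,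
    perK_eq_lintegral_rieszForm (A := fun t => {z | t < K z}) hmeasK (fun z => ?_) hE]
  · refine setLIntegral_mono' measurableSet_Ioi fun t ht => ?_
    have hA : MeasurableSet {z | t < K z} := measurableSet_lt measurable_const hKmeas
    have hAfin := volume_superlevel_ne_top hKint ht
    obtain ⟨ρ, hρ0, hρ⟩ := exists_volume_ball_eq (n := n) hAfin
    have hstar : {y : EuclideanSpace ℝ (Fin (n + 1)) |
        volume (ball (0 : EuclideanSpace ℝ (Fin (n + 1))) ‖y‖) < volume {z | t < K z}} =
        ball 0 ρ := by
      ext y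
      rw [Set.mem_ofPred_eq, ← hρ, volume_ball_lt_iff (norm_nonneg y) hρ0, mem_ball_zero_iff]
    rw [hstar]
    have h1 := rieszForm_le_ball hE hA hEfin.ne hAfin hr hρ0 hball hρ
    have h2 := rieszForm_compl_add (A := {z | t < K z}) volume hE
    have h3 := rieszForm_compl_add (A := ball (0 : EuclideanSpace ℝ (Fin (n + 1))) ρ) volume
      (measurableSet_ball (x := (0 : EuclideanSpace ℝ (Fin (n + 1)))) (ε := r))
    rw [hball, hρ, ← h2] at h3
    have hfin : rieszForm volume (ball (0 : EuclideanSpace ℝ (Fin (n + 1))) r) (ball 0 ρ)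
        (ball 0 r) ≠ ⊤ := by
      refine ne_top_of_le_ne_top (ENNReal.mul_ne_top hEfin.ne hAfin) ?_
      rw [← h2, ← h3]
      exact le_add_self
    refine (ENNReal.add_le_add_iff_right hfin).1 ?_
    rw [h3]
    exact add_le_add_right h1 _
  · have h : (fun t : ℝ => {z | t < K z}.indicator (fun _ => (1 : ℝ≥0∞)) z) =
        (Set.Iio (K z)).indicator 1 := by
      ext t; simp [Set.indicator_apply]
    rw [h, lintegral_indicator_one measurableSet_Iio, Measure.restrict_apply measurableSet_Iio,
      Set.inter_comm, Set.Ioi_inter_Iio, Real.volume_Ioo, sub_zero]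
end

section
/- Let K : ℝ^N → [0,∞) be measurable, radially symmetric and radially decreasing (K(x) = k(|x|) with k nonincreasing), and assume K ∈ L¹(ℝ^N). Then for every m > 0 one has Per_K(B_m) ≤ ‖K‖_{L¹(ℝ^N)} · m, and moreover lim_{m→0⁺} Per_K(B_m)/m = ‖K‖_{L¹(ℝ^N)}, where B_m is the ball centered at the origin with Lebesgue measure m. -/
open MeasureTheory Filter Metric
open scoped ENNReal Topology

theorem perK_le_lintegral_mul_volume {N : ℕ} (W : EuclideanSpace ℝ (Fin N) → ℝ≥0∞)
    (E : Set (EuclideanSpace ℝ (Fin N))) :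
    perK W E ≤ (∫⁻ z, W z) * volume E := by
  calc perK W E ≤ ∫⁻ _ in E, ∫⁻ z, W z := by
        refine lintegral_mono fun x => ?_
        rw [← lintegral_sub_left_eq_self W x]
        exact setLIntegral_le_lintegral _ _
    _ = (∫⁻ z, W z) * volume E := setLIntegral_const _ _

theorem lintegral_sub_mul_volume_le_perK_ball {N : ℕ} {W : EuclideanSpace ℝ (Fin N) → ℝ≥0∞}
    (r : ℝ) :
    ((∫⁻ z, W z) - ∫⁻ z in ball 0 (2 * r), W z) * volume (ball (0 : EuclideanSpace ℝ (Fin N)) r) ≤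
      perK W (ball 0 r) := by
  rw [← setLIntegral_const]
  refine setLIntegral_mono' measurableSet_ball fun x hx => ?_
  rw [tsub_le_iff_left, ← lintegral_add_compl W measurableSet_ball]
  refine add_le_add_right ?_ _
  rw [← lintegral_indicator measurableSet_ball.compl, ← lintegral_indicator measurableSet_ball.compl,
    ← lintegral_sub_left_eq_self _ x]
  refine lintegral_mono fun y => ?_
  by_cases hy : x - y ∈ (ball (0 : EuclideanSpace ℝ (Fin N)) (2 * r))ᶜ
  · have hy' : y ∈ (ball (0 : EuclideanSpace ℝ (Fin N)) r)ᶜ := by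
      simp only [Set.mem_compl_iff, mem_ball_zero_iff, not_lt] at hx hy ⊢
      linarith [norm_sub_le x y]
    rw [Set.indicator_of_mem hy, Set.indicator_of_mem hy']
  · simp [Set.indicator_of_notMem hy]

open scoped Pointwise in
/-- if `K(x) = k(|x|)` with `k` nonincreasing on `[0,∞)` and `K ∈ L¹(ℝ^N)`,
then for every `m > 0` one has `Per_K(B_m) ≤ ‖K‖_{L¹} m`, and
`Per_K(B_m)/m → ‖K‖_{L¹}` as `m → 0⁺`, where `B_m` is the ball centered at the origin with
Lebesgue measure `m` (here `‖K‖_{L¹} = ∫ K` since `K ≥ 0`). -/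
theorem profile_slope_of_integrable {N : ℕ} (hN : 0 < N)
    (K : EuclideanSpace ℝ (Fin N) → ℝ)
    (hKmeas : Measurable K) (hKnonneg : ∀ x, 0 ≤ K x)
    (k : ℝ → ℝ) (hkmono : AntitoneOn k (Set.Ici 0)) (hknonneg : ∀ t ∈ Set.Ici (0 : ℝ), 0 ≤ k t)
    (hrad : ∀ x, K x = k ‖x‖)
    (hKL1 : Integrable K volume)
    (B : ℝ → Set (EuclideanSpace ℝ (Fin N)))
    (hB : ∀ m : ℝ, 0 < m → ∃ r : ℝ, 0 < r ∧ B m = ball (0 : EuclideanSpace ℝ (Fin N)) r ∧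
      volume (B m) = ENNReal.ofReal m) :
    (∀ m : ℝ, 0 < m →
      perK (fun z => ENNReal.ofReal (K z)) (B m) ≤ ENNReal.ofReal ((∫ x, K x) * m)) ∧
    Tendsto (fun m : ℝ => perK (fun z => ENNReal.ofReal (K z)) (B m) / ENNReal.ofReal m)
      (𝓝[>] (0 : ℝ)) (𝓝 (ENNReal.ofReal (∫ x, K x))) := by
  have hA : ENNReal.ofReal (∫ x, K x) = ∫⁻ x, ENNReal.ofReal (K x) :=
    ofReal_integral_eq_lintegral_ofReal hKL1 (.of_forall hKnonneg)
  have hfin : ∫⁻ x, ENNReal.ofReal (K x) ≠ ∞ := hA ▸ ENNReal.ofReal_ne_top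
  have hupper : ∀ m : ℝ, 0 < m → perK (fun z => ENNReal.ofReal (K z)) (B m) ≤
      ENNReal.ofReal (∫ x, K x) * ENNReal.ofReal m := by
    intro m hm
    obtain ⟨r, -, -, hvol⟩ := hB m hm
    rw [← hvol, hA]
    exact perK_le_lintegral_mul_volume _ _
  refine ⟨fun m hm => ?_, ?_⟩
  · rw [ENNReal.ofReal_mul (integral_nonneg hKnonneg)]
    exact hupper m hm
  have hvol : Tendsto (fun m : ℝ => volume ((2 : ℝ) • B m)) (𝓝[>] 0) (𝓝 0) := by
    have h : Tendsto (fun m : ℝ => ENNReal.ofReal (|(2 : ℝ) ^ N| * m)) (𝓝[>] 0) (𝓝 0) := by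
      have hc : Continuous fun m : ℝ => ENNReal.ofReal (|(2 : ℝ) ^ N| * m) :=
        ENNReal.continuous_ofReal.comp (continuous_const_mul _)
      simpa using (hc.tendsto 0).mono_left nhdsWithin_le_nhds
    refine h.congr' ?_
    filter_upwards [self_mem_nhdsWithin] with m hm
    obtain ⟨r, -, -, hvol⟩ := hB m hm
    rw [Measure.addHaar_smul, hvol, finrank_euclideanSpace_fin, ENNReal.ofReal_mul (abs_nonneg _)]
  have hlower : Tendsto (fun m : ℝ => (∫⁻ z, ENNReal.ofReal (K z)) -
      ∫⁻ z in (2 : ℝ) • B m, ENNReal.ofReal (K z)) (𝓝[>] 0)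
      (𝓝 (ENNReal.ofReal (∫ x, K x))) := by
    have h := ENNReal.Tendsto.sub (tendsto_const_nhds (x := ∫⁻ z, ENNReal.ofReal (K z)))
      (tendsto_setLIntegral_zero hfin hvol) (.inl hfin)
    rw [hA]
    simpa only [tsub_zero] using h
  refine tendsto_of_tendsto_of_tendsto_of_le_of_le' hlower tendsto_const_nhds ?_ ?_
  · filter_upwards [self_mem_nhdsWithin] with m hm
    obtain ⟨r, hr, hball, hvol⟩ := hB m hm
    have hm0 : ENNReal.ofReal m ≠ 0 := (ENNReal.ofReal_pos.2 hm).ne'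
    rw [ENNReal.le_div_iff_mul_le (.inl hm0) (.inl ENNReal.ofReal_ne_top), ← hvol, hball,
      smul_ball two_ne_zero, smul_zero, Real.norm_two]
    exact lintegral_sub_mul_volume_le_perK_ball r
  · filter_upwards [self_mem_nhdsWithin] with m hm
    exact ENNReal.div_le_of_le_mul (hupper m hm)
end

section
/- First variation inequality: let K ∈ L¹(ℝ^N), K ≥ 0, K(x) = K(−x) a.e., K ≢ 0, m > 0, and let f ∈ A_m minimize P_K over A_m. Set S := {x : f(x) = 1}, N := {x : f(x) = 0}, and V(x) := ∫ f(y) K(x−y) dy. Then for every ψ, φ ∈ L¹(ℝ^N; [0,1]) with ∫ ψ = ∫ φ, ψ = 0 a.e. on S, and φ = 0 a.e. on N, one has ∫_{ℝ^N} (ψ(x) − φ(x)) V(x) dx ≤ 0. -/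
open MeasureTheory Filter Metric
open scoped ENNReal Topology

/-- The admissible class `A_m`: densities `f ∈ L¹(ℝ^N; [0,1])` with `∫ f = m`. -/
def memA {N : ℕ} (m : ℝ) (f : EuclideanSpace ℝ (Fin N) → ℝ) : Prop :=
  Integrable f volume ∧
    (∀ᵐ x ∂(volume : Measure (EuclideanSpace ℝ (Fin N))), 0 ≤ f x ∧ f x ≤ 1) ∧
    ∫ x, f x = m

/-- The relaxed nonlocal perimeter `P_K(f) = ∬ f(x)(1 - f(y)) K(x-y) dx dy`, in `[0,∞]`. -/
noncomputable def PK {N : ℕ} (K f : EuclideanSpace ℝ (Fin N) → ℝ) : ℝ≥0∞ :=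
  ∫⁻ x, ∫⁻ y, ENNReal.ofReal (f x) * ENNReal.ofReal (1 - f y) * ENNReal.ofReal (K (x - y))

/-- The potential of `f : V(x) = ∫ f(y) K(x-y) dy`. -/
noncomputable def potential {N : ℕ} (K f : EuclideanSpace ℝ (Fin N) → ℝ)
    (x : EuclideanSpace ℝ (Fin N)) : ℝ :=
  ∫ y, f y * K (x - y)

section KernelForm

variable {N : ℕ} {K : EuclideanSpace ℝ (Fin N) → ℝ}

/-- The bilinear form `∬ u(x) v(y) K(x-y) dx dy`. -/
noncomputable def kernelForm (K u v : EuclideanSpace ℝ (Fin N) → ℝ) : ℝ :=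
  ∫ p : EuclideanSpace ℝ (Fin N) × EuclideanSpace ℝ (Fin N),
    u p.1 * v p.2 * K (p.1 - p.2) ∂(volume.prod volume)

theorem integrable_fst_mul_kernel (hK : Integrable K volume)
    {u : EuclideanSpace ℝ (Fin N) → ℝ} (hu : Integrable u volume) :
    Integrable (fun p : EuclideanSpace ℝ (Fin N) × EuclideanSpace ℝ (Fin N) =>
      u p.1 * K (p.1 - p.2)) (volume.prod volume) := by
  have h := (hu.convolution_integrand (ContinuousLinearMap.mul ℝ ℝ) hK.comp_neg).swap
  refine h.congr (Eventually.of_forall fun p => ?_)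
  simp

theorem integrable_kernelForm (hK : Integrable K volume)
    {u v : EuclideanSpace ℝ (Fin N) → ℝ} (hu : Integrable u volume)
    (hv : AEStronglyMeasurable v volume) {c : ℝ} (hvc : ∀ᵐ x, |v x| ≤ c) :
    Integrable (fun p : EuclideanSpace ℝ (Fin N) × EuclideanSpace ℝ (Fin N) =>
      u p.1 * v p.2 * K (p.1 - p.2)) (volume.prod volume) := by
  have h := (integrable_fst_mul_kernel hK hu).bdd_mul (c := c) hv.comp_snd
    (Measure.quasiMeasurePreserving_snd.ae hvc)
  refine h.congr (Eventually.of_forall fun p => ?_)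
  simp only
  ring

theorem kernelForm_comm (hKsymm : ∀ᵐ x, K (-x) = K x) (u v : EuclideanSpace ℝ (Fin N) → ℝ) :
    kernelForm K u v = kernelForm K v u := by
  unfold kernelForm
  rw [← integral_prod_swap]
  have h := (quasiMeasurePreserving_sub (volume : Measure (EuclideanSpace ℝ (Fin N)))
    volume).ae hKsymm
  refine integral_congr_ae ?_
  filter_upwards [h] with p hp
  simp only [Prod.fst_swap, Prod.snd_swap]
  rw [← neg_sub, hp]
  ring

theorem kernelForm_add_smul (hK : Integrable K volume) (hKsymm : ∀ᵐ x, K (-x) = K x)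
    {f h : EuclideanSpace ℝ (Fin N) → ℝ} (hf : Integrable f volume) (hh : Integrable h volume)
    {c d : ℝ} (hfc : ∀ᵐ x, |f x| ≤ c) (hhd : ∀ᵐ x, |h x| ≤ d) (t : ℝ) :
    kernelForm K (fun x => f x + t * h x) (fun x => f x + t * h x) =
      kernelForm K f f + t * (2 * kernelForm K h f + t * kernelForm K h h) := by
  have hff := integrable_kernelForm hK hf hf.1 hfc
  have hfh := integrable_kernelForm hK hf hh.1 hhd
  have hhf := integrable_kernelForm hK hh hf.1 hfc
  have hhh := integrable_kernelForm hK hh hh.1 hhd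
  have key : kernelForm K (fun x => f x + t * h x) (fun x => f x + t * h x) =
      kernelForm K f f + (t * kernelForm K f h + (t * kernelForm K h f +
        t ^ 2 * kernelForm K h h)) := by
    unfold kernelForm
    simp only [← integral_const_mul]
    have h1 := (hhf.const_mul t).add (hhh.const_mul (t ^ 2))
    have h2 := (hfh.const_mul t).add h1
    rw [← integral_add (hhf.const_mul t) (hhh.const_mul _)]
    erw [← integral_add (hfh.const_mul t) h1, ← integral_add hff h2]
    congr 1
    ext p
    simp only [Pi.add_apply]
    ring
  rw [key, kernelForm_comm hKsymm f h]
  ring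

theorem kernelForm_eq_integral_mul_potential (hK : Integrable K volume)
    {u f : EuclideanSpace ℝ (Fin N) → ℝ} (hu : Integrable u volume)
    (hf : AEStronglyMeasurable f volume) {c : ℝ} (hfc : ∀ᵐ x, |f x| ≤ c) :
    kernelForm K u f = ∫ x, u x * potential K f x := by
  unfold kernelForm potential
  rw [integral_prod _ (integrable_kernelForm hK hu hf hfc)]
  simp only [← integral_const_mul, mul_assoc]

theorem integrable_potential (hK : Integrable K volume)
    {f : EuclideanSpace ℝ (Fin N) → ℝ} (hf : Integrable f volume) :
    Integrable (potential K f) volume :=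
  hf.integrable_convolution (ContinuousLinearMap.mul ℝ ℝ) hK

theorem integral_fst_mul_kernel (hK : Integrable K volume)
    {u : EuclideanSpace ℝ (Fin N) → ℝ} (hu : Integrable u volume) :
    ∫ p : EuclideanSpace ℝ (Fin N) × EuclideanSpace ℝ (Fin N),
      u p.1 * K (p.1 - p.2) ∂(volume.prod volume) = (∫ x, u x) * ∫ x, K x := by
  rw [integral_prod _ (integrable_fst_mul_kernel hK hu)]
  simp only [integral_const_mul, integral_sub_left_eq_self K volume, integral_mul_const]

theorem memA.abs_le_one {m : ℝ} {f : EuclideanSpace ℝ (Fin N) → ℝ} (hf : memA m f) :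
    ∀ᵐ x, |f x| ≤ 1 := by
  filter_upwards [hf.2.1] with x hx
  exact abs_le.2 ⟨by linarith, hx.2⟩

theorem memA.PK_eq {m : ℝ} {f : EuclideanSpace ℝ (Fin N) → ℝ} (hf : memA m f)
    (hK : Integrable K volume) (hK0 : ∀ x, 0 ≤ K x) :
    0 ≤ m * (∫ x, K x) - kernelForm K f f ∧
      PK K f = ENNReal.ofReal (m * (∫ x, K x) - kernelForm K f f) := by
  obtain ⟨hfi, hf01, hfm⟩ := id hf
  have h1 := integrable_fst_mul_kernel hK hfi
  have h2 := integrable_kernelForm hK hfi hfi.1 hf.abs_le_one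
  have hint : m * (∫ x, K x) - kernelForm K f f =
      ∫ p : EuclideanSpace ℝ (Fin N) × EuclideanSpace ℝ (Fin N),
        f p.1 * (1 - f p.2) * K (p.1 - p.2) ∂(volume.prod volume) := by
    rw [← hfm, ← integral_fst_mul_kernel hK hfi, kernelForm, ← integral_sub h1 h2]
    congr 1
    ext p
    ring
  have hF : Integrable (fun p : EuclideanSpace ℝ (Fin N) × EuclideanSpace ℝ (Fin N) =>
      f p.1 * (1 - f p.2) * K (p.1 - p.2)) (volume.prod volume) := by
    refine (h1.sub h2).congr (Eventually.of_forall fun p => ?_)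
    simp only [Pi.sub_apply]
    ring
  have hF0 : 0 ≤ᵐ[volume.prod volume]
      (fun p : EuclideanSpace ℝ (Fin N) × EuclideanSpace ℝ (Fin N) =>
        f p.1 * (1 - f p.2) * K (p.1 - p.2)) := by
    filter_upwards [Measure.quasiMeasurePreserving_fst.ae hf01,
      Measure.quasiMeasurePreserving_snd.ae hf01] with p hp1 hp2
    exact mul_nonneg (mul_nonneg hp1.1 (sub_nonneg.2 hp2.2)) (hK0 _)
  rw [hint]
  refine ⟨integral_nonneg_of_ae hF0, ?_⟩
  rw [ofReal_integral_eq_lintegral_ofReal hF hF0, lintegral_prod _ hF.1.aemeasurable.ennreal_ofReal]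
  refine lintegral_congr_ae ?_
  filter_upwards [hf01] with x hx
  refine lintegral_congr_ae ?_
  filter_upwards [hf01] with y hy
  rw [ENNReal.ofReal_mul (mul_nonneg hx.1 (sub_nonneg.2 hy.2)), ENNReal.ofReal_mul hx.1]

theorem kernelForm_self_le_of_PK_le (hK : Integrable K volume) (hK0 : ∀ x, 0 ≤ K x) {m : ℝ}
    {f g : EuclideanSpace ℝ (Fin N) → ℝ} (hf : memA m f) (hg : memA m g)
    (h : PK K f ≤ PK K g) : kernelForm K g g ≤ kernelForm K f f := by
  rw [(hf.PK_eq hK hK0).2, (hg.PK_eq hK hK0).2,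
    ENNReal.ofReal_le_ofReal_iff (hg.PK_eq hK hK0).1] at h
  linarith

/-- The first variation of a minimizer is nonpositive along every bounded direction in which
the minimizer can be moved inside the admissible class. -/
theorem integral_mul_potential_nonpos (hK : Integrable K volume) (hK0 : ∀ x, 0 ≤ K x)
    (hKsymm : ∀ᵐ x, K (-x) = K x) {m : ℝ} {f h : EuclideanSpace ℝ (Fin N) → ℝ} (hf : memA m f)
    (hmin : ∀ g : EuclideanSpace ℝ (Fin N) → ℝ, memA m g → PK K f ≤ PK K g)
    (hh : Integrable h volume) {d : ℝ} (hhd : ∀ᵐ x, |h x| ≤ d)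
    (hadm : ∀ᶠ t in 𝓝[>] (0 : ℝ), memA m (fun x => f x + t * h x)) :
    ∫ x, h x * potential K f x ≤ 0 := by
  rw [← kernelForm_eq_integral_mul_potential hK hh hf.1.1 hf.abs_le_one]
  have hlim : Tendsto (fun t : ℝ => 2 * kernelForm K h f + t * kernelForm K h h) (𝓝[>] 0)
      (𝓝 (2 * kernelForm K h f + 0 * kernelForm K h h)) :=
    (Continuous.tendsto (by fun_prop) 0).mono_left nhdsWithin_le_nhds
  have hle : 2 * kernelForm K h f + 0 * kernelForm K h h ≤ 0 := by
    refine le_of_tendsto hlim ?_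
    filter_upwards [hadm, self_mem_nhdsWithin] with t ht ht0
    have := kernelForm_self_le_of_PK_le hK hK0 hf ht (hmin _ ht)
    rw [kernelForm_add_smul hK hKsymm hf.1 hh hf.abs_le_one hhd] at this
    exact nonpos_of_mul_nonpos_right (by linarith) ht0
  linarith

end KernelForm

/-- Truncating `u` by large multiples of a nonnegative weight `w` converges to `u`
wherever `u` vanishes on the zeros of `w`. -/
theorem tendsto_min_natCast_mul {u w : ℝ} (hw : 0 ≤ w) (huw : w = 0 → u = 0) :
    Tendsto (fun n : ℕ => min u (n * w)) atTop (𝓝 u) := by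
  rcases hw.eq_or_lt with h | h
  · simp [huw h.symm, ← h]
  · refine tendsto_const_nhds.congr' ?_
    filter_upwards [(tendsto_natCast_atTop_atTop.atTop_mul_const h).eventually_ge_atTop u]
      with n hn
    exact (min_eq_left hn).symm

/-- Integrals against an integrable `V` pass to the limit in the truncations `min u (n * w)`. -/
theorem tendsto_integral_min_natCast_mul {α : Type*} [MeasurableSpace α] {μ : Measure α}
    {u w V : α → ℝ} (hu : AEStronglyMeasurable u μ) (hw : AEStronglyMeasurable w μ)
    (hV : AEStronglyMeasurable V μ) (huV : Integrable (fun x => u x * V x) μ)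
    (hu0 : ∀ᵐ x ∂μ, 0 ≤ u x) (hw0 : ∀ᵐ x ∂μ, 0 ≤ w x) (huw : ∀ᵐ x ∂μ, w x = 0 → u x = 0) :
    Tendsto (fun n : ℕ => ∫ x, min (u x) (n * w x) * V x ∂μ) atTop (𝓝 (∫ x, u x * V x ∂μ)) := by
  refine tendsto_integral_of_dominated_convergence (fun x => ‖u x * V x‖)
    (fun n => (hu.inf (hw.const_mul _)).mul hV) huV.norm (fun n => ?_) ?_
  · filter_upwards [hu0, hw0] with x hx hx'
    have h0 : 0 ≤ min (u x) (n * w x) := le_min hx (by positivity)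
    rw [norm_mul, norm_mul, Real.norm_of_nonneg h0, Real.norm_of_nonneg hx]
    gcongr
    exact min_le_left _ _
  · filter_upwards [hu0, hw0, huw] with x hx hx' hx''
    exact (tendsto_min_natCast_mul hx' hx'').mul_const _


/-- First variation inequality: let `f ∈ A_m` minimize `P_K` over `A_m`, and set
`S = {f = 1}`, `N = {f = 0}`. For all `ψ, φ ∈ L¹(ℝ^N; [0,1])` with `∫ ψ = ∫ φ`, `ψ = 0` a.e. on
`S` and `φ = 0` a.e. on `N`, one has `∫ (ψ(x) - φ(x)) V(x) dx ≤ 0`. -/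
theorem first_variation {N : ℕ} (K : EuclideanSpace ℝ (Fin N) → ℝ)
    (hKmeas : Measurable K) (hKnonneg : ∀ x, 0 ≤ K x)
    (hKsymm : ∀ᵐ x ∂(volume : Measure (EuclideanSpace ℝ (Fin N))), K (-x) = K x)
    (hKL1 : Integrable K volume)
    (hKne : ¬ (∀ᵐ x ∂(volume : Measure (EuclideanSpace ℝ (Fin N))), K x = 0))
    (m : ℝ) (hm : 0 < m) (f : EuclideanSpace ℝ (Fin N) → ℝ) (hf : memA m f)
    (hmin : ∀ g : EuclideanSpace ℝ (Fin N) → ℝ, memA m g → PK K f ≤ PK K g)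
    (ψ φ : EuclideanSpace ℝ (Fin N) → ℝ)
    (hψint : Integrable ψ volume) (hφint : Integrable φ volume)
    (hψ01 : ∀ᵐ x ∂(volume : Measure (EuclideanSpace ℝ (Fin N))), 0 ≤ ψ x ∧ ψ x ≤ 1)
    (hφ01 : ∀ᵐ x ∂(volume : Measure (EuclideanSpace ℝ (Fin N))), 0 ≤ φ x ∧ φ x ≤ 1)
    (heq : ∫ x, ψ x = ∫ x, φ x)
    (hψS : ∀ᵐ x ∂(volume : Measure (EuclideanSpace ℝ (Fin N))), f x = 1 → ψ x = 0)
    (hφN : ∀ᵐ x ∂(volume : Measure (EuclideanSpace ℝ (Fin N))), f x = 0 → φ x = 0) :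
    ∫ x, (ψ x - φ x) * potential K f x ≤ 0 := by
  have hfi := hf.1
  have hVi : Integrable (potential K f) volume := integrable_potential hKL1 hfi
  have hw : AEStronglyMeasurable (fun x => 1 - f x) volume :=
    aestronglyMeasurable_const.sub hfi.1
  have hw0 : ∀ᵐ x, 0 ≤ 1 - f x := hf.2.1.mono fun x hx => sub_nonneg.2 hx.2
  have hf0 : ∀ᵐ x, 0 ≤ f x := hf.2.1.mono fun x hx => hx.1
  have hψ0 : ∀ᵐ x, 0 ≤ ψ x := hψ01.mono fun x hx => hx.1
  have hφ0 : ∀ᵐ x, 0 ≤ φ x := hφ01.mono fun x hx => hx.1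
  have hψw : ∀ᵐ x, 1 - f x = 0 → ψ x = 0 :=
    hψS.mono fun x hx h => hx (sub_eq_zero.1 h).symm
  have bdd {u : EuclideanSpace ℝ (Fin N) → ℝ} (hu : ∀ᵐ x, 0 ≤ u x ∧ u x ≤ 1) :
      ∀ᵐ x, ‖u x‖ ≤ 1 :=
    hu.mono fun x hx => by rw [Real.norm_of_nonneg hx.1]; exact hx.2
  have hψV := hVi.bdd_mul hψint.1 (bdd hψ01)
  have hφV := hVi.bdd_mul hφint.1 (bdd hφ01)
  set P : ℕ → EuclideanSpace ℝ (Fin N) → ℝ := fun n x => min (ψ x) (n * (1 - f x)) with hP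
  set Q : ℕ → EuclideanSpace ℝ (Fin N) → ℝ := fun n x => min (φ x) (n * f x) with hQ
  have hP01 (n : ℕ) : ∀ᵐ x, 0 ≤ P n x ∧ P n x ≤ 1 := by
    filter_upwards [hψ01, hw0] with x hx hx'
    exact ⟨le_min hx.1 (by positivity), (min_le_left _ _).trans hx.2⟩
  have hQ01 (n : ℕ) : ∀ᵐ x, 0 ≤ Q n x ∧ Q n x ≤ 1 := by
    filter_upwards [hφ01, hf0] with x hx hx'
    exact ⟨le_min hx.1 (by positivity), (min_le_left _ _).trans hx.2⟩
  have hPint (n : ℕ) : Integrable (P n) volume := by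
    refine hψint.mono' (hψint.1.inf (hw.const_mul _)) ?_
    filter_upwards [hP01 n] with x hx
    rw [Real.norm_of_nonneg hx.1]
    exact min_le_left _ _
  have hQint (n : ℕ) : Integrable (Q n) volume := by
    refine hφint.mono' (hφint.1.inf (hfi.1.const_mul _)) ?_
    filter_upwards [hQ01 n] with x hx
    rw [Real.norm_of_nonneg hx.1]
    exact min_le_left _ _
  have hstep (n : ℕ) : (∫ x, Q n x) * (∫ x, P n x * potential K f x) -
      (∫ x, P n x) * (∫ x, Q n x * potential K f x) ≤ 0 := by
    set a := ∫ x, P n x with ha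
    set b := ∫ x, Q n x with hb
    have ha0 : 0 ≤ a := integral_nonneg_of_ae ((hP01 n).mono fun x hx => hx.1)
    have hb0 : 0 ≤ b := integral_nonneg_of_ae ((hQ01 n).mono fun x hx => hx.1)
    have hhi : Integrable (fun x => b * P n x - a * Q n x) volume :=
      ((hPint n).const_mul b).sub ((hQint n).const_mul a)
    have hnonpos : ∫ x, (b * P n x - a * Q n x) * potential K f x ≤ 0 := by
      refine integral_mul_potential_nonpos (d := a + b) hKL1 hKnonneg hKsymm hf hmin hhi ?_ ?_
      · filter_upwards [hP01 n, hQ01 n] with x hx hx'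
        exact abs_le.2 ⟨by nlinarith, by nlinarith⟩
      · have hsmall (c : ℝ) : ∀ᶠ t in 𝓝[>] (0 : ℝ), t * c * n < 1 := by
          have : Tendsto (fun t : ℝ => t * c * n) (𝓝 0) (𝓝 (0 * c * n)) :=
            Continuous.tendsto (by fun_prop) 0
          exact (this.mono_left nhdsWithin_le_nhds).eventually_lt_const (by simp)
        filter_upwards [hsmall a, hsmall b, self_mem_nhdsWithin] with t hta htb ht
        have ht0 : 0 ≤ t := le_of_lt ht
        refine ⟨hfi.add (hhi.const_mul t), ?_, ?_⟩
        · filter_upwards [hP01 n, hQ01 n, hf.2.1] with x hx hx' hfx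
          have hPle : P n x ≤ n * (1 - f x) := min_le_right _ _
          have hQle : Q n x ≤ n * f x := min_le_right _ _
          have h1 : t * b * P n x ≤ t * b * (n * (1 - f x)) := by gcongr
          have h2 : t * a * Q n x ≤ t * a * (n * f x) := by gcongr
          have h3 : 0 ≤ t * b * P n x := mul_nonneg (mul_nonneg ht0 hb0) hx.1
          have h4 : 0 ≤ t * a * Q n x := mul_nonneg (mul_nonneg ht0 ha0) hx'.1
          constructor <;> nlinarith
        · rw [integral_add hfi (hhi.const_mul t), integral_const_mul,
            integral_sub ((hPint n).const_mul b) ((hQint n).const_mul a),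
            integral_const_mul, integral_const_mul, hf.2.2, ← ha, ← hb]
          ring
    have hPV := hVi.bdd_mul (hPint n).1 (bdd (hP01 n))
    have hQV := hVi.bdd_mul (hQint n).1 (bdd (hQ01 n))
    rw [← integral_const_mul, ← integral_const_mul,
      ← integral_sub (hPV.const_mul b) (hQV.const_mul a)]
    convert hnonpos using 3
    ring
  have hPlim : Tendsto (fun n => ∫ x, P n x) atTop (𝓝 (∫ x, ψ x)) := by
    simpa using tendsto_integral_min_natCast_mul (V := fun _ => 1) hψint.1 hw
      aestronglyMeasurable_const (by simpa using hψint) hψ0 hw0 hψw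
  have hQlim : Tendsto (fun n => ∫ x, Q n x) atTop (𝓝 (∫ x, φ x)) := by
    simpa using tendsto_integral_min_natCast_mul (V := fun _ => 1) hφint.1 hfi.1
      aestronglyMeasurable_const (by simpa using hφint) hφ0 hf0 hφN
  have hPVlim := tendsto_integral_min_natCast_mul hψint.1 hw hVi.1 hψV hψ0 hw0 hψw
  have hQVlim := tendsto_integral_min_natCast_mul hφint.1 hfi.1 hVi.1 hφV hφ0 hf0 hφN
  have hlim := le_of_tendsto' ((hQlim.mul hPVlim).sub (hPlim.mul hQVlim)) hstep
  rw [heq, ← mul_sub, ← integral_sub hψV hφV] at hlim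
  simp only [← sub_mul] at hlim
  rcases (integral_nonneg_of_ae hφ0).eq_or_lt with h0 | hpos
  · have hφz := (integral_eq_zero_iff_of_nonneg_ae hφ0 hφint).1 h0.symm
    have hψz := (integral_eq_zero_iff_of_nonneg_ae hψ0 hψint).1 (heq.trans h0.symm)
    refine (integral_eq_zero_of_ae ?_).le
    filter_upwards [hφz, hψz] with x hx hx'
    simp [hx, hx']
  · exact nonpos_of_mul_nonpos_right hlim hpos
end

section
/- Euler–Lagrange conditions: let K ∈ L¹(ℝ^N), K ≥ 0, K(x) = K(−x) a.e., K ≢ 0, m > 0, and let f ∈ A_m minimize P_K over A_m. Set V(x) := ∫ f(y) K(x−y) dy. Then there exists a constant c > 0 such that V(x) = c for a.e. x with 0 < f(x) < 1, V(x) ≥ c for a.e. x with f(x) = 1, and V(x) ≤ c for a.e. x with f(x) = 0. -/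
open MeasureTheory Filter Metric
open scoped ENNReal Topology

section NonlocalPerimeter

variable {N : ℕ} {K u v f : EuclideanSpace ℝ (Fin N) → ℝ} {C m : ℝ}

lemma integrable_mul_kernel (hK : Integrable K volume) (hu : Integrable u volume)
    (hb : ∀ᵐ x ∂(volume : Measure (EuclideanSpace ℝ (Fin N))), ‖u x‖ ≤ C)
    (x : EuclideanSpace ℝ (Fin N)) : Integrable (fun y => u y * K (x - y)) volume :=
  (hK.comp_sub_left x).bdd_mul hu.aestronglyMeasurable hb

lemma potential_eq_convolution (K u : EuclideanSpace ℝ (Fin N) → ℝ) :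
    potential K u = convolution u K (ContinuousLinearMap.mul ℝ ℝ) volume := rfl

lemma integrable_potential_s15 (hK : Integrable K volume) (hu : Integrable u volume) :
    Integrable (potential K u) volume :=
  hu.integrable_convolution (ContinuousLinearMap.mul ℝ ℝ) hK

lemma integral_potential (hK : Integrable K volume) (hu : Integrable u volume) :
    ∫ x, potential K u x = (∫ x, u x) * ∫ x, K x := by
  rw [potential_eq_convolution]
  exact integral_convolution (ContinuousLinearMap.mul ℝ ℝ) hu hK

/-- The form `(u, v) ↦ ∬ u(x) v(y) K(x-y) dx dy` is symmetric. -/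
lemma integral_mul_potential_comm
    (hKsymm : ∀ᵐ x ∂(volume : Measure (EuclideanSpace ℝ (Fin N))), K (-x) = K x)
    (hK : Integrable K volume) (hu : Integrable u volume)
    (hb : ∀ᵐ x ∂(volume : Measure (EuclideanSpace ℝ (Fin N))), ‖u x‖ ≤ C)
    (hv : Integrable v volume) :
    ∫ x, u x * potential K v x = ∫ x, v x * potential K u x := by
  have hprod : Integrable (Function.uncurry fun x y => u x * (v y * K (x - y)))
      ((volume : Measure (EuclideanSpace ℝ (Fin N))).prod volume) := by
    have h := hv.convolution_integrand (μ := volume) (ContinuousLinearMap.mul ℝ ℝ) hK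
    refine h.bdd_mul (f := fun p => u p.1) hu.aestronglyMeasurable.comp_fst ?_ (c := C)
    exact Measure.quasiMeasurePreserving_fst.ae hb
  calc ∫ x, u x * potential K v x
      = ∫ x, ∫ y, u x * (v y * K (x - y)) := by simp only [potential, integral_const_mul]
    _ = ∫ y, ∫ x, u x * (v y * K (x - y)) := integral_integral_swap hprod
    _ = ∫ y, v y * potential K u y := by
      refine integral_congr_ae (Eventually.of_forall fun y => ?_)
      simp only [potential, ← integral_const_mul]
      refine integral_congr_ae ?_
      filter_upwards [(quasiMeasurePreserving_sub_left volume y).ae hKsymm] with x hx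
      rw [neg_sub] at hx
      rw [hx]
      ring

lemma potential_nonneg (hKnonneg : ∀ x, 0 ≤ K x)
    (hf : ∀ᵐ x ∂(volume : Measure (EuclideanSpace ℝ (Fin N))), 0 ≤ f x ∧ f x ≤ 1)
    (x : EuclideanSpace ℝ (Fin N)) : 0 ≤ potential K f x :=
  integral_nonneg_of_ae (hf.mono fun _ hy => mul_nonneg hy.1 (hKnonneg _))

lemma norm_le_one_of_mem_unitInterval
    (hf : ∀ᵐ x ∂(volume : Measure (EuclideanSpace ℝ (Fin N))), 0 ≤ f x ∧ f x ≤ 1) :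
    ∀ᵐ x ∂(volume : Measure (EuclideanSpace ℝ (Fin N))), ‖f x‖ ≤ 1 :=
  hf.mono fun x hx => by rw [Real.norm_of_nonneg hx.1]; exact hx.2

lemma potential_le (hKnonneg : ∀ x, 0 ≤ K x) (hK : Integrable K volume)
    (hfi : Integrable f volume)
    (hf : ∀ᵐ x ∂(volume : Measure (EuclideanSpace ℝ (Fin N))), 0 ≤ f x ∧ f x ≤ 1)
    (x : EuclideanSpace ℝ (Fin N)) : potential K f x ≤ ∫ y, K y := by
  rw [← integral_sub_left_eq_self K volume x]
  exact integral_mono_ae (integrable_mul_kernel hK hfi (norm_le_one_of_mem_unitInterval hf) x)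
    (hK.comp_sub_left x) (hf.mono fun y hy => mul_le_of_le_one_left (hKnonneg _) hy.2)

lemma PK_eq_ofReal (hKnonneg : ∀ x, 0 ≤ K x) (hK : Integrable K volume) (hf : memA m f) :
    PK K f = ENNReal.ofReal (m * (∫ y, K y) - ∫ x, f x * potential K f x) := by
  obtain ⟨hfi, hf01, hfm⟩ := hf
  have hb := norm_le_one_of_mem_unitInterval hf01
  have hint : Integrable (fun x => f x * potential K f x) volume :=
    (integrable_potential_s15 hK hfi).bdd_mul hfi.aestronglyMeasurable hb
  have hsub : ∫ x, f x * ((∫ y, K y) - potential K f x)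
      = m * (∫ y, K y) - ∫ x, f x * potential K f x := by
    simp only [mul_sub]
    rw [integral_sub (hfi.mul_const _) hint, integral_mul_const, hfm]
  rw [← hsub, ofReal_integral_eq_lintegral_ofReal]
  · refine lintegral_congr_ae (hf01.mono fun x hx => ?_)
    have hi := integrable_mul_kernel hK hfi hb x
    have hV : (∫ y, K y) - potential K f x = ∫ y, (1 - f y) * K (x - y) := by
      rw [← integral_sub_left_eq_self K volume x, potential,
        ← integral_sub (hK.comp_sub_left x) hi]
      simp only [sub_mul, one_mul]
    have hi' : Integrable (fun y => (1 - f y) * K (x - y)) volume := by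
      simp only [sub_mul, one_mul]
      exact (hK.comp_sub_left x).sub hi
    have hnn : 0 ≤ᵐ[volume] fun y => (1 - f y) * K (x - y) :=
      hf01.mono fun y hy => mul_nonneg (sub_nonneg.2 hy.2) (hKnonneg _)
    simp only [mul_assoc]
    rw [lintegral_const_mul' _ _ ENNReal.ofReal_ne_top, ENNReal.ofReal_mul hx.1, hV,
      ofReal_integral_eq_lintegral_ofReal hi' hnn]
    congr 1
    refine lintegral_congr_ae (hf01.mono fun y hy => ?_)
    exact (ENNReal.ofReal_mul (sub_nonneg.2 hy.2)).symm
  · simp only [mul_sub]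
    exact (hfi.mul_const _).sub hint
  · exact hf01.mono fun x hx =>
      mul_nonneg hx.1 (sub_nonneg.2 (potential_le hKnonneg hK hfi hf01 x))

lemma integral_mul_potential_le (hKnonneg : ∀ x, 0 ≤ K x) (hK : Integrable K volume)
    (hf : memA m f) : ∫ x, f x * potential K f x ≤ m * ∫ y, K y := by
  obtain ⟨hfi, hf01, hfm⟩ := hf
  rw [← hfm, ← integral_mul_const]
  refine integral_mono_ae ((integrable_potential_s15 hK hfi).bdd_mul hfi.aestronglyMeasurable
    (norm_le_one_of_mem_unitInterval hf01)) (hfi.mul_const _) (hf01.mono fun x hx => ?_)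
  exact mul_le_mul_of_nonneg_left (potential_le hKnonneg hK hfi hf01 x) hx.1

/-- Minimizing `P_K` amounts to maximizing `∬ f(x) f(y) K(x-y) dx dy`. -/
lemma integral_mul_potential_le_of_minimizer (hKnonneg : ∀ x, 0 ≤ K x)
    (hK : Integrable K volume) (hf : memA m f)
    (hmin : ∀ g : EuclideanSpace ℝ (Fin N) → ℝ, memA m g → PK K f ≤ PK K g)
    (hu : memA m u) :
    ∫ x, u x * potential K u x ≤ ∫ x, f x * potential K f x := by
  have h := hmin u hu
  rw [PK_eq_ofReal hKnonneg hK hf, PK_eq_ofReal hKnonneg hK hu, ENNReal.ofReal_le_ofReal_iff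
    (sub_nonneg.2 (integral_mul_potential_le hKnonneg hK hu))] at h
  linarith

/-- First variation: the linear functional `h ↦ ∫ h V` is nonpositive on admissible directions. -/
lemma integral_mul_potential_nonpos_of_minimizer (hKnonneg : ∀ x, 0 ≤ K x)
    (hKsymm : ∀ᵐ x ∂(volume : Measure (EuclideanSpace ℝ (Fin N))), K (-x) = K x)
    (hK : Integrable K volume) (hf : memA m f)
    (hmin : ∀ g : EuclideanSpace ℝ (Fin N) → ℝ, memA m g → PK K f ≤ PK K g)
    (hu : Integrable u volume)
    (hb : ∀ᵐ x ∂(volume : Measure (EuclideanSpace ℝ (Fin N))), ‖u x‖ ≤ C)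
    (hu0 : ∫ x, u x = 0) {T : ℝ} (hT : 0 < T)
    (hadm : ∀ t, 0 < t → t ≤ T → ∀ᵐ x ∂(volume : Measure (EuclideanSpace ℝ (Fin N))),
      0 ≤ f x + t * u x ∧ f x + t * u x ≤ 1) :
    ∫ x, u x * potential K f x ≤ 0 := by
  have hfi := hf.1
  have hfb := norm_le_one_of_mem_unitInterval hf.2.1
  have hVf := integrable_potential_s15 hK hfi
  have hVu := integrable_potential_s15 hK hu
  set A := ∫ x, u x * potential K f x with hA
  set B := ∫ x, u x * potential K u x with hB
  have key : ∀ t, 0 < t → t ≤ T → 2 * A + t * B ≤ 0 := by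
    intro t ht htT
    have hmem : memA m (fun x => f x + t * u x) := by
      refine ⟨hfi.add (hu.const_mul t), hadm t ht htT, ?_⟩
      rw [integral_add hfi (hu.const_mul t), integral_const_mul, hu0, hf.2.2]
      ring
    have hpot : ∀ x, potential K (fun x => f x + t * u x) x
        = potential K f x + t * potential K u x := by
      intro x
      simp only [potential]
      rw [← integral_const_mul, ← integral_add (integrable_mul_kernel hK hfi hfb x)
        ((integrable_mul_kernel hK hu hb x).const_mul t)]
      exact integral_congr_ae (Eventually.of_forall fun y => by ring)
    have hle := integral_mul_potential_le_of_minimizer hKnonneg hK hf hmin hmem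
    have hff : Integrable (fun x => f x * potential K f x) volume :=
      hVf.bdd_mul hfi.aestronglyMeasurable hfb
    have hfu : Integrable (fun x => f x * potential K u x) volume :=
      hVu.bdd_mul hfi.aestronglyMeasurable hfb
    have huf : Integrable (fun x => u x * potential K f x) volume :=
      hVf.bdd_mul hu.aestronglyMeasurable hb
    have huu : Integrable (fun x => u x * potential K u x) volume :=
      hVu.bdd_mul hu.aestronglyMeasurable hb
    have hexp : ∫ x, (f x + t * u x) * potential K (fun x => f x + t * u x) x
        = (∫ x, f x * potential K f x) + t * (∫ x, f x * potential K u x)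
          + t * A + t ^ 2 * B := by
      have h2 : Integrable (fun x => f x * potential K f x + t * (f x * potential K u x))
          volume := hff.add (hfu.const_mul t)
      have h3 : Integrable (fun x => f x * potential K f x + t * (f x * potential K u x)
          + t * (u x * potential K f x)) volume := h2.add (huf.const_mul t)
      rw [hA, hB, ← integral_const_mul, ← integral_const_mul, ← integral_const_mul,
        ← integral_add hff (hfu.const_mul t), ← integral_add h2 (huf.const_mul t),
        ← integral_add h3 (huu.const_mul _)]
      refine integral_congr_ae (Eventually.of_forall fun x => ?_)
      simp only [hpot]
      ring
    rw [hexp, integral_mul_potential_comm hKsymm hK hfi hfb hu, ← hA] at hle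
    have : t * (2 * A + t * B) ≤ 0 := by linarith
    exact nonpos_of_mul_nonpos_right this ht
  by_contra! hpos
  have h := key (min T (A / (|B| + 1))) (lt_min hT (by positivity)) (min_le_left _ _)
  have h1 : min T (A / (|B| + 1)) * |B| ≤ A := by
    calc min T (A / (|B| + 1)) * |B| ≤ A / (|B| + 1) * (|B| + 1) := by
          gcongr
          · exact min_le_right _ _
          · linarith
      _ = A := by field_simp
  have h2 : -(min T (A / (|B| + 1)) * |B|) ≤ min T (A / (|B| + 1)) * B := by
    rw [← mul_neg]
    exact mul_le_mul_of_nonneg_left (neg_abs_le B) (lt_min hT (by positivity)).le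
  linarith

/-- Every level `a ≥ 0` separates: if `V > a` somewhere on `{f < 1}`, then `V ≥ a` on `{f > 0}`. -/
lemma le_potential_of_minimizer (hKnonneg : ∀ x, 0 ≤ K x)
    (hKsymm : ∀ᵐ x ∂(volume : Measure (EuclideanSpace ℝ (Fin N))), K (-x) = K x)
    (hK : Integrable K volume) (hf : memA m f)
    (hmin : ∀ g : EuclideanSpace ℝ (Fin N) → ℝ, memA m g → PK K f ≤ PK K g)
    {a : ℝ} (ha : 0 ≤ a)
    (hnot : ¬ ∀ᵐ x ∂(volume : Measure (EuclideanSpace ℝ (Fin N))),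
      f x < 1 → potential K f x ≤ a) :
    ∀ᵐ x ∂(volume : Measure (EuclideanSpace ℝ (Fin N))), 0 < f x → a ≤ potential K f x := by
  obtain ⟨hfi, hf01, hfm⟩ := id hf
  have hfb := norm_le_one_of_mem_unitInterval hf01
  have hV0 := potential_nonneg hKnonneg hf01
  have hVκ := potential_le hKnonneg hK hfi hf01
  have hVi := integrable_potential_s15 hK hfi
  set V := potential K f with hV
  set κ := ∫ y, K y
  have hκ : 0 ≤ κ := integral_nonneg hKnonneg
  have hfm' := hfi.aestronglyMeasurable
  have hVm := hVi.aestronglyMeasurable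
  have hVb : ∀ᵐ x ∂(volume : Measure (EuclideanSpace ℝ (Fin N))), ‖V x - a‖ ≤ κ + a :=
    Eventually.of_forall fun x => by
      rw [Real.norm_eq_abs, abs_le]
      constructor <;> linarith [hV0 x, hVκ x]
  set ψ : EuclideanSpace ℝ (Fin N) → ℝ := fun x => (1 - f x) * max (V x - a) 0 with hψ
  set φ : EuclideanSpace ℝ (Fin N) → ℝ := fun x => f x * max (a - V x) 0 with hφ
  have hmψ : ∀ x, 0 ≤ max (V x - a) 0 ∧ max (V x - a) 0 ≤ V x ∧ max (V x - a) 0 ≤ κ :=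
    fun x => ⟨le_max_right _ _, max_le (by linarith) (hV0 x),
      max_le (by linarith [hVκ x]) hκ⟩
  have hmφ : ∀ x, 0 ≤ max (a - V x) 0 ∧ max (a - V x) 0 ≤ a :=
    fun x => ⟨le_max_right _ _, max_le (by linarith [hV0 x]) ha⟩
  have hψb : ∀ᵐ x ∂(volume : Measure (EuclideanSpace ℝ (Fin N))),
      0 ≤ ψ x ∧ ψ x ≤ V x ∧ ψ x ≤ (1 - f x) * κ ∧ ψ x ≤ κ := by
    filter_upwards [hf01] with x hx
    obtain ⟨h1, h2, h3⟩ := hmψ x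
    have h4 : ψ x ≤ max (V x - a) 0 := mul_le_of_le_one_left h1 (by linarith)
    exact ⟨mul_nonneg (by linarith) h1, h4.trans h2,
      mul_le_mul_of_nonneg_left h3 (by linarith), h4.trans h3⟩
  have hφb : ∀ᵐ x ∂(volume : Measure (EuclideanSpace ℝ (Fin N))),
      0 ≤ φ x ∧ φ x ≤ f x * a ∧ φ x ≤ a := by
    filter_upwards [hf01] with x hx
    obtain ⟨h1, h2⟩ := hmφ x
    exact ⟨mul_nonneg hx.1 h1, mul_le_mul_of_nonneg_left h2 hx.1,
      (mul_le_of_le_one_left h1 hx.2).trans h2⟩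
  have hψi : Integrable ψ volume := by
    refine hVi.mono' ((aestronglyMeasurable_const.sub hfm').mul
      ((hVm.sub aestronglyMeasurable_const).sup aestronglyMeasurable_const)) ?_
    filter_upwards [hψb] with x hx
    rw [Real.norm_of_nonneg hx.1]
    exact hx.2.1
  have hφi : Integrable φ volume := by
    refine (hfi.mul_const a).mono' (hfm'.mul
      ((aestronglyMeasurable_const.sub hVm).sup aestronglyMeasurable_const)) ?_
    filter_upwards [hφb] with x hx
    rw [Real.norm_of_nonneg hx.1]
    exact hx.2.1
  have hVψi : Integrable (fun x => ψ x * (V x - a)) volume :=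
    hψi.mul_bdd (hVm.sub aestronglyMeasurable_const) hVb
  have hVφi : Integrable (fun x => φ x * (V x - a)) volume :=
    hφi.mul_bdd (hVm.sub aestronglyMeasurable_const) hVb
  have hψnn : 0 ≤ᵐ[volume] ψ := hψb.mono fun x hx => hx.1
  have hφnn : 0 ≤ᵐ[volume] φ := hφb.mono fun x hx => hx.1
  have hVψnn : 0 ≤ᵐ[volume] fun x => ψ x * (V x - a) := by
    filter_upwards [hf01] with x hx
    have : 0 ≤ 1 - f x := by linarith
    rcases le_total (V x - a) 0 with h | h
    · simp [hψ, h]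
    · exact mul_nonneg (mul_nonneg this (le_max_right _ _)) h
  have hVφnn : 0 ≤ᵐ[volume] fun x => -(φ x * (V x - a)) := by
    filter_upwards [hf01] with x hx
    rcases le_total (a - V x) 0 with h | h
    · simp [hφ, h]
    · have := mul_nonneg (mul_nonneg hx.1 (le_max_right (a - V x) 0)) h
      simp only [Pi.zero_apply, hφ]
      linarith
  set p := ∫ x, φ x with hp
  set q := ∫ x, ψ x with hq
  have hp0 : 0 ≤ p := integral_nonneg_of_ae hφnn
  have hq0 : 0 < q := by
    refine lt_of_le_of_ne (integral_nonneg_of_ae hψnn) fun h => hnot ?_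
    filter_upwards [(integral_eq_zero_iff_of_nonneg_ae hψnn hψi).1 h.symm] with x hx hx1
    rcases mul_eq_zero.1 hx with h | h
    · linarith
    · linarith [le_max_left (V x - a) 0]
  have hui : Integrable (fun x => p * ψ x - q * φ x) volume :=
    (hψi.const_mul p).sub (hφi.const_mul q)
  have hint0 : ∫ x, (p * ψ x - q * φ x) = 0 := by
    rw [integral_sub (hψi.const_mul p) (hφi.const_mul q), integral_const_mul, integral_const_mul]
    ring
  have hub : ∀ᵐ x ∂(volume : Measure (EuclideanSpace ℝ (Fin N))),
      ‖p * ψ x - q * φ x‖ ≤ p * κ + q * a := by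
    filter_upwards [hψb, hφb] with x hx hx'
    rw [Real.norm_eq_abs, abs_le]
    have h1 := mul_nonneg hp0 hx.1
    have h2 := mul_nonneg hq0.le hx'.1
    have h3 := mul_le_mul_of_nonneg_left hx.2.2.2 hp0
    have h4 := mul_le_mul_of_nonneg_left hx'.2.2 hq0.le
    constructor <;> linarith
  have hD : 0 < p * κ + q * a + 1 := by positivity
  have hvar := integral_mul_potential_nonpos_of_minimizer hKnonneg hKsymm hK hf hmin hui hub
    hint0 (T := (p * κ + q * a + 1)⁻¹) (by positivity) (by
      intro t ht htT
      have htD : t * (p * κ + q * a + 1) ≤ 1 := by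
        calc _ ≤ (p * κ + q * a + 1)⁻¹ * (p * κ + q * a + 1) := by gcongr
          _ = 1 := inv_mul_cancel₀ hD.ne'
      have hpκ : 0 ≤ t * (p * κ) := by positivity
      have hqa : 0 ≤ t * (q * a) := by positivity
      filter_upwards [hf01, hψb, hφb] with x hx hx1 hx2
      have h1 : 0 ≤ t * (p * ψ x) := mul_nonneg ht.le (mul_nonneg hp0 hx1.1)
      have h2 : 0 ≤ t * (q * φ x) := mul_nonneg ht.le (mul_nonneg hq0.le hx2.1)
      have h3 : t * (p * ψ x) ≤ t * (p * ((1 - f x) * κ)) := by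
        have := hx1.2.2.1
        gcongr
      have h4 : t * (q * φ x) ≤ t * (q * (f x * a)) := by
        have := hx2.2.1
        gcongr
      have h5 : (1 - f x) * (t * (p * κ)) ≤ (1 - f x) * 1 :=
        mul_le_mul_of_nonneg_left (by linarith) (by linarith)
      have h6 : f x * (t * (q * a)) ≤ f x * 1 :=
        mul_le_mul_of_nonneg_left (by linarith) hx.1
      constructor <;> linarith)
  have hsplit : ∫ x, (p * ψ x - q * φ x) * V x
      = p * (∫ x, ψ x * (V x - a)) + q * ∫ x, -(φ x * (V x - a)) := by
    have h1 : ∀ x, (p * ψ x - q * φ x) * V x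
        = (p * (ψ x * (V x - a)) + q * -(φ x * (V x - a))) + a * (p * ψ x - q * φ x) :=
      fun x => by ring
    simp only [h1]
    have h2 : Integrable (fun x => -(φ x * (V x - a))) volume := hVφi.neg
    have h3 : Integrable (fun x => p * (ψ x * (V x - a)) + q * -(φ x * (V x - a))) volume :=
      (hVψi.const_mul p).add (h2.const_mul q)
    rw [integral_add h3 (hui.const_mul a), integral_const_mul, hint0,
      integral_add (hVψi.const_mul p) (h2.const_mul q), integral_const_mul, integral_const_mul]
    ring
  rw [hsplit] at hvar
  have hI1 := mul_nonneg hp0 (integral_nonneg_of_ae hVψnn)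
  have hI2 := integral_nonneg_of_ae hVφnn
  have hI2' : ∫ x, -(φ x * (V x - a)) = 0 :=
    le_antisymm (nonpos_of_mul_nonpos_right (by linarith) hq0) hI2
  filter_upwards [(integral_eq_zero_iff_of_nonneg_ae hVφnn hVφi.neg).1 hI2'] with x hx hx0
  by_contra! hlt
  have h1 : 0 < φ x := mul_pos hx0 (lt_max_of_lt_left (by linarith))
  have h2 : -(φ x * (V x - a)) = 0 := hx
  nlinarith

/-- If the potential vanishes on `{f < 1}` then it equals its maximal value on `{f > 0}`. -/
lemma potential_eq_of_potential_eq_zero (hKnonneg : ∀ x, 0 ≤ K x)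
    (hK : Integrable K volume) (hf : memA m f)
    (h0 : ∀ᵐ x ∂(volume : Measure (EuclideanSpace ℝ (Fin N))), f x < 1 → potential K f x = 0) :
    ∀ᵐ x ∂(volume : Measure (EuclideanSpace ℝ (Fin N))),
      0 < f x → potential K f x = ∫ y, K y := by
  obtain ⟨hfi, hf01, hfm⟩ := hf
  have hint : Integrable (fun x => f x * potential K f x) volume :=
    (integrable_potential_s15 hK hfi).bdd_mul hfi.aestronglyMeasurable
      (norm_le_one_of_mem_unitInterval hf01)
  have hfV : ∫ x, f x * potential K f x = (∫ x, f x) * ∫ y, K y := by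
    rw [← integral_potential hK hfi]
    refine integral_congr_ae ?_
    filter_upwards [hf01, h0] with x hx hx0
    rcases hx.2.lt_or_eq with h | h
    · simp [hx0 h]
    · simp [h]
  have hnn : 0 ≤ᵐ[volume] fun x => f x * (∫ y, K y) - f x * potential K f x :=
    hf01.mono fun x hx => sub_nonneg.2
      (mul_le_mul_of_nonneg_left (potential_le hKnonneg hK hfi hf01 x) hx.1)
  have hzero : ∫ x, (f x * (∫ y, K y) - f x * potential K f x) = 0 := by
    rw [integral_sub (hfi.mul_const _) hint, integral_mul_const, hfV, sub_self]
  filter_upwards [(integral_eq_zero_iff_of_nonneg_ae hnn ((hfi.mul_const _).sub hint)).1 hzero]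
    with x hx hx0
  have h : f x * (∫ y, K y) - f x * potential K f x = 0 := hx
  exact (mul_left_cancel₀ hx0.ne' (sub_eq_zero.1 h)).symm

end NonlocalPerimeter

/-- Euler–Lagrange conditions: let `f ∈ A_m` minimize `P_K` over `A_m` and let
`V` be its potential. Then there is `c > 0` with `V = c` a.e. on `{0 < f < 1}`, `V ≥ c` a.e. on
`{f = 1}`, and `V ≤ c` a.e. on `{f = 0}`. -/
theorem euler_lagrange {N : ℕ} (K : EuclideanSpace ℝ (Fin N) → ℝ)
    (hKmeas : Measurable K) (hKnonneg : ∀ x, 0 ≤ K x)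
    (hKsymm : ∀ᵐ x ∂(volume : Measure (EuclideanSpace ℝ (Fin N))), K (-x) = K x)
    (hKL1 : Integrable K volume)
    (hKne : ¬ (∀ᵐ x ∂(volume : Measure (EuclideanSpace ℝ (Fin N))), K x = 0))
    (m : ℝ) (hm : 0 < m) (f : EuclideanSpace ℝ (Fin N) → ℝ) (hf : memA m f)
    (hmin : ∀ g : EuclideanSpace ℝ (Fin N) → ℝ, memA m g → PK K f ≤ PK K g) :
    ∃ c : ℝ, 0 < c ∧
      (∀ᵐ x ∂(volume : Measure (EuclideanSpace ℝ (Fin N))),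
        0 < f x → f x < 1 → potential K f x = c) ∧
      (∀ᵐ x ∂(volume : Measure (EuclideanSpace ℝ (Fin N))), f x = 1 → c ≤ potential K f x) ∧
      (∀ᵐ x ∂(volume : Measure (EuclideanSpace ℝ (Fin N))), f x = 0 → potential K f x ≤ c) := by
  obtain ⟨hfi, hf01, -⟩ := id hf
  have hV0 := potential_nonneg hKnonneg hf01
  have hVκ := potential_le hKnonneg hKL1 hfi hf01
  obtain ⟨c, hc, hle, hge⟩ : ∃ c : ℝ, 0 < c ∧
      (∀ᵐ x ∂(volume : Measure (EuclideanSpace ℝ (Fin N))), f x < 1 → potential K f x ≤ c) ∧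
      (∀ᵐ x ∂(volume : Measure (EuclideanSpace ℝ (Fin N))), 0 < f x → c ≤ potential K f x) := by
    by_cases h0 : ∀ᵐ x ∂(volume : Measure (EuclideanSpace ℝ (Fin N))),
        f x < 1 → potential K f x ≤ 0
    · have hκ : 0 < ∫ y, K y := by
        refine lt_of_le_of_ne (integral_nonneg hKnonneg) fun h => hKne ?_
        exact (integral_eq_zero_iff_of_nonneg hKnonneg hKL1).1 h.symm
      refine ⟨∫ y, K y, hκ, Eventually.of_forall fun x _ => hVκ x, ?_⟩
      filter_upwards [potential_eq_of_potential_eq_zero hKnonneg hKL1 hf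
        (h0.mono fun x hx h1 => le_antisymm (hx h1) (hV0 x))] with x hx hx0
      exact (hx hx0).ge
    · set S : Set ℝ := {a | ∀ᵐ x ∂(volume : Measure (EuclideanSpace ℝ (Fin N))),
        f x < 1 → potential K f x ≤ a}
      have hmem : ∀ a, a ∈ S ↔ ∀ᵐ x ∂(volume : Measure (EuclideanSpace ℝ (Fin N))),
        f x < 1 → potential K f x ≤ a := fun _ => Iff.rfl
      have hSne : S.Nonempty :=
        ⟨∫ y, K y, (hmem _).2 (Eventually.of_forall fun x _ => hVκ x)⟩
      have hSpos : ∀ a ∈ S, 0 ≤ a := by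
        intro a ha
        by_contra! hneg
        exact h0 (((hmem a).1 ha).mono fun x hx h1 => (hx h1).trans hneg.le)
      have hSbdd : BddBelow S := ⟨0, hSpos⟩
      have hle : ∀ᵐ x ∂(volume : Measure (EuclideanSpace ℝ (Fin N))),
          f x < 1 → potential K f x ≤ sInf S := by
        have h : ∀ r : ℚ, ∀ᵐ x ∂(volume : Measure (EuclideanSpace ℝ (Fin N))),
            sInf S < r → f x < 1 → potential K f x ≤ r := by
          intro r
          by_cases hr : sInf S < r
          · obtain ⟨a, ha, har⟩ := exists_lt_of_csInf_lt hSne hr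
            exact ((hmem a).1 ha).mono fun x hx _ h1 => (hx h1).trans har.le
          · exact Eventually.of_forall fun x h => absurd h hr
        filter_upwards [ae_all_iff.2 h] with x hx h1
        exact le_of_forall_lt_rat_imp_le fun r hr => hx r hr h1
      refine ⟨sInf S, ?_, hle, ?_⟩
      · refine lt_of_le_of_ne (le_csInf hSne hSpos) fun h => h0 ?_
        rwa [← h] at hle
      · have h : ∀ r : ℚ, ∀ᵐ x ∂(volume : Measure (EuclideanSpace ℝ (Fin N))),
            (r : ℝ) < sInf S → 0 < f x → (r : ℝ) ≤ potential K f x := by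
          intro r
          by_cases hr : (r : ℝ) < sInf S
          · rcases le_total 0 (r : ℝ) with hr0 | hr0
            · have hrS : (r : ℝ) ∉ S := fun hmem => (csInf_le hSbdd hmem).not_gt hr
              exact (le_potential_of_minimizer hKnonneg hKsymm hKL1 hf hmin hr0 hrS).mono
                fun x hx _ => hx
            · exact Eventually.of_forall fun x _ _ => hr0.trans (hV0 x)
          · exact Eventually.of_forall fun x h => absurd h hr
        filter_upwards [ae_all_iff.2 h] with x hx h1
        exact le_of_forall_rat_lt_imp_le fun r hr => hx r hr h1
  refine ⟨c, hc, ?_, ?_, ?_⟩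
  · filter_upwards [hle, hge] with x h1 h2 hx0 hx1 using le_antisymm (h1 hx1) (h2 hx0)
  · filter_upwards [hge] with x h2 hx using h2 (by rw [hx]; exact one_pos)
  · filter_upwards [hle] with x h1 hx using h1 (by rw [hx]; exact one_pos)
end
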